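/- Let q be a prime power and 0 < δ < 1/2 with r = 10/δ an integer. For all sufficiently large ℓ (with 2(1−δ)ℓ an integer) and all n sufficiently large in terms of q and ℓ, the following holds. Let T₁ be a table on Grass_q(n, 2ℓ) and T₂ a table on Grass_q(n, 2(1−δ)ℓ), and suppose T₁ and T₂ are ε-consistent for some ε ≥ 2q^{−2ℓ(1−1000δ)}. Then there exist positive integers r₁ and r₂ with r₁ + r₂ = r = 10/δ such that for at least a q^{−5ℓ²} fraction of the r₁-dimensional subspaces Q ⊆ F_q^n, there exists a subspace W ⊇ Q of codimension r₂ and an F_q-linear function g_{Q,W} : W → F_q such that g_{Q,W} restricted to L equals T₁[L] for at least a q^{−2ℓ(1−1000δ²)}/2 fraction of the subspaces L ∈ Grass_q(n, 2ℓ) with Q ⊆ L ⊆ W. -/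

import Mathlib

open Module

/-- The consistency probability of the `ℓ₂`-vs-`m`-dimensional subspace agreement test:
the fraction of pairs `R ⊆ L` with `dim L = ℓ₂`, `dim R = m`, on which `T₁[L]` restricted
to `R` coincides with `T₂[R]`. -/
noncomputable def consistFrac (F : Type) [Field F] (n ℓ₂ m : ℕ)
    (T₁ T₂ : (L : Submodule F (Fin n → F)) → (↥L →ₗ[F] F)) : ℝ :=
  (Nat.card {p : Submodule F (Fin n → F) × Submodule F (Fin n → F) //
      finrank F ↥p.1 = ℓ₂ ∧ finrank F ↥p.2 = m ∧ p.2 ≤ p.1 ∧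
        ∀ (x : Fin n → F) (hx2 : x ∈ p.2) (hx1 : x ∈ p.1),
          T₁ p.1 ⟨x, hx1⟩ = T₂ p.2 ⟨x, hx2⟩} : ℝ) /
    (Nat.card {p : Submodule F (Fin n → F) × Submodule F (Fin n → F) //
      finrank F ↥p.1 = ℓ₂ ∧ finrank F ↥p.2 = m ∧ p.2 ≤ p.1} : ℝ)

set_option linter.unusedSectionVars false

namespace LinFourier

open scoped Classical

section Instances

variable {K E X : Type} [Field K] [AddCommGroup E] [Module K E]
  [AddCommGroup X] [Module K X]

instance finite_linearMap [Finite E] [Finite X] : Finite (E →ₗ[K] X) :=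
  Finite.of_injective (fun f : E →ₗ[K] X => (f : E → X)) DFunLike.coe_injective

noncomputable instance fintype_linearMap [Finite E] [Finite X] : Fintype (E →ₗ[K] X) :=
  Fintype.ofFinite _

noncomputable instance fintype_submodule [Finite X] : Fintype (Submodule K X) :=
  Fintype.ofFinite _

end Instances

section Character

variable (K : Type) [Field K] [Fintype K]

lemma exists_nontrivial_addChar : ∃ ψ : AddChar K ℂ, ψ ≠ 1 := by
  obtain ⟨ψ, hψ⟩ := (AddChar.exists_apply_ne_zero (a := (1 : K))).2 one_ne_zero
  exact ⟨ψ, fun h => hψ (by rw [h]; rfl)⟩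

/-- A fixed nontrivial additive character of a finite field. -/
noncomputable def stdChar : AddChar K ℂ := (exists_nontrivial_addChar K).choose

lemma stdChar_ne_one : stdChar K ≠ 1 := (exists_nontrivial_addChar K).choose_spec

end Character

section Pair

variable {K E X : Type} [Field K] [Fintype K] [AddCommGroup E] [Module K E] [Finite E]
  [AddCommGroup X] [Module K X] [Finite X]

/-- The character of `Hom(E, X)` indexed by `S ∈ Hom(X, E)`. -/
noncomputable def pair (S : X →ₗ[K] E) (M : E →ₗ[K] X) : ℂ :=
  stdChar K (LinearMap.trace K E (S ∘ₗ M))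

lemma pair_comm (S : X →ₗ[K] E) (M : E →ₗ[K] X) : pair S M = pair M S := by
  unfold pair; rw [LinearMap.trace_comp_comm']

lemma norm_pair (S : X →ₗ[K] E) (M : E →ₗ[K] X) : ‖pair S M‖ = 1 :=
  AddChar.norm_apply _ _

lemma pair_add_left (S S' : X →ₗ[K] E) (M : E →ₗ[K] X) :
    pair (S + S') M = pair S M * pair S' M := by
  simp [pair, LinearMap.add_comp, AddChar.map_add_eq_mul]

lemma pair_neg_left (S : X →ₗ[K] E) (M : E →ₗ[K] X) : pair (-S) M = star (pair S M) := by
  simp [pair, LinearMap.neg_comp, AddChar.map_neg_eq_conj]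

lemma pair_sub_left (S S' : X →ₗ[K] E) (M : E →ₗ[K] X) :
    pair (S - S') M = pair S M * star (pair S' M) := by
  rw [sub_eq_add_neg, pair_add_left, pair_neg_left]

@[simp] lemma pair_zero_left (M : E →ₗ[K] X) : pair (0 : X →ₗ[K] E) M = 1 := by
  simp [pair]

@[simp] lemma pair_zero_right (S : X →ₗ[K] E) : pair S (0 : E →ₗ[K] X) = 1 := by
  simp [pair]

lemma sum_pair_right (S : X →ₗ[K] E) :
    ∑ M : E →ₗ[K] X, pair S M = if S = 0 then (Fintype.card (E →ₗ[K] X) : ℂ) else 0 := by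
  split_ifs with h
  · subst h; simp
  · let tr : (E →ₗ[K] X) →+ K :=
      { toFun := fun M => LinearMap.trace K E (S ∘ₗ M)
        map_zero' := by simp
        map_add' := fun M M' => by simp [LinearMap.comp_add] }
    have hne : (stdChar K).compAddMonoidHom tr ≠ 1 := by
      intro h1
      apply stdChar_ne_one K
      ext c
      obtain ⟨x, hx⟩ : ∃ x, S x ≠ 0 := by
        by_contra hc; push Not at hc; exact h (LinearMap.ext hc)
      obtain ⟨f, hf⟩ : ∃ f : Module.Dual K E, f (S x) ≠ 0 := by
        by_contra hc; push Not at hc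
        exact hx ((Module.forall_dual_apply_eq_zero_iff K _).1 hc)
      have h2 := DFunLike.congr_fun h1 (f.smulRight ((c / f (S x)) • x))
      have h3 : S ∘ₗ (f.smulRight ((c / f (S x)) • x)) = f.smulRight ((c / f (S x)) • S x) := by
        ext; simp
      simpa [tr, h3, LinearMap.trace_smulRight, hf] using h2
    have := AddChar.sum_eq_zero_of_ne_one hne
    simpa [tr, pair] using this

lemma sum_pair_left (M : E →ₗ[K] X) :
    ∑ S : X →ₗ[K] E, pair S M = if M = 0 then (Fintype.card (X →ₗ[K] E) : ℂ) else 0 := by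
  rw [← sum_pair_right M]; exact Finset.sum_congr rfl fun S _ => pair_comm S M

lemma card_linearMap :
    Fintype.card (E →ₗ[K] X) = Fintype.card K ^ (finrank K E * finrank K X) := by
  rw [← Module.finrank_linearMap (S := K)]
  rw [← Module.card_eq_pow_finrank (K := K) (V := E →ₗ[K] X)]

lemma card_linearMap_comm : Fintype.card (X →ₗ[K] E) = Fintype.card (E →ₗ[K] X) := by
  rw [card_linearMap, card_linearMap, mul_comm]

end Pair

/-- Average over a finite type. -/
noncomputable def avg {ι : Type} [Fintype ι] (f : ι → ℂ) : ℂ :=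
  (Fintype.card ι : ℂ)⁻¹ * ∑ i, f i

section Fourier

variable {K E X : Type} [Field K] [Fintype K] [AddCommGroup E] [Module K E] [Finite E]
  [AddCommGroup X] [Module K X] [Finite X]

/-- Fourier coefficient. -/
noncomputable def hat (F : (E →ₗ[K] X) → ℂ) (S : X →ₗ[K] E) : ℂ :=
  avg fun M => F M * pair S M

/-- Fourier synthesis. -/
noncomputable def syn (g : (X →ₗ[K] E) → ℂ) (M : E →ₗ[K] X) : ℂ :=
  ∑ S, g S * star (pair S M)

lemma card_hom_ne_zero : (Fintype.card (E →ₗ[K] X) : ℂ) ≠ 0 := by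
  exact_mod_cast Fintype.card_ne_zero

lemma hat_syn (g : (X →ₗ[K] E) → ℂ) (S : X →ₗ[K] E) : hat (syn g) S = g S := by
  unfold hat syn avg
  simp_rw [Finset.sum_mul]
  rw [Finset.sum_comm]
  have : ∀ S' : X →ₗ[K] E, ∑ M : E →ₗ[K] X, g S' * star (pair S' M) * pair S M =
      if S' = S then g S' * (Fintype.card (E →ₗ[K] X) : ℂ) else 0 := by
    intro S'
    have h := sum_pair_right (S - S')
    simp_rw [pair_sub_left] at h
    calc _ = g S' * ∑ M : E →ₗ[K] X, pair S M * star (pair S' M) := by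
          rw [Finset.mul_sum]; exact Finset.sum_congr rfl fun _ _ => by ring
      _ = _ := by rw [h]; simp only [sub_eq_zero, eq_comm (a := S)]; split_ifs <;> simp
  simp_rw [this]
  simp only [Finset.sum_ite_eq', Finset.mem_univ, if_true]
  field_simp [card_hom_ne_zero]

lemma syn_hat (F : (E →ₗ[K] X) → ℂ) (M : E →ₗ[K] X) : syn (hat F) M = F M := by
  unfold hat syn avg
  simp_rw [mul_assoc, Finset.sum_mul]
  rw [← Finset.mul_sum, Finset.sum_comm]
  have : ∀ M' : E →ₗ[K] X, ∑ S : X →ₗ[K] E, F M' * pair S M' * star (pair S M) =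
      if M' = M then F M' * (Fintype.card (E →ₗ[K] X) : ℂ) else 0 := by
    intro M'
    have h := sum_pair_left (M' - M)
    have h2 : ∀ S : X →ₗ[K] E, pair S (M' - M) = pair S M' * star (pair S M) := by
      intro S; rw [pair_comm, pair_sub_left, pair_comm M', pair_comm M]
    simp_rw [h2] at h
    calc _ = F M' * ∑ S : X →ₗ[K] E, pair S M' * star (pair S M) := by
          rw [Finset.mul_sum]; exact Finset.sum_congr rfl fun _ _ => by ring
      _ = _ := by rw [h, card_linearMap_comm]; simp only [sub_eq_zero]; split_ifs <;> simp
  simp_rw [this]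
  simp only [Finset.sum_ite_eq', Finset.mem_univ, if_true]
  field_simp [card_hom_ne_zero]

lemma avg_mul_syn (F : (E →ₗ[K] X) → ℂ) (u : (X →ₗ[K] E) → ℂ) :
    avg (fun M => F M * star (syn u M)) = ∑ S, star (u S) * hat F S := by
  unfold hat syn avg
  simp only [star_sum, star_mul', star_star, Finset.mul_sum]
  rw [Finset.sum_comm]
  refine Finset.sum_congr rfl fun S _ => Finset.sum_congr rfl fun M _ => by ring

lemma avg_mul_syn_syn (F : (E →ₗ[K] X) → ℂ) (u v : (X →ₗ[K] E) → ℂ) :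
    avg (fun M => F M * star (syn u M) * syn v M) =
      ∑ S, ∑ S', hat F (S - S') * star (u S) * v S' := by
  have h : ∀ M : E →ₗ[K] X, F M * star (syn u M) * syn v M =
      ∑ S, ∑ S', F M * pair (S - S') M * star (u S) * v S' := by
    intro M
    unfold syn
    simp only [star_sum, star_mul', star_star, Finset.mul_sum, Finset.sum_mul]
    rw [Finset.sum_comm]
    refine Finset.sum_congr rfl fun S _ => Finset.sum_congr rfl fun S' _ => ?_
    rw [pair_sub_left]; ring
  unfold hat avg
  simp_rw [h, Finset.mul_sum, Finset.sum_mul]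
  rw [Finset.sum_comm]
  refine Finset.sum_congr rfl fun S _ => ?_
  rw [Finset.sum_comm]
  refine Finset.sum_congr rfl fun S' _ => Finset.sum_congr rfl fun M _ => by ring

lemma parseval (u v : (X →ₗ[K] E) → ℂ) :
    avg (fun M => syn v M * star (syn u M)) = ∑ S, star (u S) * v S := by
  rw [avg_mul_syn]; simp_rw [hat_syn]

end Fourier

section Count

instance finite_quotient {K X : Type} [Field K] [AddCommGroup X] [Module K X] [Finite X]
    (Y : Submodule K X) : Finite (X ⧸ Y) :=
  Finite.of_surjective Y.mkQ Y.mkQ_surjective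

variable {K E X : Type} [Field K] [Fintype K] [AddCommGroup E] [Module K E] [Finite E]
  [AddCommGroup X] [Module K X] [Finite X]

/-- Codimension of a subspace. -/
noncomputable def cod (Y : Submodule K X) : ℕ := finrank K (X ⧸ Y)

/-- Rank of a linear map. -/
noncomputable def rk (S : X →ₗ[K] E) : ℕ := finrank K (LinearMap.range S)

lemma cod_add_finrank (Y : Submodule K X) : cod Y + finrank K Y = finrank K X :=
  Submodule.finrank_quotient_add_finrank Y

lemma rk_eq_cod_ker (S : X →ₗ[K] E) : rk S = cod (LinearMap.ker S) :=
  (LinearMap.quotKerEquivRange S).finrank_eq.symm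

lemma cod_antitone {Y Y' : Submodule K X} (h : Y ≤ Y') : cod Y' ≤ cod Y := by
  have := Submodule.finrank_mono h
  have := cod_add_finrank Y
  have := cod_add_finrank Y'
  omega

lemma cod_inf_add_cod_sup (Y Y' : Submodule K X) :
    cod (Y ⊓ Y') + cod (Y ⊔ Y') = cod Y + cod Y' := by
  have := Submodule.finrank_sup_add_finrank_inf_eq Y Y'
  have := cod_add_finrank Y
  have := cod_add_finrank Y'
  have := cod_add_finrank (Y ⊓ Y')
  have := cod_add_finrank (Y ⊔ Y')
  omega

lemma card_submodule_le : Fintype.card (Submodule K X) ≤ 2 ^ Fintype.card K ^ finrank K X := by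
  have : Fintype X := Fintype.ofFinite X
  rw [← Module.card_eq_pow_finrank (K := K) (V := X), ← Fintype.card_set]
  exact Fintype.card_le_of_injective (fun Y : Submodule K X => (Y : Set X)) SetLike.coe_injective

lemma card_submodule_ge_le (Y : Submodule K X) :
    Fintype.card {I : Submodule K X // Y ≤ I} ≤ 2 ^ Fintype.card K ^ cod Y := by
  refine le_trans (le_of_eq ?_) (card_submodule_le (K := K) (X := X ⧸ Y))
  exact Fintype.card_congr (Submodule.comapMkQRelIso Y).toEquiv.symm

/-- Linear maps with kernel `Y` are the injective maps on the quotient. -/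
noncomputable def kerEquiv (Y : Submodule K X) :
    {S : X →ₗ[K] E // LinearMap.ker S = Y} ≃ {T : (X ⧸ Y) →ₗ[K] E // LinearMap.ker T = ⊥} where
  toFun S := ⟨Y.liftQ S.1 S.2.ge, by
    rw [Submodule.ker_liftQ, S.2, Submodule.mkQ_map_self]⟩
  invFun T := ⟨T.1 ∘ₗ Y.mkQ, by rw [LinearMap.ker_comp, T.2]; exact Y.ker_mkQ⟩
  left_inv S := by ext; simp
  right_inv T := by ext; simp

lemma card_ker_eq (Y : Submodule K X) (h : cod Y ≤ finrank K E) :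
    Fintype.card {S : X →ₗ[K] E // LinearMap.ker S = Y} =
      ∏ i : Fin (cod Y), (Fintype.card K ^ finrank K E - Fintype.card K ^ (i : ℕ)) := by
  have hE : Fintype E := Fintype.ofFinite E
  rw [← card_linearIndependent h, ← Nat.card_eq_fintype_card]
  refine Nat.card_congr ((kerEquiv Y).trans ?_)
  let b := Module.finBasis K (X ⧸ Y)
  refine ((b.constr K).toEquiv.subtypeEquiv fun f => ?_).symm
  constructor
  · intro hf
    have h1 : LinearMap.ker (b.constr K f) = ⊥ := by
      rw [LinearMap.ker_eq_bot']
      intro x hx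
      rw [Module.Basis.constr_apply_fintype] at hx
      have := Fintype.linearIndependent_iff.1 hf _ hx
      exact b.equivFun.map_eq_zero_iff.1 (funext this)
    exact h1
  · intro hf
    have hf : LinearMap.ker (b.constr K f) = ⊥ := hf
    have := b.linearIndependent.map' (b.constr K f) hf
    have h2 : (b.constr K f) ∘ b = f := by funext i; simp
    rwa [h2] at this

lemma exists_ker_eq (Y : Submodule K X) (h : cod Y ≤ finrank K E) :
    ∃ S : X →ₗ[K] E, LinearMap.ker S = Y := by
  have : 0 < Fintype.card {S : X →ₗ[K] E // LinearMap.ker S = Y} := by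
    rw [card_ker_eq Y h]
    refine Finset.prod_pos fun i _ => ?_
    have : (i : ℕ) < finrank K E := lt_of_lt_of_le i.2 h
    have := Nat.pow_lt_pow_right (Fintype.one_lt_card (α := K)) this
    omega
  obtain ⟨S⟩ := Fintype.card_pos_iff.1 this
  exact ⟨S.1, S.2⟩

lemma pow_le_card_ker_eq (Y : Submodule K X) (h : cod Y ≤ finrank K E) :
    Fintype.card K ^ (finrank K E * cod Y) ≤
      2 ^ cod Y * Fintype.card {S : X →ₗ[K] E // LinearMap.ker S = Y} := by
  rw [card_ker_eq Y h, pow_mul]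
  calc _ = ∏ i : Fin (cod Y), Fintype.card K ^ finrank K E := by simp
    _ ≤ ∏ i : Fin (cod Y), (2 * (Fintype.card K ^ finrank K E - Fintype.card K ^ (i : ℕ))) := by
        refine Finset.prod_le_prod' fun i _ => ?_
        have h1 : (i : ℕ) + 1 ≤ finrank K E := lt_of_lt_of_le i.2 h
        have h2 := Nat.pow_le_pow_right (Fintype.card_pos (α := K)) h1
        have h3 : 2 * Fintype.card K ^ (i : ℕ) ≤ Fintype.card K ^ ((i : ℕ) + 1) := by
          rw [pow_succ, mul_comm]; exact Nat.mul_le_mul_left _ (Fintype.one_lt_card (α := K))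
        omega
    _ = _ := by rw [Finset.prod_mul_distrib]; simp

lemma card_ker_eq_mul_le {E₁ : Type} [AddCommGroup E₁] [Module K E₁] [Finite E₁] {k : ℕ}
    (hk : finrank K E₁ + k = finrank K E) (Y : Submodule K X) (h : cod Y ≤ finrank K E₁) :
    Fintype.card K ^ (k * cod Y) * Fintype.card {S : X →ₗ[K] E₁ // LinearMap.ker S = Y} ≤
      Fintype.card {S : X →ₗ[K] E // LinearMap.ker S = Y} := by
  rw [card_ker_eq Y h, card_ker_eq Y (by omega), pow_mul]
  calc _ = ∏ i : Fin (cod Y), (Fintype.card K ^ k *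
        (Fintype.card K ^ finrank K E₁ - Fintype.card K ^ (i : ℕ))) := by
          rw [Finset.prod_mul_distrib]; simp
    _ ≤ _ := by
      refine Finset.prod_le_prod' fun i _ => ?_
      rw [Nat.mul_sub, ← pow_add, ← hk, add_comm k]
      have : Fintype.card K ^ (i : ℕ) ≤ Fintype.card K ^ k * Fintype.card K ^ (i : ℕ) :=
        Nat.le_mul_of_pos_left _ (pow_pos Fintype.card_pos _)
      omega

lemma exists_equiv_of_ker_eq {S S' : X →ₗ[K] E} (h : LinearMap.ker S = LinearMap.ker S') :
    ∃ g : E ≃ₗ[K] E, S' = g.toLinearMap ∘ₗ S := by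
  let f : LinearMap.range S ≃ₗ[K] LinearMap.range S' :=
    S.quotKerEquivRange.symm.trans ((Submodule.quotEquivOfEq _ _ h).trans S'.quotKerEquivRange)
  obtain ⟨g, hg⟩ := Submodule.exists_linearEquiv_restrict_eq f
  refine ⟨g, LinearMap.ext fun x => ?_⟩
  have := hg ⟨S x, x, rfl⟩
  rw [LinearMap.comp_apply, LinearEquiv.coe_coe, ← this]
  simp only [f, LinearEquiv.trans_apply]
  have h1 : S.quotKerEquivRange.symm ⟨S x, x, rfl⟩ = Submodule.Quotient.mk x := by
    rw [LinearEquiv.symm_apply_eq]; rfl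
  rw [h1]; rfl

end Count

section Invariant

variable {K E X : Type} [Field K] [Fintype K] [AddCommGroup E] [Module K E] [Finite E]
  [AddCommGroup X] [Module K X] [Finite X]

/-- Invariance under the change of basis of the source. -/
def Inv (F : (E →ₗ[K] X) → ℂ) : Prop :=
  ∀ (g : E ≃ₗ[K] E) (M : E →ₗ[K] X), F (M ∘ₗ g.toLinearMap) = F M

/-- The common value of the Fourier coefficients at the maps with kernel `Y`. -/
noncomputable def phi (F : (E →ₗ[K] X) → ℂ) (Y : Submodule K X) : ℂ :=
  if h : ∃ S : X →ₗ[K] E, LinearMap.ker S = Y then hat F h.choose else 0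

lemma hat_comp_equiv {F : (E →ₗ[K] X) → ℂ} (hF : Inv F) (g : E ≃ₗ[K] E) (S : X →ₗ[K] E) :
    hat F (g.toLinearMap ∘ₗ S) = hat F S := by
  unfold hat avg
  congr 1
  refine Fintype.sum_equiv (g.arrowCongr (LinearEquiv.refl K X)).toEquiv.symm _ _ fun M => ?_
  have h1 : (g.arrowCongr (LinearEquiv.refl K X)).toEquiv.symm M = M ∘ₗ g.toLinearMap := by
    ext; simp
  rw [h1, hF]
  congr 1
  rw [pair_comm, pair_comm S]
  rfl

lemma hat_eq_phi {F : (E →ₗ[K] X) → ℂ} (hF : Inv F) (S : X →ₗ[K] E) :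
    hat F S = phi F (LinearMap.ker S) := by
  have h : ∃ S' : X →ₗ[K] E, LinearMap.ker S' = LinearMap.ker S := ⟨S, rfl⟩
  rw [phi, dif_pos h]
  obtain ⟨g, hg⟩ := exists_equiv_of_ker_eq h.choose_spec
  conv_lhs => rw [hg]
  exact hat_comp_equiv hF g _

lemma phi_eq_hat {F : (E →ₗ[K] X) → ℂ} (hF : Inv F) {S : X →ₗ[K] E} {Y : Submodule K X}
    (h : LinearMap.ker S = Y) : phi F Y = hat F S := by
  subst h; exact (hat_eq_phi hF S).symm

/-- Fourier weight of rank `c`. -/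
noncomputable def Wt (c : ℕ) (F : (E →ₗ[K] X) → ℂ) : ℝ :=
  ∑ S : X →ₗ[K] E, if rk S = c then ‖hat F S‖ ^ 2 else 0

lemma sum_ker {R : Type} [AddCommMonoid R] (f : Submodule K X → R) :
    ∑ S : X →ₗ[K] E, f (LinearMap.ker S) =
      ∑ Y : Submodule K X, Fintype.card {S : X →ₗ[K] E // LinearMap.ker S = Y} • f Y := by
  rw [← Finset.sum_fiberwise (g := fun S : X →ₗ[K] E => LinearMap.ker S)]
  refine Finset.sum_congr rfl fun Y _ => ?_
  rw [Finset.sum_congr rfl (g := fun _ => f Y) (by intro S hS; rw [(Finset.mem_filter.1 hS).2]),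
    Finset.sum_const, Fintype.card_subtype]

lemma Wt_eq_sum {F : (E →ₗ[K] X) → ℂ} (hF : Inv F) (c : ℕ) :
    Wt c F = ∑ Y : Submodule K X, if cod Y = c then
      Fintype.card {S : X →ₗ[K] E // LinearMap.ker S = Y} * ‖phi F Y‖ ^ 2 else 0 := by
  unfold Wt
  simp_rw [hat_eq_phi hF, rk_eq_cod_ker]
  rw [sum_ker (E := E) (fun Y : Submodule K X => if cod Y = c then ‖phi F Y‖ ^ 2 else 0)]
  refine Finset.sum_congr rfl fun Y _ => ?_
  split_ifs <;> simp

lemma Wt_nonneg (c : ℕ) (F : (E →ₗ[K] X) → ℂ) : 0 ≤ Wt c F :=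
  Finset.sum_nonneg fun S _ => by split_ifs <;> positivity

lemma sum_sq_phi_le_Wt {F : (E →ₗ[K] X) → ℂ} (hF : Inv F) {c : ℕ} (hc : c ≤ finrank K E) :
    (Fintype.card K : ℝ) ^ (finrank K E * c) *
      (∑ Y : Submodule K X, if cod Y = c then ‖phi F Y‖ ^ 2 else 0) ≤ 2 ^ c * Wt c F := by
  rw [Wt_eq_sum hF, Finset.mul_sum, Finset.mul_sum]
  refine Finset.sum_le_sum fun Y _ => ?_
  split_ifs with h
  · subst h
    rw [← mul_assoc]
    refine mul_le_mul_of_nonneg_right ?_ (by positivity)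
    exact_mod_cast pow_le_card_ker_eq Y hc
  · simp

end Invariant

section Zoom

variable {K E X : Type} [Field K] [Fintype K] [AddCommGroup E] [Module K E] [Finite E]
  [AddCommGroup X] [Module K X] [Finite X]
  {P E' : Type} [AddCommGroup P] [Module K P] [Finite P]
  [AddCommGroup E'] [Module K E'] [Finite E']
  {Y : Type} [AddCommGroup Y] [Module K Y] [Finite Y]

/-- Restriction of the target along `ι`. -/
def zout (F : (E →ₗ[K] X) → ℂ) (ι : Y →ₗ[K] X) (y : E →ₗ[K] Y) : ℂ := F (ι ∘ₗ y)

/-- Prescribing the values on the factor `P` of the source. -/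
def zin (F : (E →ₗ[K] X) → ℂ) (θ : (P × E') ≃ₗ[K] E) (ζ : P →ₗ[K] X) (y : E' →ₗ[K] X) : ℂ :=
  F ((LinearMap.coprod ζ y) ∘ₗ θ.symm.toLinearMap)

lemma hat_sum {ι : Type} [Fintype ι] (f : ι → (E →ₗ[K] X) → ℂ) (S : X →ₗ[K] E) :
    hat (fun M => ∑ i, f i M) S = ∑ i, hat (f i) S := by
  unfold hat avg
  simp_rw [Finset.sum_mul]
  rw [Finset.sum_comm, Finset.mul_sum]

lemma hat_const_mul_star_pair (a : ℂ) (T S : X →ₗ[K] E) :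
    hat (fun M => a * star (pair T M)) S = if T = S then a else 0 := by
  have h := hat_syn (fun T' => if T' = T then a else 0) S
  have h2 : syn (fun T' : X →ₗ[K] E => if T' = T then a else 0) =
      fun M => a * star (pair T M) := by
    funext M; simp [syn]
  rw [h2] at h; rw [h]; simp only [eq_comm]

lemma hat_zout (F : (E →ₗ[K] X) → ℂ) (ι : Y →ₗ[K] X) (S : Y →ₗ[K] E) :
    hat (zout F ι) S = ∑ T : X →ₗ[K] E with T ∘ₗ ι = S, hat F T := by
  have h : zout F ι = fun y => ∑ T : X →ₗ[K] E, hat F T * star (pair (T ∘ₗ ι) y) := by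
    funext y
    rw [zout, ← syn_hat F]; rfl
  rw [h, hat_sum, Finset.sum_filter]
  exact Finset.sum_congr rfl fun T _ => hat_const_mul_star_pair _ _ _

lemma hat_zin (F : (E →ₗ[K] X) → ℂ) (θ : (P × E') ≃ₗ[K] E) (ζ : P →ₗ[K] X) (S : X →ₗ[K] E') :
    hat (zin F θ ζ) S =
      ∑ ρ : X →ₗ[K] P, hat F (θ.toLinearMap ∘ₗ LinearMap.prod ρ S) * star (pair ρ ζ) := by
  have h : zin F θ ζ = fun y => ∑ T : (X →ₗ[K] P) × (X →ₗ[K] E'),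
      (hat F (θ.toLinearMap ∘ₗ LinearMap.prod T.1 T.2) * star (pair T.1 ζ)) *
        star (pair T.2 y) := by
    funext y
    rw [zin, ← syn_hat F, syn]
    refine (Fintype.sum_equiv ((LinearMap.prodEquiv K).toEquiv.trans
      ((LinearEquiv.refl K X).arrowCongr θ).toEquiv) _ _ fun T => ?_).symm
    have h1 : ((LinearMap.prodEquiv K).toEquiv.trans
      ((LinearEquiv.refl K X).arrowCongr θ).toEquiv) T =
        θ.toLinearMap ∘ₗ LinearMap.prod T.1 T.2 := by
      ext; rfl
    rw [h1, mul_assoc, ← star_mul']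
    congr 2
    rw [pair_comm T.1, pair_comm T.2, pair_comm (θ.toLinearMap ∘ₗ _)]
    unfold pair
    rw [← AddChar.map_add_eq_mul, ← map_add]
    congr 2
    ext x; simp
  rw [h, hat_sum, Fintype.sum_prod_type]
  refine Finset.sum_congr rfl fun ρ _ => ?_
  simp_rw [hat_const_mul_star_pair]
  simp

lemma Inv.zout {F : (E →ₗ[K] X) → ℂ} (hF : Inv F) (ι : Y →ₗ[K] X) : Inv (zout F ι) :=
  fun g M => hF g (ι ∘ₗ M)

lemma Inv.zin {F : (E →ₗ[K] X) → ℂ} (hF : Inv F) (θ : (P × E') ≃ₗ[K] E) (ζ : P →ₗ[K] X) :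
    Inv (zin F θ ζ) := by
  intro g M
  have := hF (θ.symm.trans (((LinearEquiv.refl K P).prodCongr g).trans θ))
    ((LinearMap.coprod ζ M) ∘ₗ θ.symm.toLinearMap)
  unfold LinFourier.zin
  rw [← this]
  congr 1
  ext x
  simp

end Zoom

section ZoomOutBound

variable {K E X : Type} [Field K] [Fintype K] [AddCommGroup E] [Module K E] [Finite E]
  [AddCommGroup X] [Module K X] [Finite X]

lemma cod_ker_dual {p : X →ₗ[K] K} {x₀ : X} (h : p x₀ = 1) : cod (LinearMap.ker p) = 1 := by
  rw [← rk_eq_cod_ker, rk, LinearMap.range_eq_top.2, finrank_top, finrank_self]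
  intro a; exact ⟨a • x₀, by simp [h]⟩

lemma cod_inf_ker_dual {p : X →ₗ[K] K} {x₀ : X} (h : p x₀ = 1) {Y : Submodule K X}
    (hY : ¬ Y ≤ LinearMap.ker p) : cod (Y ⊓ LinearMap.ker p) = cod Y + 1 := by
  have h1 := cod_inf_add_cod_sup Y (LinearMap.ker p)
  rw [cod_ker_dual h] at h1
  have h2 : cod (Y ⊔ LinearMap.ker p) < 1 := by
    have := Submodule.finrank_lt_finrank_of_lt (right_lt_sup.2 hY)
    have h3 := cod_add_finrank (Y ⊔ LinearMap.ker p)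
    have h4 := cod_add_finrank (LinearMap.ker p)
    rw [cod_ker_dual h] at h4
    omega
  omega

lemma cod_comap_subtype {W Y : Submodule K X} (h : Y ≤ W) :
    cod (Y.comap W.subtype) + cod W = cod Y := by
  have h1 := cod_add_finrank (Y.comap W.subtype)
  have h2 := cod_add_finrank W
  have h3 := cod_add_finrank Y
  have h4 := (Submodule.comapSubtypeEquivOfLe h).finrank_eq
  omega

lemma sq_phi_le_of_hyperplane {G : (E →ₗ[K] X) → ℂ} (hG : Inv G) {p : X →ₗ[K] K} {x₀ : X}
    (hx : p x₀ = 1) {r : ℕ} (hr : r + 1 ≤ finrank K E) {Y : Submodule K X}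
    (hYp : Y ≤ LinearMap.ker p) (hY : cod Y = r + 1) :
    ((Fintype.card K : ℝ) ^ finrank K E) ^ 2 * ‖phi G Y‖ ^ 2 ≤
      8 * ‖phi (zout G (LinearMap.ker p).subtype) (Y.comap (LinearMap.ker p).subtype)‖ ^ 2 +
      8 * ((Fintype.card K : ℝ) ^ r) ^ 2 *
        ∑ Y' : Submodule K X with Y' ⊓ LinearMap.ker p = Y ∧ cod Y' = r, ‖phi G Y'‖ ^ 2 := by
  have hE : Fintype E := Fintype.ofFinite E
  set W := LinearMap.ker p
  set q : ℝ := (Fintype.card K : ℝ)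
  have hcod : cod (Y.comap W.subtype) = r := by
    have := cod_comap_subtype hYp
    rw [cod_ker_dual hx] at this; omega
  obtain ⟨S, hS⟩ := exists_ker_eq (E := E) (Y.comap W.subtype) (by omega)
  have hrk : finrank K (LinearMap.range S) = r := by rw [← hcod, ← hS]; exact rk_eq_cod_ker S
  obtain ⟨T₀, hT₀⟩ := LinearMap.exists_extend S
  set A : Finset (X →ₗ[K] E) := Finset.univ.filter fun T => T ∘ₗ W.subtype = S
  have hsum : phi (zout G W.subtype) (Y.comap W.subtype) = ∑ T ∈ A, phi G (LinearMap.ker T) := by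
    rw [phi_eq_hat (hG.zout _) hS, hat_zout]
    exact Finset.sum_congr rfl fun T _ => hat_eq_phi hG T
  have hker : ∀ T ∈ A, LinearMap.ker T ⊓ W = Y := by
    intro T hT
    have hT : T ∘ₗ W.subtype = S := (Finset.mem_filter.1 hT).2
    ext x
    constructor
    · rintro ⟨h1, h2⟩
      have : (⟨x, h2⟩ : W) ∈ LinearMap.ker S := by
        rw [← hT]; exact h1
      rw [hS] at this; exact this
    · intro h
      refine ⟨?_, hYp h⟩
      have : (⟨x, hYp h⟩ : W) ∈ LinearMap.ker S := by rw [hS]; exact h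
      rw [← hT] at this; exact this
  have hgood : ∀ T ∈ A.filter (fun T => LinearMap.ker T ≤ W), LinearMap.ker T = Y := by
    intro T hT
    have := hker T (Finset.mem_filter.1 hT).1
    rwa [inf_eq_left.2 (Finset.mem_filter.1 hT).2] at this
  have hbad : (A.filter (fun T => ¬ LinearMap.ker T ≤ W)).card ≤ Fintype.card K ^ r := by
    have hR : Fintype.card (LinearMap.range S) = Fintype.card K ^ r := by
      rw [Module.card_eq_pow_finrank (K := K), hrk]
    rw [← hR, ← Fintype.card_coe]
    refine Fintype.card_le_of_injective (fun T => ⟨T.1 x₀, ?_⟩) ?_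
    · obtain ⟨h1, h2⟩ := Finset.mem_filter.1 T.2
      have h1 : T.1 ∘ₗ W.subtype = S := (Finset.mem_filter.1 h1).2
      obtain ⟨y, hy, hyW⟩ := SetLike.not_le_iff_exists.1 h2
      have hpy : p y ≠ 0 := hyW
      refine ⟨⟨x₀ - (p y)⁻¹ • y, by simp [W, hx, hpy]⟩, ?_⟩
      rw [← h1]
      have hy : T.1 y = 0 := hy
      simp [hy]
    · intro T T' h
      have h : T.1 x₀ = T'.1 x₀ := congrArg Subtype.val h
      have h1 : T.1 ∘ₗ W.subtype = S := (Finset.mem_filter.1 (Finset.mem_filter.1 T.2).1).2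
      have h2 : T'.1 ∘ₗ W.subtype = S := (Finset.mem_filter.1 (Finset.mem_filter.1 T'.2).1).2
      ext x
      have h3 := LinearMap.congr_fun (h1.trans h2.symm) ⟨x - p x • x₀, by simp [W, hx]⟩
      simp only [LinearMap.comp_apply, Submodule.subtype_apply, map_sub, map_smul, h] at h3
      exact sub_left_injective h3
  have htot : Fintype.card K ^ finrank K E ≤ A.card := by
    rw [← Module.card_eq_pow_finrank (K := K) (V := E), ← Fintype.card_coe A]
    refine Fintype.card_le_of_injective (fun e => ⟨T₀ + p.smulRight e, ?_⟩) ?_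
    · refine Finset.mem_filter.2 ⟨Finset.mem_univ _, ?_⟩
      ext w
      have : p w = 0 := w.2
      simp [this, ← hT₀]
    · intro e e' h
      have h : T₀ + p.smulRight e = T₀ + p.smulRight e' := congrArg Subtype.val h
      have := LinearMap.congr_fun h x₀
      simpa [hx] using this
  set B := A.filter (fun T => ¬ LinearMap.ker T ≤ W)
  set Gd := A.filter (fun T => LinearMap.ker T ≤ W)
  have hcard : Gd.card + B.card = A.card := Finset.card_filter_add_card_filter_not _
  have hGd : q ^ finrank K E ≤ 2 * Gd.card := by
    have h1 := Nat.pow_le_pow_right (Fintype.card_pos (α := K)) hr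
    have h3 : 2 * Fintype.card K ^ r ≤ Fintype.card K ^ (r + 1) := by
      rw [pow_succ, mul_comm]; exact Nat.mul_le_mul_left _ (Fintype.one_lt_card (α := K))
    have : Fintype.card K ^ finrank K E ≤ 2 * Gd.card := by omega
    rw [show q = (Fintype.card K : ℝ) from rfl]; exact_mod_cast this
  have hsplit : phi (zout G W.subtype) (Y.comap W.subtype) =
      Gd.card * phi G Y + ∑ T ∈ B, phi G (LinearMap.ker T) := by
    rw [hsum, ← Finset.sum_filter_add_sum_filter_not A (fun T => LinearMap.ker T ≤ W)]
    congr 1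
    rw [Finset.sum_congr rfl (fun T hT => by rw [hgood T hT]), Finset.sum_const, nsmul_eq_mul]
  set τ : ℝ := ∑ Y' : Submodule K X with Y' ⊓ W = Y ∧ cod Y' = r, ‖phi G Y'‖ ^ 2
  have hB1 : ∀ T ∈ B, ‖phi G (LinearMap.ker T)‖ ^ 2 ≤ τ := by
    intro T hT
    obtain ⟨h1, h2⟩ := Finset.mem_filter.1 hT
    refine Finset.single_le_sum (f := fun Y' => ‖phi G Y'‖ ^ 2) (fun _ _ => by positivity)
      (Finset.mem_filter.2 ⟨Finset.mem_univ _, hker T h1, ?_⟩)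
    have := cod_inf_ker_dual hx h2
    rw [hker T h1, hY] at this; omega
  have hτ : 0 ≤ τ := Finset.sum_nonneg fun _ _ => by positivity
  have hB2 : ‖∑ T ∈ B, phi G (LinearMap.ker T)‖ ≤ q ^ r * Real.sqrt τ := by
    calc _ ≤ ∑ T ∈ B, ‖phi G (LinearMap.ker T)‖ := norm_sum_le _ _
      _ ≤ ∑ T ∈ B, Real.sqrt τ := Finset.sum_le_sum fun T hT => Real.le_sqrt_of_sq_le (hB1 T hT)
      _ = B.card * Real.sqrt τ := by simp
      _ ≤ _ := by
        gcongr
        rw [show q = (Fintype.card K : ℝ) from rfl]; exact_mod_cast hbad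
  set x := ‖phi (zout G W.subtype) (Y.comap W.subtype)‖
  set y := q ^ r * Real.sqrt τ
  have h1 : Gd.card * ‖phi G Y‖ ≤ x + y := by
    calc _ = ‖(Gd.card : ℂ) * phi G Y‖ := by simp
      _ = ‖phi (zout G W.subtype) (Y.comap W.subtype) - ∑ T ∈ B, phi G (LinearMap.ker T)‖ := by
          rw [hsplit]; congr 1; ring
      _ ≤ _ := (norm_sub_le _ _).trans (by gcongr)
  have h2 : q ^ finrank K E * ‖phi G Y‖ ≤ 2 * (x + y) := by
    have := mul_le_mul_of_nonneg_right hGd (norm_nonneg (phi G Y))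
    linarith
  have h3 : (q ^ finrank K E * ‖phi G Y‖) ^ 2 ≤ (2 * (x + y)) ^ 2 :=
    pow_le_pow_left₀ (by positivity) h2 2
  have h4 : y ^ 2 = (q ^ r) ^ 2 * τ := by rw [mul_pow, Real.sq_sqrt hτ]
  nlinarith [sq_nonneg (x - y)]

lemma sum_sq_phi_le_of_cod_eq_zero {G : (E →ₗ[K] X) → ℂ} (hG : Inv G) {c : ℕ}
    (hc : c ≤ finrank K E) :
    (Fintype.card K : ℝ) ^ (finrank K E * c) *
      ∑ Y : Submodule K X with cod Y = c, ‖phi G Y‖ ^ 2 ≤ 2 ^ c * Wt c G := by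
  rw [Finset.sum_filter]; exact sum_sq_phi_le_Wt hG hc

lemma exists_dual_of_cod_pos {I : Submodule K X} (h : 0 < cod I) :
    ∃ (p : X →ₗ[K] K) (x₀ : X), p x₀ = 1 ∧ I ≤ LinearMap.ker p := by
  have hI : I < ⊤ := by
    rw [lt_top_iff_ne_top]; rintro rfl
    have := cod_add_finrank (⊤ : Submodule K X)
    rw [finrank_top] at this; omega
  obtain ⟨p, hp, hIp⟩ := Submodule.exists_le_ker_of_lt_top I hI
  obtain ⟨x, hx⟩ : ∃ x, p x ≠ 0 := by
    by_contra hc; push Not at hc; exact hp (LinearMap.ext hc)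
  exact ⟨p, (p x)⁻¹ • x, by simp [hx], hIp⟩

/-- A bound for the Fourier coefficients at the subspaces of a given subspace of codimension `b`,
in terms of the weights of the restrictions to subspaces of codimension at most `b`. -/
theorem exists_sum_sq_phi_le (K : Type) [Field K] [Fintype K] (b c : ℕ) :
    ∃ C : ℝ, 0 ≤ C ∧ ∀ (E X : Type) [AddCommGroup E] [Module K E] [Finite E]
      [AddCommGroup X] [Module K X] [Finite X] (G : (E →ₗ[K] X) → ℂ) (Ω : ℝ), Inv G →
      b + c + 1 ≤ finrank K E →
      (∀ (Y : Type) [AddCommGroup Y] [Module K Y] [Finite Y] (ι : Y →ₗ[K] X),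
        Function.Injective ι → finrank K X ≤ finrank K Y + b → Wt c (zout G ι) ≤ Ω) →
      ∀ I : Submodule K X, cod I = b →
        (Fintype.card K : ℝ) ^ (finrank K E * (2 * b + c)) *
          ∑ Y : Submodule K X with Y ≤ I ∧ cod Y = b + c, ‖phi G Y‖ ^ 2 ≤ C * Ω := by
  induction b with
  | zero =>
    refine ⟨2 ^ c, by positivity, ?_⟩
    intro E X _ _ _ _ _ _ G Ω hG hN hW I hI
    have h1 := hW X LinearMap.id Function.injective_id (by simp)
    have h2 : zout G LinearMap.id = G := by funext y; simp [zout]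
    rw [h2] at h1
    have hI' : I = ⊤ := by
      have := cod_add_finrank I
      exact Submodule.eq_top_of_finrank_eq (by omega)
    subst hI'
    have := sum_sq_phi_le_of_cod_eq_zero hG (c := c) (by omega)
    simp only [le_top, true_and, mul_zero, zero_add]
    exact this.trans (by gcongr)
  | succ b ih =>
    obtain ⟨C, hC0, hC⟩ := ih
    set q : ℝ := (Fintype.card K : ℝ)
    refine ⟨8 * C + 8 * (q ^ (b + c)) ^ 2 * (2 ^ Fintype.card K ^ (b + 1) * C), by positivity, ?_⟩
    intro E X _ _ _ _ _ _ G Ω hG hN hW I hI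
    have hΩ : 0 ≤ Ω := (Wt_nonneg _ _).trans (hW X LinearMap.id Function.injective_id (by simp))
    obtain ⟨p, x₀, hx, hIp⟩ := exists_dual_of_cod_pos (I := I) (by omega)
    set W := LinearMap.ker p with hWdef
    have hWrk : finrank K X = finrank K W + 1 := by
      have := cod_add_finrank W
      rw [cod_ker_dual hx] at this; omega
    set N := finrank K E
    -- the restriction to the hyperplane
    have hA : q ^ (N * (2 * b + c)) * ∑ Y : Submodule K X with Y ≤ I ∧ cod Y = b + 1 + c,
        ‖phi (zout G W.subtype) (Y.comap W.subtype)‖ ^ 2 ≤ C * Ω := by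
      have := hC E W (zout G W.subtype) Ω (hG.zout _) (by omega) (fun Y _ _ _ ι hι hY =>
        hW Y (W.subtype ∘ₗ ι) (W.injective_subtype.comp hι) (by omega)) (I.comap W.subtype)
        (by have := cod_comap_subtype hIp; rw [cod_ker_dual hx] at this; omega)
      refine le_trans ?_ this
      refine mul_le_mul_of_nonneg_left ?_ (by positivity)
      rw [← Finset.sum_image (s := Finset.univ.filter fun Y : Submodule K X =>
        Y ≤ I ∧ cod Y = b + 1 + c) (g := fun Y => Y.comap W.subtype)
        (f := fun Z => ‖phi (zout G W.subtype) Z‖ ^ 2)]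
      · refine Finset.sum_le_sum_of_subset_of_nonneg ?_ (fun _ _ _ => by positivity)
        intro Z hZ
        obtain ⟨Y, hY, rfl⟩ := Finset.mem_image.1 hZ
        obtain ⟨h1, h2⟩ := (Finset.mem_filter.1 hY).2
        refine Finset.mem_filter.2 ⟨Finset.mem_univ _, Submodule.comap_mono h1, ?_⟩
        have := cod_comap_subtype (h1.trans hIp)
        rw [cod_ker_dual hx] at this; omega
      · intro Y hY Y' hY' h
        have h1 := (Finset.mem_filter.1 hY).2.1.trans hIp
        have h2 := (Finset.mem_filter.1 hY').2.1.trans hIp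
        have := congrArg (Submodule.map W.subtype) h
        simpa [Submodule.map_comap_subtype, inf_eq_right.2 h1, inf_eq_right.2 h2] using this
    -- the exceptional extensions
    have hB : q ^ (N * (2 * b + c)) * ∑ Y : Submodule K X with Y ≤ I ∧ cod Y = b + 1 + c,
        ∑ Y' : Submodule K X with Y' ⊓ W = Y ∧ cod Y' = b + c, ‖phi G Y'‖ ^ 2 ≤
          2 ^ Fintype.card K ^ (b + 1) * (C * Ω) := by
      have h1 : ∑ Y : Submodule K X with Y ≤ I ∧ cod Y = b + 1 + c,
          ∑ Y' : Submodule K X with Y' ⊓ W = Y ∧ cod Y' = b + c, ‖phi G Y'‖ ^ 2 ≤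
          ∑ I' : Submodule K X with I ≤ I' ∧ cod I' = b,
            ∑ Y' : Submodule K X with Y' ≤ I' ∧ cod Y' = b + c, ‖phi G Y'‖ ^ 2 := by
        have e1 : ∀ Y : Submodule K X, ∑ Y' : Submodule K X with Y' ⊓ W = Y ∧ cod Y' = b + c,
            ‖phi G Y'‖ ^ 2 = ∑ Y' : Submodule K X,
              if Y' ⊓ W = Y ∧ cod Y' = b + c then ‖phi G Y'‖ ^ 2 else 0 := fun Y => by
          rw [Finset.sum_filter]
        have e2 : ∀ I' : Submodule K X, ∑ Y' : Submodule K X with Y' ≤ I' ∧ cod Y' = b + c,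
            ‖phi G Y'‖ ^ 2 = ∑ Y' : Submodule K X,
              if Y' ≤ I' ∧ cod Y' = b + c then ‖phi G Y'‖ ^ 2 else 0 := fun I' => by
          rw [Finset.sum_filter]
        simp_rw [e1, e2]
        rw [Finset.sum_comm, Finset.sum_comm (s := Finset.univ.filter fun I' => _)]
        refine Finset.sum_le_sum fun Y' _ => ?_
        have hnn : ∀ I' : Submodule K X, 0 ≤
            if Y' ≤ I' ∧ cod Y' = b + c then ‖phi G Y'‖ ^ 2 else 0 := fun I' => by
          split_ifs <;> positivity
        by_cases h : (Y' ⊓ W ≤ I ∧ cod (Y' ⊓ W) = b + 1 + c) ∧ cod Y' = b + c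
        · obtain ⟨⟨h1, h2⟩, h3⟩ := h
          have hle : ¬ Y' ≤ W := fun hle => by rw [inf_eq_left.2 hle] at h2; omega
          have hmem : Y' ⊔ I ∈ Finset.univ.filter fun I' : Submodule K X =>
              I ≤ I' ∧ cod I' = b := by
            refine Finset.mem_filter.2 ⟨Finset.mem_univ _, le_sup_right, ?_⟩
            have h4 : (Y' ⊔ I) ⊓ W = I := by
              rw [sup_comm, sup_inf_assoc_of_le _ hIp, sup_eq_left.2 h1]
            have := cod_inf_ker_dual hx (Y := Y' ⊔ I) (fun h => hle (le_sup_left.trans h))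
            rw [← hWdef, h4, hI] at this; omega
          refine le_trans ?_ (Finset.single_le_sum (f := fun I' : Submodule K X =>
            if Y' ≤ I' ∧ cod Y' = b + c then ‖phi G Y'‖ ^ 2 else 0) (fun I' _ => hnn I') hmem)
          rw [Finset.sum_eq_single (Y' ⊓ W)]
          · simp [h3]
          · intro Y _ hne; rw [if_neg]; rintro ⟨h, _⟩; exact hne h.symm
          · intro hn; exact (hn (Finset.mem_filter.2 ⟨Finset.mem_univ _, h1, h2⟩)).elim
        · rw [Finset.sum_eq_zero]
          · exact Finset.sum_nonneg fun I' _ => hnn I'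
          · intro Y hY
            rw [if_neg]
            rintro ⟨rfl, h3⟩
            exact h ⟨(Finset.mem_filter.1 hY).2, h3⟩
      calc _ ≤ q ^ (N * (2 * b + c)) * ∑ I' : Submodule K X with I ≤ I' ∧ cod I' = b,
            ∑ Y' : Submodule K X with Y' ≤ I' ∧ cod Y' = b + c, ‖phi G Y'‖ ^ 2 :=
            mul_le_mul_of_nonneg_left h1 (by positivity)
        _ ≤ ∑ I' : Submodule K X with I ≤ I' ∧ cod I' = b, C * Ω := by
            rw [Finset.mul_sum]
            refine Finset.sum_le_sum fun I' hI' => ?_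
            exact hC E X G Ω hG (by omega) (fun Y _ _ _ ι hι hY => hW Y ι hι (by omega)) I'
              (Finset.mem_filter.1 hI').2.2
        _ ≤ _ := by
            rw [Finset.sum_const, nsmul_eq_mul]
            refine mul_le_mul_of_nonneg_right ?_ (by positivity)
            have h2 := card_submodule_ge_le I
            rw [hI, Fintype.card_subtype] at h2
            refine le_trans (Nat.cast_le.2 (Finset.card_le_card ?_)) (le_trans (Nat.cast_le.2 h2) ?_)
            · intro I' hI'
              exact Finset.mem_filter.2 ⟨Finset.mem_univ _, (Finset.mem_filter.1 hI').2.1⟩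
            · push_cast; rfl
    have hpt : (q ^ N) ^ 2 * ∑ Y : Submodule K X with Y ≤ I ∧ cod Y = b + 1 + c, ‖phi G Y‖ ^ 2 ≤
        8 * ∑ Y : Submodule K X with Y ≤ I ∧ cod Y = b + 1 + c,
          ‖phi (zout G W.subtype) (Y.comap W.subtype)‖ ^ 2 +
        8 * (q ^ (b + c)) ^ 2 * ∑ Y : Submodule K X with Y ≤ I ∧ cod Y = b + 1 + c,
          ∑ Y' : Submodule K X with Y' ⊓ W = Y ∧ cod Y' = b + c, ‖phi G Y'‖ ^ 2 := by
      rw [Finset.mul_sum, Finset.mul_sum, Finset.mul_sum, ← Finset.sum_add_distrib]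
      refine Finset.sum_le_sum fun Y hY => ?_
      obtain ⟨h1, h2⟩ := (Finset.mem_filter.1 hY).2
      exact sq_phi_le_of_hyperplane hG hx (by omega) (h1.trans hIp) (by omega)
    have hpow : q ^ (N * (2 * (b + 1) + c)) = q ^ (N * (2 * b + c)) * (q ^ N) ^ 2 := by
      rw [← pow_mul, ← pow_add]; congr 1; ring
    rw [hpow, mul_assoc]
    refine (mul_le_mul_of_nonneg_left hpt (by positivity)).trans ?_
    have hB' := mul_le_mul_of_nonneg_left hB (show 0 ≤ 8 * (q ^ (b + c)) ^ 2 by positivity)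
    linarith

end ZoomOutBound

section CauchySchwarz

lemma norm_sq_sum_le_of_sq_le {ι : Type} (s : Finset ι) (T : ι → ℂ) (a b : ι → ℝ) {Γ : ℝ}
    (hΓ : 0 ≤ Γ) (ha : ∀ i ∈ s, 0 ≤ a i) (hb : ∀ i ∈ s, 0 ≤ b i)
    (h : ∀ i ∈ s, ‖T i‖ ^ 2 ≤ Γ * a i * b i) :
    ‖∑ i ∈ s, T i‖ ^ 2 ≤ Γ * (∑ i ∈ s, a i) * ∑ i ∈ s, b i := by
  have h1 : ‖∑ i ∈ s, T i‖ ≤ ∑ i ∈ s, Real.sqrt (Γ * a i) * Real.sqrt (b i) := by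
    refine (norm_sum_le _ _).trans (Finset.sum_le_sum fun i hi => ?_)
    rw [← Real.sqrt_mul (mul_nonneg hΓ (ha i hi))]
    exact Real.le_sqrt_of_sq_le (h i hi)
  calc _ ≤ (∑ i ∈ s, Real.sqrt (Γ * a i) * Real.sqrt (b i)) ^ 2 :=
        pow_le_pow_left₀ (norm_nonneg _) h1 2
    _ ≤ (∑ i ∈ s, Real.sqrt (Γ * a i) ^ 2) * ∑ i ∈ s, Real.sqrt (b i) ^ 2 :=
        Finset.sum_mul_sq_le_sq_mul_sq _ _ _
    _ = _ := by
        rw [Finset.sum_congr rfl fun i hi => Real.sq_sqrt (mul_nonneg hΓ (ha i hi)),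
          Finset.sum_congr rfl fun i hi => Real.sq_sqrt (hb i hi), ← Finset.mul_sum]

lemma norm_sq_sum_mul_le {ι : Type} (s : Finset ι) (f g : ι → ℂ) :
    ‖∑ i ∈ s, f i * g i‖ ^ 2 ≤ (∑ i ∈ s, ‖f i‖ ^ 2) * ∑ i ∈ s, ‖g i‖ ^ 2 := by
  calc _ ≤ (∑ i ∈ s, ‖f i‖ * ‖g i‖) ^ 2 := by
        refine pow_le_pow_left₀ (norm_nonneg _) ?_ 2
        exact (norm_sum_le _ _).trans (by simp)
    _ ≤ _ := Finset.sum_mul_sq_le_sq_mul_sq _ _ _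

end CauchySchwarz

lemma one_le_card (K : Type) [Field K] [Fintype K] : (1 : ℝ) ≤ (Fintype.card K : ℝ) := by
  exact_mod_cast (Fintype.card_pos (α := K))

section Surjective

variable {K X : Type} [Field K] [Fintype K] [AddCommGroup X] [Module K X] [Finite X]
  {P₁ P₂ : Type} [AddCommGroup P₁] [Module K P₁] [Finite P₁]
  [AddCommGroup P₂] [Module K P₂] [Finite P₂]

lemma card_le_ker (Y : Submodule K X) :
    (Finset.univ.filter fun A : X →ₗ[K] P₁ => Y ≤ LinearMap.ker A).card ≤
      Fintype.card K ^ (cod Y * finrank K P₁) := by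
  rw [cod, ← card_linearMap, ← Fintype.card_subtype]
  refine Fintype.card_le_of_injective (fun A => Y.liftQ A.1 A.2) fun A B h => ?_
  have := congrArg (fun f => f ∘ₗ Y.mkQ) h
  simp only [Submodule.liftQ_mkQ] at this
  exact Subtype.ext this

lemma cod_ker_of_surjective {A : X →ₗ[K] P₁} (h : LinearMap.range A = ⊤) :
    cod (LinearMap.ker A) = finrank K P₁ := by
  rw [← rk_eq_cod_ker, rk, h, finrank_top]

lemma sum_sum_ker_le_le (u : (X →ₗ[K] P₁) → ℂ) (hu : ∀ A, LinearMap.range A ≠ ⊤ → u A = 0) :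
    ∑ I : Submodule K X, ∑ A : X →ₗ[K] P₁ with LinearMap.ker A ≤ I, ‖u A‖ ^ 2 ≤
      2 ^ Fintype.card K ^ finrank K P₁ * ∑ A, ‖u A‖ ^ 2 := by
  simp_rw [Finset.sum_filter]
  rw [Finset.sum_comm, Finset.mul_sum]
  refine Finset.sum_le_sum fun A _ => ?_
  by_cases hA : LinearMap.range A = ⊤
  · rw [← Finset.sum_filter, Finset.sum_const, nsmul_eq_mul]
    refine mul_le_mul_of_nonneg_right ?_ (by positivity)
    have := card_submodule_ge_le (LinearMap.ker A)
    rw [cod_ker_of_surjective hA, Fintype.card_subtype] at this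
    exact_mod_cast this
  · simp [hu A hA]

/-- Bilinear forms whose kernel depends on the intersection of the two kernels. -/
lemma norm_sq_sum_inf_ker_le (κ : Submodule K X → ℂ) {Γ : ℝ} (hΓ : 0 ≤ Γ)
    (hκ : ∀ I : Submodule K X, ∑ Y : Submodule K X with
      Y ≤ I ∧ cod Y + cod I = finrank K P₁ + finrank K P₂, ‖κ Y‖ ^ 2 ≤ Γ)
    (u : (X →ₗ[K] P₁) → ℂ) (hu : ∀ A, LinearMap.range A ≠ ⊤ → u A = 0)
    (v : (X →ₗ[K] P₂) → ℂ) (hv : ∀ B, LinearMap.range B ≠ ⊤ → v B = 0) :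
    ‖∑ A, ∑ B, κ (LinearMap.ker A ⊓ LinearMap.ker B) * u A * v B‖ ^ 2 ≤
      (Fintype.card K : ℝ) ^ (finrank K P₁ + finrank K P₂) ^ 2 * 2 ^ Fintype.card K ^ finrank K P₁ *
        2 ^ Fintype.card K ^ finrank K P₂ * Γ * (∑ A, ‖u A‖ ^ 2) * ∑ B, ‖v B‖ ^ 2 := by
  set q : ℝ := (Fintype.card K : ℝ)
  set n := finrank K P₁ + finrank K P₂
  have hq : (1 : ℝ) ≤ q := one_le_card K
  let s (I : Submodule K X) : Finset ((X →ₗ[K] P₁) × (X →ₗ[K] P₂)) :=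
    Finset.univ.filter fun p => LinearMap.range p.1 = ⊤ ∧ LinearMap.range p.2 = ⊤ ∧
      LinearMap.ker p.1 ⊔ LinearMap.ker p.2 = I
  have hsum : ∑ A, ∑ B, κ (LinearMap.ker A ⊓ LinearMap.ker B) * u A * v B =
      ∑ I : Submodule K X, ∑ p ∈ s I,
        κ (LinearMap.ker p.1 ⊓ LinearMap.ker p.2) * (u p.1 * v p.2) := by
    rw [← Fintype.sum_prod_type (f := fun p : (X →ₗ[K] P₁) × (X →ₗ[K] P₂) =>
      κ (LinearMap.ker p.1 ⊓ LinearMap.ker p.2) * u p.1 * v p.2)]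
    rw [← Finset.sum_fiberwise (g := fun p : (X →ₗ[K] P₁) × (X →ₗ[K] P₂) =>
      LinearMap.ker p.1 ⊔ LinearMap.ker p.2)]
    refine Finset.sum_congr rfl fun I _ => ?_
    rw [Finset.sum_filter, Finset.sum_filter]
    refine Finset.sum_congr rfl fun p _ => ?_
    by_cases h1 : LinearMap.range p.1 = ⊤
    · by_cases h2 : LinearMap.range p.2 = ⊤
      · simp [h1, h2, mul_assoc]
      · simp [hv _ h2]
    · simp [hu _ h1]
  have hK : ∀ I : Submodule K X,
      ∑ p ∈ s I, ‖κ (LinearMap.ker p.1 ⊓ LinearMap.ker p.2)‖ ^ 2 ≤ q ^ n ^ 2 * Γ := by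
    intro I
    have hm : ∀ p ∈ s I, LinearMap.ker p.1 ⊓ LinearMap.ker p.2 ∈ Finset.univ.filter
        fun Y : Submodule K X => Y ≤ I ∧ cod Y + cod I = n := by
      intro p hp
      obtain ⟨-, h1, h2, h3⟩ := Finset.mem_filter.1 hp
      refine Finset.mem_filter.2 ⟨Finset.mem_univ _, ?_, ?_⟩
      · rw [← h3]; exact inf_le_left.trans le_sup_left
      · rw [← h3, cod_inf_add_cod_sup, cod_ker_of_surjective h1, cod_ker_of_surjective h2]
    rw [← Finset.sum_fiberwise_of_maps_to hm]
    refine le_trans ?_ (mul_le_mul_of_nonneg_left (hκ I) (by positivity))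
    rw [Finset.mul_sum]
    refine Finset.sum_le_sum fun Y hY => ?_
    rw [Finset.sum_congr rfl (g := fun _ => ‖κ Y‖ ^ 2)
      (by intro p hp; rw [(Finset.mem_filter.1 hp).2]), Finset.sum_const, nsmul_eq_mul]
    refine mul_le_mul_of_nonneg_right ?_ (by positivity)
    have hcY : cod Y ≤ n := by have := (Finset.mem_filter.1 hY).2.2; omega
    have h1 : (Finset.filter (fun p => LinearMap.ker p.1 ⊓ LinearMap.ker p.2 = Y) (s I)).card ≤
        Fintype.card K ^ (cod Y * finrank K P₁) * Fintype.card K ^ (cod Y * finrank K P₂) := by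
      refine le_trans ?_ (Nat.mul_le_mul (card_le_ker (P₁ := P₁) Y) (card_le_ker (P₁ := P₂) Y))
      rw [← Finset.card_product]
      refine Finset.card_le_card fun p hp => ?_
      obtain ⟨-, rfl⟩ := Finset.mem_filter.1 hp
      simp
    calc _ ≤ q ^ (cod Y * finrank K P₁) * q ^ (cod Y * finrank K P₂) := by
          rw [show q = (Fintype.card K : ℝ) from rfl]; exact_mod_cast h1
      _ = q ^ (cod Y * n) := by rw [← pow_add, ← mul_add]
      _ ≤ _ := pow_le_pow_right₀ hq (by rw [sq]; exact Nat.mul_le_mul_right _ hcY)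
  rw [hsum]
  refine (norm_sq_sum_le_of_sq_le Finset.univ _
    (fun I => ∑ A : X →ₗ[K] P₁ with LinearMap.ker A ≤ I, ‖u A‖ ^ 2)
    (fun I => ∑ B : X →ₗ[K] P₂ with LinearMap.ker B ≤ I, ‖v B‖ ^ 2)
    (Γ := q ^ n ^ 2 * Γ) (by positivity) (fun _ _ => Finset.sum_nonneg fun _ _ => by positivity)
    (fun _ _ => Finset.sum_nonneg fun _ _ => by positivity) fun I _ => ?_).trans ?_
  · refine (norm_sq_sum_mul_le _ _ _).trans ?_
    rw [mul_assoc (q ^ n ^ 2 * Γ)]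
    refine mul_le_mul (hK I) ?_ (Finset.sum_nonneg fun _ _ => by positivity) (by positivity)
    rw [Finset.sum_mul_sum, ← Finset.sum_product']
    refine (Finset.sum_le_sum_of_subset_of_nonneg
      (t := (Finset.univ.filter fun A : X →ₗ[K] P₁ => LinearMap.ker A ≤ I) ×ˢ
        (Finset.univ.filter fun B : X →ₗ[K] P₂ => LinearMap.ker B ≤ I)) (fun p hp => ?_)
      (fun _ _ _ => by positivity)).trans (le_of_eq ?_)
    · obtain ⟨-, -, -, h⟩ := Finset.mem_filter.1 hp
      simp [← h]
    · exact Finset.sum_congr rfl fun p _ => by rw [norm_mul, mul_pow]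
  · have h1 := sum_sum_ker_le_le u hu
    have h2 := sum_sum_ker_le_le v hv
    calc _ ≤ q ^ n ^ 2 * Γ * (2 ^ Fintype.card K ^ finrank K P₁ * ∑ A, ‖u A‖ ^ 2) *
          (2 ^ Fintype.card K ^ finrank K P₂ * ∑ B, ‖v B‖ ^ 2) := by
          refine mul_le_mul (mul_le_mul_of_nonneg_left h1 (by positivity)) h2
            (Finset.sum_nonneg fun _ _ => Finset.sum_nonneg fun _ _ => by positivity) (by positivity)
      _ = _ := by ring

end Surjective

section Block

variable {K X : Type} [Field K] [Fintype K] [AddCommGroup X] [Module K X] [Finite X]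
  {J P₁ P₂ : Type} [AddCommGroup J] [Module K J] [Finite J]
  [AddCommGroup P₁] [Module K P₁] [Finite P₁]
  [AddCommGroup P₂] [Module K P₂] [Finite P₂]

lemma sum_norm_sq_syn (u : (X →ₗ[K] J) → ℂ) :
    ∑ M, ‖syn u M‖ ^ 2 = Fintype.card (J →ₗ[K] X) * ∑ S, ‖u S‖ ^ 2 := by
  have h := parseval u u
  unfold avg at h
  rw [inv_mul_eq_iff_eq_mul₀ card_hom_ne_zero] at h
  have h1 : ∀ z : ℂ, z * star z = ((‖z‖ ^ 2 : ℝ) : ℂ) := fun z => by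
    have := Complex.mul_conj' z; push_cast; exact this
  simp_rw [mul_comm (star _), h1] at h
  exact_mod_cast h

/-- Partial Fourier synthesis along `J` of a function of the kernel. -/
noncomputable def kap (Φ : Submodule K X → ℂ) (ζ : J →ₗ[K] X) (Y : Submodule K X) : ℂ :=
  ∑ ρ : X →ₗ[K] J, Φ (LinearMap.ker ρ ⊓ Y) * star (pair ρ ζ)

lemma norm_sq_sum_block_le (Φ : Submodule K X → ℂ) {Γ : ℝ} (hΓ : 0 ≤ Γ)
    (hκ : ∀ (ζ : J →ₗ[K] X) (I : Submodule K X), ∑ Y : Submodule K X with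
      Y ≤ I ∧ cod Y + cod I = finrank K P₁ + finrank K P₂, ‖kap Φ ζ Y‖ ^ 2 ≤ Γ)
    (u : (X →ₗ[K] J) → (X →ₗ[K] P₁) → ℂ) (hu : ∀ σ A, LinearMap.range A ≠ ⊤ → u σ A = 0)
    (v : (X →ₗ[K] J) → (X →ₗ[K] P₂) → ℂ) (hv : ∀ τ B, LinearMap.range B ≠ ⊤ → v τ B = 0) :
    ‖∑ A, ∑ B, ∑ σ, ∑ τ, Φ (LinearMap.ker (σ - τ) ⊓ (LinearMap.ker A ⊓ LinearMap.ker B)) *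
        u σ A * v τ B‖ ^ 2 ≤
      (Fintype.card K : ℝ) ^ (finrank K P₁ + finrank K P₂) ^ 2 * 2 ^ Fintype.card K ^ finrank K P₁ *
        2 ^ Fintype.card K ^ finrank K P₂ * Γ * (∑ A, ∑ σ, ‖u σ A‖ ^ 2) * ∑ B, ∑ τ, ‖v τ B‖ ^ 2 := by
  set D : ℝ := (Fintype.card K : ℝ) ^ (finrank K P₁ + finrank K P₂) ^ 2 *
    2 ^ Fintype.card K ^ finrank K P₁ * 2 ^ Fintype.card K ^ finrank K P₂ * Γ
  let uh (ζ : J →ₗ[K] X) (A : X →ₗ[K] P₁) : ℂ := star (syn (fun σ => star (u σ A)) ζ)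
  let vh (ζ : J →ₗ[K] X) (B : X →ₗ[K] P₂) : ℂ := syn (fun τ => v τ B) ζ
  have h1 : ∀ A B, ∑ σ, ∑ τ, Φ (LinearMap.ker (σ - τ) ⊓ (LinearMap.ker A ⊓ LinearMap.ker B)) *
        u σ A * v τ B = (Fintype.card (J →ₗ[K] X) : ℂ)⁻¹ *
        ∑ ζ, kap Φ ζ (LinearMap.ker A ⊓ LinearMap.ker B) * uh ζ A * vh ζ B := by
    intro A B
    have := avg_mul_syn_syn
      (syn fun ρ : X →ₗ[K] J => Φ (LinearMap.ker ρ ⊓ (LinearMap.ker A ⊓ LinearMap.ker B)))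
      (fun σ => star (u σ A)) (fun τ => v τ B)
    simp only [hat_syn, star_star] at this
    rw [← this]; rfl
  have h2 : ∑ A, ∑ B, ∑ σ, ∑ τ, Φ (LinearMap.ker (σ - τ) ⊓ (LinearMap.ker A ⊓ LinearMap.ker B)) *
        u σ A * v τ B = (Fintype.card (J →ₗ[K] X) : ℂ)⁻¹ *
        ∑ ζ, ∑ A, ∑ B, kap Φ ζ (LinearMap.ker A ⊓ LinearMap.ker B) * uh ζ A * vh ζ B := by
    simp_rw [h1, ← Finset.mul_sum]
    congr 1
    rw [Finset.sum_comm, Finset.sum_congr rfl fun B _ => Finset.sum_comm]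
    rw [Finset.sum_comm]
    exact Finset.sum_congr rfl fun ζ _ => Finset.sum_comm
  have h3 := norm_sq_sum_le_of_sq_le Finset.univ
    (fun ζ : J →ₗ[K] X => ∑ A, ∑ B, kap Φ ζ (LinearMap.ker A ⊓ LinearMap.ker B) * uh ζ A * vh ζ B)
    (fun ζ => ∑ A, ‖uh ζ A‖ ^ 2) (fun ζ => ∑ B, ‖vh ζ B‖ ^ 2) (Γ := D) (by positivity)
    (fun _ _ => Finset.sum_nonneg fun _ _ => by positivity)
    (fun _ _ => Finset.sum_nonneg fun _ _ => by positivity) (fun ζ _ => by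
      refine norm_sq_sum_inf_ker_le (kap Φ ζ) hΓ (hκ ζ) _ (fun A hA => ?_) _ (fun B hB => ?_)
      · simp [uh, syn, hu _ A hA]
      · simp [vh, syn, hv _ B hB])
  have h4 : ∑ ζ : J →ₗ[K] X, ∑ A, ‖uh ζ A‖ ^ 2 =
      Fintype.card (J →ₗ[K] X) * ∑ A, ∑ σ, ‖u σ A‖ ^ 2 := by
    rw [Finset.sum_comm, Finset.mul_sum]
    refine Finset.sum_congr rfl fun A _ => ?_
    simp only [uh, norm_star, sum_norm_sq_syn]
  have h5 : ∑ ζ : J →ₗ[K] X, ∑ B, ‖vh ζ B‖ ^ 2 =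
      Fintype.card (J →ₗ[K] X) * ∑ B, ∑ σ, ‖v σ B‖ ^ 2 := by
    rw [Finset.sum_comm, Finset.mul_sum]
    refine Finset.sum_congr rfl fun A _ => ?_
    simp only [vh, sum_norm_sq_syn]
  rw [h4, h5] at h3
  rw [h2, norm_mul, mul_pow, norm_inv, Complex.norm_natCast]
  have hc : (0 : ℝ) < Fintype.card (J →ₗ[K] X) := by exact_mod_cast Fintype.card_pos
  rw [inv_pow, inv_mul_le_iff₀ (by positivity)]
  refine h3.trans (le_of_eq (by ring))

end Block

section Ranges

variable {K X : Type} [Field K] [Fintype K] [AddCommGroup X] [Module K X] [Finite X]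
  {E : Type} [AddCommGroup E] [Module K E] [Finite E]

lemma exists_complement_of_le {I Q : Submodule K E} (h : I ≤ Q) :
    ∃ P : Submodule K E, P ≤ Q ∧ I ⊓ P = ⊥ ∧ I ⊔ P = Q ∧
      finrank K P + finrank K I = finrank K Q := by
  obtain ⟨P, hP⟩ := exists_isCompl I
  have h1 : I ⊓ (P ⊓ Q) = ⊥ := by rw [← inf_assoc, hP.inf_eq_bot, bot_inf_eq]
  have h2 : I ⊔ P ⊓ Q = Q := by rw [← sup_inf_assoc_of_le _ h, hP.sup_eq_top, top_inf_eq]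
  refine ⟨P ⊓ Q, inf_le_right, h1, h2, ?_⟩
  have := Submodule.finrank_sup_add_finrank_inf_eq I (P ⊓ Q)
  rw [h1, h2, finrank_bot] at this
  omega

lemma card_finrank_inf_le (Q : Submodule K E) (e' i : ℕ) :
    (Finset.univ.filter fun Q' : Submodule K E =>
      finrank K Q' = e' ∧ finrank K ↥(Q ⊓ Q') = i).card ≤
      2 ^ Fintype.card K ^ finrank K Q * Fintype.card K ^ (finrank K E * (e' - i)) := by
  have hE : Fintype E := Fintype.ofFinite E
  have h1 : Fintype.card (Submodule K Q × (Fin (e' - i) → E)) ≤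
      2 ^ Fintype.card K ^ finrank K Q * Fintype.card K ^ (finrank K E * (e' - i)) := by
    rw [Fintype.card_prod, Fintype.card_fun, Fintype.card_fin,
      Module.card_eq_pow_finrank (K := K) (V := E), pow_mul]
    exact Nat.mul_le_mul_right _ card_submodule_le
  refine le_trans ?_ h1
  rw [← Finset.card_univ]
  refine Finset.card_le_card_of_surjOn
    (fun p => p.1.map Q.subtype ⊔ Submodule.span K (Set.range p.2)) ?_
  intro Q' hQ'
  obtain ⟨-, h2, h3⟩ := Finset.mem_filter.1 (Finset.mem_coe.1 hQ')
  obtain ⟨P, hPQ, -, hsup, hfin⟩ := exists_complement_of_le (inf_le_right : Q ⊓ Q' ≤ Q')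
  let b := Module.finBasisOfFinrankEq K P (show finrank K P = e' - i by omega)
  refine ⟨((Q ⊓ Q').comap Q.subtype, fun j => (b j : E)), by simp, ?_⟩
  have h4 : Submodule.span K (Set.range fun j => (b j : E)) = P := by
    have h5 : (Set.range fun j => (b j : E)) = P.subtype '' Set.range b := by
      rw [← Set.range_comp]; rfl
    rw [h5, Submodule.span_image, b.span_eq, Submodule.map_subtype_top]
  simp only [h4]
  rw [Submodule.map_comap_subtype, ← inf_assoc, inf_idem, hsup]

lemma exists_comp_eq {J P : Submodule K E} {S : X →ₗ[K] E} (h : LinearMap.range S ≤ J ⊔ P) :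
    ∃ (σ : X →ₗ[K] J) (A : X →ₗ[K] P), S = J.subtype ∘ₗ σ + P.subtype ∘ₗ A := by
  let c := LinearMap.coprod J.subtype P.subtype
  have hc : LinearMap.range c = J ⊔ P := by
    rw [LinearMap.range_coprod, Submodule.range_subtype, Submodule.range_subtype]
  obtain ⟨g, hg⟩ := (LinearMap.range c).subtype.exists_leftInverse_of_injective
    (Submodule.ker_subtype _)
  obtain ⟨s, hs⟩ := c.rangeRestrict.exists_rightInverse_of_surjective
    (LinearMap.range_rangeRestrict c)
  refine ⟨LinearMap.fst K J P ∘ₗ s ∘ₗ g ∘ₗ S, LinearMap.snd K J P ∘ₗ s ∘ₗ g ∘ₗ S, ?_⟩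
  ext x
  have hx : S x ∈ LinearMap.range c := by rw [hc]; exact h ⟨x, rfl⟩
  have h1 : g (S x) = ⟨S x, hx⟩ := LinearMap.congr_fun hg ⟨S x, hx⟩
  have h2 : c (s ⟨S x, hx⟩) = S x := congrArg Subtype.val (LinearMap.congr_fun hs ⟨S x, hx⟩)
  simp only [LinearMap.add_apply, LinearMap.comp_apply, h1]
  exact h2.symm

lemma subtype_add_injective {J P : Submodule K E} (h : J ⊓ P = ⊥) {a a' : J} {p p' : P}
    (he : (a : E) + p = a' + p') : a = a' ∧ p = p' := by
  have h1 : (a : E) - a' = p' - p := by rw [sub_eq_sub_iff_add_eq_add, he, add_comm]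
  have h2 : (a : E) - a' ∈ J ⊓ P :=
    ⟨J.sub_mem a.2 a'.2, by rw [h1]; exact P.sub_mem p'.2 p.2⟩
  rw [h, Submodule.mem_bot] at h2
  rw [h2] at h1
  exact ⟨Subtype.ext (sub_eq_zero.1 h2), Subtype.ext (sub_eq_zero.1 h1.symm).symm⟩

lemma sum_range_eq {R : Type} [AddCommMonoid R] {J P Q : Submodule K E} (h : J ⊓ P = ⊥)
    (hQ : J ⊔ P = Q) (f : (X →ₗ[K] E) → R) :
    ∑ S : X →ₗ[K] E with LinearMap.range S = Q, f S =
      ∑ A : X →ₗ[K] P, ∑ σ : X →ₗ[K] J,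
        if LinearMap.range (J.subtype ∘ₗ σ + P.subtype ∘ₗ A) = Q then
          f (J.subtype ∘ₗ σ + P.subtype ∘ₗ A) else 0 := by
  rw [← Fintype.sum_prod_type (f := fun p : (X →ₗ[K] P) × (X →ₗ[K] J) =>
    if LinearMap.range (J.subtype ∘ₗ p.2 + P.subtype ∘ₗ p.1) = Q then
          f (J.subtype ∘ₗ p.2 + P.subtype ∘ₗ p.1) else 0), ← Finset.sum_filter]
  symm
  refine Finset.sum_bij (fun p _ => J.subtype ∘ₗ p.2 + P.subtype ∘ₗ p.1) (fun p hp => ?_)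
    (fun p _ p' _ he => ?_) (fun S hS => ?_) (fun p _ => rfl)
  · simpa using hp
  · have h1 : ∀ x, p.2 x = p'.2 x ∧ p.1 x = p'.1 x := fun x =>
      subtype_add_injective h (LinearMap.congr_fun he x)
    exact Prod.ext (LinearMap.ext fun x => (h1 x).2) (LinearMap.ext fun x => (h1 x).1)
  · have hS : LinearMap.range S = Q := by simpa using hS
    obtain ⟨σ, A, hSA⟩ := exists_comp_eq (J := J) (P := P) (S := S) (by rw [hS, hQ])
    exact ⟨(A, σ), by simpa [← hSA] using hS, hSA.symm⟩

lemma range_eq_top_of_range_add {J P Q : Submodule K E} (h : J ⊓ P = ⊥) (hPQ : P ≤ Q)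
    {σ : X →ₗ[K] J} {A : X →ₗ[K] P}
    (hr : LinearMap.range (J.subtype ∘ₗ σ + P.subtype ∘ₗ A) = Q) : LinearMap.range A = ⊤ := by
  rw [LinearMap.range_eq_top]
  intro p
  have : (p : E) ∈ LinearMap.range (J.subtype ∘ₗ σ + P.subtype ∘ₗ A) := by rw [hr]; exact hPQ p.2
  obtain ⟨x, hx⟩ := this
  refine ⟨x, (subtype_add_injective h (a := σ x) (a' := 0) ?_).2⟩
  simpa using hx

lemma ker_sub_eq {Q Q' P P' : Submodule K E} (hP : P ≤ Q) (h : Q ⊓ Q' ⊓ P = ⊥)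
    (hP' : P' ≤ Q') (h' : Q ⊓ Q' ⊓ P' = ⊥)
    (σ τ : X →ₗ[K] ↥(Q ⊓ Q')) (A : X →ₗ[K] P) (B : X →ₗ[K] P') :
    LinearMap.ker (((Q ⊓ Q').subtype ∘ₗ σ + P.subtype ∘ₗ A) -
      ((Q ⊓ Q').subtype ∘ₗ τ + P'.subtype ∘ₗ B)) =
      LinearMap.ker (σ - τ) ⊓ (LinearMap.ker A ⊓ LinearMap.ker B) := by
  ext x
  simp only [LinearMap.mem_ker, LinearMap.sub_apply, LinearMap.add_apply, LinearMap.comp_apply,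
    Submodule.subtype_apply, Submodule.mem_inf]
  constructor
  · intro hx
    have h1 : ((A x : P) : E) = τ x - σ x + B x := by
      have : ((σ x : E) + A x) = τ x + B x := sub_eq_zero.1 hx
      rw [sub_add_eq_add_sub, ← this]; abel
    have hA : ((A x : P) : E) ∈ Q ⊓ Q' ⊓ P := by
      refine ⟨⟨hP (A x).2, ?_⟩, (A x).2⟩
      rw [h1]
      exact Q'.add_mem (Q'.sub_mem (τ x).2.2 (σ x).2.2) (hP' (B x).2)
    rw [h, Submodule.mem_bot] at hA
    rw [hA, add_zero] at hx
    have h2 : ((B x : P') : E) = σ x - τ x := by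
      have : (σ x : E) = τ x + B x := sub_eq_zero.1 hx
      rw [this]; abel
    have hB : ((B x : P') : E) ∈ Q ⊓ Q' ⊓ P' := by
      refine ⟨?_, (B x).2⟩
      rw [h2]; exact (Q ⊓ Q').sub_mem (σ x).2 (τ x).2
    rw [h', Submodule.mem_bot] at hB
    rw [hB] at h2
    refine ⟨Subtype.ext ?_, Subtype.ext hA, Subtype.ext hB⟩
    simpa using h2.symm
  · rintro ⟨h1, h2, h3⟩
    rw [h2, h3]
    have := congrArg Subtype.val h1
    simpa using this

lemma norm_sq_sum_range_le (Φ : Submodule K X → ℂ) (Q Q' : Submodule K E) {i₁ i₂ : ℕ}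
    (h₁ : i₁ + finrank K ↥(Q ⊓ Q') = finrank K Q) (h₂ : i₂ + finrank K ↥(Q ⊓ Q') = finrank K Q')
    {Γ : ℝ} (hΓ : 0 ≤ Γ)
    (hκ : ∀ (ζ : ↥(Q ⊓ Q') →ₗ[K] X) (I : Submodule K X), ∑ Y : Submodule K X with
      Y ≤ I ∧ cod Y + cod I = i₁ + i₂, ‖kap Φ ζ Y‖ ^ 2 ≤ Γ)
    (u v : (X →ₗ[K] E) → ℂ) :
    ‖∑ S : X →ₗ[K] E with LinearMap.range S = Q, ∑ S' : X →ₗ[K] E with LinearMap.range S' = Q',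
        Φ (LinearMap.ker (S - S')) * u S * v S'‖ ^ 2 ≤
      (Fintype.card K : ℝ) ^ (i₁ + i₂) ^ 2 * 2 ^ Fintype.card K ^ i₁ * 2 ^ Fintype.card K ^ i₂ * Γ *
        (∑ S : X →ₗ[K] E with LinearMap.range S = Q, ‖u S‖ ^ 2) *
        ∑ S : X →ₗ[K] E with LinearMap.range S = Q', ‖v S‖ ^ 2 := by
  obtain ⟨P, hPQ, hbot, hsup, hfin⟩ := exists_complement_of_le (inf_le_left : Q ⊓ Q' ≤ Q)
  obtain ⟨P', hPQ', hbot', hsup', hfin'⟩ := exists_complement_of_le (inf_le_right : Q ⊓ Q' ≤ Q')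
  have e1 : finrank K P = i₁ := by omega
  have e2 : finrank K P' = i₂ := by omega
  have key := norm_sq_sum_block_le (P₁ := P) (P₂ := P') Φ hΓ (by rw [e1, e2]; exact hκ)
    (fun σ A => if LinearMap.range ((Q ⊓ Q').subtype ∘ₗ σ + P.subtype ∘ₗ A) = Q then
      u ((Q ⊓ Q').subtype ∘ₗ σ + P.subtype ∘ₗ A) else 0)
    (fun σ A hA => if_neg fun h => hA (range_eq_top_of_range_add hbot hPQ h))
    (fun σ A => if LinearMap.range ((Q ⊓ Q').subtype ∘ₗ σ + P'.subtype ∘ₗ A) = Q' then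
      v ((Q ⊓ Q').subtype ∘ₗ σ + P'.subtype ∘ₗ A) else 0)
    (fun σ A hA => if_neg fun h => hA (range_eq_top_of_range_add hbot' hPQ' h))
  rw [e1, e2] at key
  convert key using 1
  · congr 2
    rw [sum_range_eq hbot hsup]
    refine Finset.sum_congr rfl fun A _ => ?_
    rw [Finset.sum_comm]
    refine Finset.sum_congr rfl fun σ _ => ?_
    rw [sum_range_eq hbot' hsup']
    by_cases hS : LinearMap.range ((Q ⊓ Q').subtype ∘ₗ σ + P.subtype ∘ₗ A) = Q
    · rw [if_pos hS]
      refine Finset.sum_congr rfl fun B _ => Finset.sum_congr rfl fun τ _ => ?_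
      rw [ker_sub_eq hPQ hbot hPQ' hbot', if_pos hS]
      split_ifs <;> simp
    · simp [hS]
  · rw [sum_range_eq hbot hsup, sum_range_eq hbot' hsup']
    congr 1
    · congr 1
      refine Finset.sum_congr rfl fun A _ => Finset.sum_congr rfl fun σ _ => ?_
      split_ifs <;> simp
    · refine Finset.sum_congr rfl fun A _ => Finset.sum_congr rfl fun σ _ => ?_
      split_ifs <;> simp

end Ranges

section Truncate

variable {K X : Type} [Field K] [Fintype K] [AddCommGroup X] [Module K X] [Finite X]
  {J : Type} [AddCommGroup J] [Module K J] [Finite J]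

/-- Restriction of a function on subspaces to those of codimension `d`. -/
noncomputable def trunc (d : ℕ) (φ : Submodule K X → ℂ) (Y : Submodule K X) : ℂ :=
  if cod Y = d then φ Y else 0

lemma cod_ker_inf (ρ : X →ₗ[K] J) (Y : Submodule K X) :
    cod (LinearMap.ker ρ ⊓ Y) = cod Y + finrank K (Y.map ρ) := by
  have h1 := LinearMap.finrank_range_add_finrank_ker (ρ.domRestrict Y)
  have h2 : LinearMap.range (ρ.domRestrict Y) = Y.map ρ := by
    rw [LinearMap.range_domRestrict]
  have h3 : LinearMap.ker (ρ.domRestrict Y) = (LinearMap.ker ρ ⊓ Y).comap Y.subtype := by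
    ext x; simp
  have h4 : finrank K ((LinearMap.ker ρ ⊓ Y).comap Y.subtype) =
      finrank K ↥(LinearMap.ker ρ ⊓ Y) :=
    (Submodule.comapSubtypeEquivOfLe inf_le_right).finrank_eq
  rw [h2, h3, h4] at h1
  have h5 := cod_add_finrank Y
  have h6 := cod_add_finrank (LinearMap.ker ρ ⊓ Y)
  omega

lemma sum_hom_isCompl {R : Type} [AddCommMonoid R] {J₀ J₁ : Submodule K J} (h : IsCompl J₀ J₁)
    (f : (X →ₗ[K] J) → R) :
    ∑ ρ, f ρ = ∑ ρ₀ : X →ₗ[K] J₀, ∑ ρ₁ : X →ₗ[K] J₁,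
      f (J₀.subtype ∘ₗ ρ₀ + J₁.subtype ∘ₗ ρ₁) := by
  rw [← Fintype.sum_prod_type (f := fun p : (X →ₗ[K] J₀) × (X →ₗ[K] J₁) =>
    f (J₀.subtype ∘ₗ p.1 + J₁.subtype ∘ₗ p.2))]
  symm
  refine Finset.sum_bij (fun p _ => J₀.subtype ∘ₗ p.1 + J₁.subtype ∘ₗ p.2)
    (fun p _ => Finset.mem_univ _) (fun p _ p' _ he => ?_) (fun S _ => ?_) (fun p _ => rfl)
  · have h1 : ∀ x, p.1 x = p'.1 x ∧ p.2 x = p'.2 x := fun x =>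
      subtype_add_injective h.inf_eq_bot (LinearMap.congr_fun he x)
    exact Prod.ext (LinearMap.ext fun x => (h1 x).1) (LinearMap.ext fun x => (h1 x).2)
  · obtain ⟨σ, A, hSA⟩ := exists_comp_eq (J := J₀) (P := J₁) (S := S)
      (by rw [h.sup_eq_top]; exact le_top)
    exact ⟨(σ, A), Finset.mem_univ _, hSA.symm⟩

lemma pair_subtype_comp {J₀ : Submodule K J} (ρ : X →ₗ[K] J₀) (ζ : J →ₗ[K] X) :
    pair (J₀.subtype ∘ₗ ρ) ζ = pair ρ (ζ ∘ₗ J₀.subtype) := by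
  unfold pair
  congr 1
  rw [LinearMap.comp_assoc, LinearMap.trace_comp_comm', LinearMap.comp_assoc]

lemma norm_sum_map_le_le (φ : Submodule K X → ℂ) (ζ : J →ₗ[K] X) (Y : Submodule K X)
    (J₀ : Submodule K J) :
    ‖∑ ρ : X →ₗ[K] J with Y.map ρ ≤ J₀, φ (LinearMap.ker ρ ⊓ Y) * star (pair ρ ζ)‖ ≤
      (Fintype.card K : ℝ) ^ (cod Y * finrank K J) * ‖kap φ (ζ ∘ₗ J₀.subtype) Y‖ := by
  obtain ⟨J₁, hJ⟩ := exists_isCompl J₀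
  have h1 : ∑ ρ : X →ₗ[K] J with Y.map ρ ≤ J₀, φ (LinearMap.ker ρ ⊓ Y) * star (pair ρ ζ) =
      kap φ (ζ ∘ₗ J₀.subtype) Y *
        ∑ ρ₁ : X →ₗ[K] J₁ with Y ≤ LinearMap.ker ρ₁, star (pair ρ₁ (ζ ∘ₗ J₁.subtype)) := by
    rw [Finset.sum_filter, sum_hom_isCompl hJ, kap, Finset.sum_mul]
    refine Finset.sum_congr rfl fun ρ₀ _ => ?_
    rw [Finset.mul_sum, Finset.sum_filter]
    refine Finset.sum_congr rfl fun ρ₁ _ => ?_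
    have hc : Y.map (J₀.subtype ∘ₗ ρ₀ + J₁.subtype ∘ₗ ρ₁) ≤ J₀ ↔ Y ≤ LinearMap.ker ρ₁ := by
      rw [Submodule.map_le_iff_le_comap]
      refine forall_congr' fun y => imp_congr_right fun _ => ?_
      simp only [Submodule.mem_comap, LinearMap.add_apply, LinearMap.comp_apply,
        Submodule.subtype_apply, LinearMap.mem_ker]
      rw [J₀.add_mem_iff_right (ρ₀ y).2]
      constructor
      · intro h
        have : ((ρ₁ y : J₁) : J) ∈ J₀ ⊓ J₁ := ⟨h, (ρ₁ y).2⟩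
        rw [hJ.inf_eq_bot, Submodule.mem_bot] at this
        exact Subtype.ext this
      · intro h; rw [h]; exact J₀.zero_mem
    simp only [hc]
    split_ifs with h
    · have hk : LinearMap.ker (J₀.subtype ∘ₗ ρ₀ + J₁.subtype ∘ₗ ρ₁) ⊓ Y =
          LinearMap.ker ρ₀ ⊓ Y := by
        ext y
        simp only [Submodule.mem_inf, LinearMap.mem_ker, LinearMap.add_apply,
          LinearMap.comp_apply, Submodule.subtype_apply]
        refine and_congr_left fun hy => ?_
        rw [show ρ₁ y = 0 from h hy]
        simp
      rw [hk, pair_add_left, star_mul', pair_subtype_comp, pair_subtype_comp, mul_assoc]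
    · rfl
  rw [h1, norm_mul, mul_comm]
  refine mul_le_mul_of_nonneg_right ?_ (norm_nonneg _)
  refine (norm_sum_le _ _).trans ?_
  simp only [norm_star, norm_pair, Finset.sum_const, nsmul_eq_mul, mul_one]
  have h2 := card_le_ker (P₁ := J₁) Y
  have h3 : finrank K J₁ ≤ finrank K J := Submodule.finrank_le J₁
  calc _ ≤ (Fintype.card K : ℝ) ^ (cod Y * finrank K J₁) := by exact_mod_cast h2
    _ ≤ _ := pow_le_pow_right₀ (one_le_card K) (Nat.mul_le_mul_left _ h3)

lemma norm_kap_trunc_le (φ : Submodule K X → ℂ) (d : ℕ) (ζ : J →ₗ[K] X) (Y : Submodule K X) :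
    ‖kap (trunc d φ) ζ Y‖ ≤ (2 ^ Fintype.card K ^ finrank K J) *
      ((Fintype.card K : ℝ) ^ (cod Y * finrank K J) * (1 + 2 ^ Fintype.card K ^ finrank K J) ^ d) *
      ∑ J₀ ∈ Finset.univ.filter (fun J₀ : Submodule K J => finrank K J₀ + cod Y ≤ d),
        ‖kap φ (ζ ∘ₗ J₀.subtype) Y‖ := by
  set B : ℝ := 2 ^ Fintype.card K ^ finrank K J
  have hB : (Fintype.card (Submodule K J) : ℝ) ≤ B := by
    have := card_submodule_le (K := K) (X := J)
    calc (Fintype.card (Submodule K J) : ℝ) ≤ ((2 ^ Fintype.card K ^ finrank K J : ℕ) : ℝ) := by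
          exact_mod_cast this
      _ = B := by push_cast; rfl
  have hB0 : 0 ≤ B := by positivity
  set A : ℝ := (Fintype.card K : ℝ) ^ (cod Y * finrank K J)
  have hA : 0 ≤ A := by positivity
  set T : ℝ := ∑ J₀ ∈ Finset.univ.filter (fun J₀ : Submodule K J => finrank K J₀ + cod Y ≤ d),
        ‖kap φ (ζ ∘ₗ J₀.subtype) Y‖
  have hT : 0 ≤ T := Finset.sum_nonneg fun _ _ => norm_nonneg _
  let κ (J₀ : Submodule K J) : ℂ :=
    ∑ ρ : X →ₗ[K] J with Y.map ρ = J₀, φ (LinearMap.ker ρ ⊓ Y) * star (pair ρ ζ)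
  have hκ : ∀ j, ∀ J₀ : Submodule K J, finrank K J₀ = j → j + cod Y ≤ d →
      ‖κ J₀‖ ≤ A * (1 + B) ^ j * T := by
    intro j
    induction j using Nat.strong_induction_on with
    | _ j ih =>
    intro J₀ hj hjd
    have hsplit : κ J₀ = ∑ ρ : X →ₗ[K] J with Y.map ρ ≤ J₀,
        φ (LinearMap.ker ρ ⊓ Y) * star (pair ρ ζ) - ∑ J₁ with J₁ < J₀, κ J₁ := by
      rw [eq_sub_iff_add_eq]
      have hm : ∀ ρ ∈ Finset.univ.filter (fun ρ : X →ₗ[K] J => Y.map ρ ≤ J₀),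
          Y.map ρ ∈ Finset.univ.filter fun J₁ : Submodule K J => J₁ ≤ J₀ := by
        intro ρ hρ; simpa using hρ
      rw [← Finset.sum_fiberwise_of_maps_to hm]
      have hs : (Finset.univ.filter fun J₁ : Submodule K J => J₁ ≤ J₀) =
          insert J₀ (Finset.univ.filter fun J₁ : Submodule K J => J₁ < J₀) := by
        ext J₁; simp [le_iff_eq_or_lt]
      rw [hs, Finset.sum_insert (by simp)]
      congr 1
      · refine Finset.sum_congr ?_ fun _ _ => rfl
        ext ρ; simp +contextual
      · refine Finset.sum_congr rfl fun J₁ hJ₁ => Finset.sum_congr ?_ fun _ _ => rfl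
        have := (Finset.mem_filter.1 hJ₁).2
        ext ρ; simp +contextual [this.le]
    have hθ : ‖kap φ (ζ ∘ₗ J₀.subtype) Y‖ ≤ T :=
      Finset.single_le_sum (f := fun J₀ : Submodule K J => ‖kap φ (ζ ∘ₗ J₀.subtype) Y‖)
        (fun _ _ => norm_nonneg _) (by simp [hj, hjd])
    have h1 : ‖κ J₀‖ ≤ A * T + ∑ J₁ with J₁ < J₀, ‖κ J₁‖ := by
      rw [hsplit]
      refine (norm_sub_le _ _).trans (add_le_add ?_ (norm_sum_le _ _))
      exact (norm_sum_map_le_le φ ζ Y J₀).trans (mul_le_mul_of_nonneg_left hθ hA)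
    rcases Nat.eq_zero_or_pos j with h0 | h0
    · have : J₀ = ⊥ := Submodule.finrank_eq_zero.1 (hj.trans h0)
      subst this
      simpa [h0] using h1
    · have h2 : ∀ J₁ ∈ Finset.univ.filter (fun J₁ : Submodule K J => J₁ < J₀),
          ‖κ J₁‖ ≤ A * (1 + B) ^ (j - 1) * T := by
        intro J₁ hJ₁
        have hlt := Submodule.finrank_lt_finrank_of_lt (Finset.mem_filter.1 hJ₁).2
        refine (ih _ (by omega) J₁ rfl (by omega)).trans ?_
        refine mul_le_mul_of_nonneg_right (mul_le_mul_of_nonneg_left ?_ hA) hT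
        exact pow_le_pow_right₀ (by linarith) (by omega)
      have h3 := Finset.sum_le_card_nsmul _ _ _ h2
      rw [nsmul_eq_mul] at h3
      have h4 : (((Finset.univ.filter fun J₁ : Submodule K J => J₁ < J₀).card : ℕ) : ℝ) ≤ B :=
        le_trans (by exact_mod_cast Finset.card_filter_le _ _) hB
      have h5 : (1:ℝ) ≤ (1 + B) ^ (j - 1) := one_le_pow₀ (by linarith)
      have h6 : (1 + B) ^ j = (1 + B) ^ (j - 1) * (1 + B) := by
        rw [← pow_succ]; congr 1; omega
      have h7 : 0 ≤ A * T := by positivity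
      have h8 : 0 ≤ A * (1 + B) ^ (j - 1) * T := by positivity
      rw [h6]
      nlinarith [mul_le_mul_of_nonneg_right h4 h8, mul_le_mul_of_nonneg_right h5 h7]
  have hsum : kap (trunc d φ) ζ Y =
      ∑ J₀ ∈ Finset.univ.filter (fun J₀ : Submodule K J => finrank K J₀ + cod Y = d), κ J₀ := by
    rw [kap, ← Finset.sum_fiberwise (g := fun ρ : X →ₗ[K] J => Y.map ρ), Finset.sum_filter]
    refine Finset.sum_congr rfl fun J₀ _ => ?_
    split_ifs with h
    · refine Finset.sum_congr rfl fun ρ hρ => ?_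
      have hρ := (Finset.mem_filter.1 hρ).2
      rw [trunc, if_pos (by rw [cod_ker_inf, hρ]; omega)]
    · refine Finset.sum_eq_zero fun ρ hρ => ?_
      have hρ := (Finset.mem_filter.1 hρ).2
      rw [trunc, if_neg (by rw [cod_ker_inf, hρ]; omega), zero_mul]
  rw [hsum]
  have h2 : ∀ J₀ ∈ Finset.univ.filter (fun J₀ : Submodule K J => finrank K J₀ + cod Y = d),
      ‖κ J₀‖ ≤ A * (1 + B) ^ d * T := by
    intro J₀ hJ₀
    have := (Finset.mem_filter.1 hJ₀).2
    refine (hκ _ J₀ rfl (by omega)).trans ?_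
    refine mul_le_mul_of_nonneg_right (mul_le_mul_of_nonneg_left ?_ hA) hT
    exact pow_le_pow_right₀ (by linarith) (by omega)
  refine (norm_sum_le _ _).trans ((Finset.sum_le_card_nsmul _ _ _ h2).trans ?_)
  rw [nsmul_eq_mul]
  calc _ ≤ B * (A * (1 + B) ^ d * T) := by
        refine mul_le_mul_of_nonneg_right (le_trans ?_ hB) (by positivity)
        exact_mod_cast Finset.card_filter_le _ _
    _ = _ := by ring

end Truncate

section Control

variable {K E X : Type} [Field K] [Fintype K] [AddCommGroup E] [Module K E] [Finite E]
  [AddCommGroup X] [Module K X] [Finite X]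

/-- All restrictions of `F` of total size at most `s` have level-`c` weight at most `Ω`. -/
def Ctl (F : (E →ₗ[K] X) → ℂ) (s c : ℕ) (Ω : ℝ) : Prop :=
  ∀ (P E' Y : Type) [AddCommGroup P] [Module K P] [Finite P] [AddCommGroup E'] [Module K E']
    [Finite E'] [AddCommGroup Y] [Module K Y] [Finite Y] (θ : (P × E') ≃ₗ[K] E)
    (ζ : P →ₗ[K] X) (ι : Y →ₗ[K] X), Function.Injective ι →
    finrank K P + finrank K X ≤ finrank K Y + s → Wt c (zout (zin F θ ζ) ι) ≤ Ω

lemma kap_phi_eq {F : (E →ₗ[K] X) → ℂ} (hF : Inv F) {J E' : Type} [AddCommGroup J] [Module K J]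
    [Finite J] [AddCommGroup E'] [Module K E'] [Finite E'] (θ : (J × E') ≃ₗ[K] E)
    (ζ : J →ₗ[K] X) {Y : Submodule K X} (hY : cod Y ≤ finrank K E') :
    kap (phi F) ζ Y = phi (zin F θ ζ) Y := by
  obtain ⟨S, hS⟩ := exists_ker_eq Y hY
  rw [phi_eq_hat (hF.zin θ ζ) hS, hat_zin, kap]
  refine Finset.sum_congr rfl fun ρ _ => ?_
  rw [hat_eq_phi hF, LinearMap.ker_comp, LinearEquiv.ker, ← LinearMap.ker, LinearMap.ker_prod, hS]

lemma exists_sum_sq_kap_trunc_le (K : Type) [Field K] [Fintype K] (d i n : ℕ) :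
    ∃ C : ℝ, 0 ≤ C ∧ ∀ (E X J : Type) [AddCommGroup E] [Module K E] [Finite E]
      [AddCommGroup X] [Module K X] [Finite X] [AddCommGroup J] [Module K J] [Finite J]
      (F : (E →ₗ[K] X) → ℂ) (Ω : ℝ) (k : ℕ), Inv F → 0 ≤ Ω → d + 1 ≤ finrank K E →
      finrank K J = i →
      (∀ s c, s + c ≤ d → Ctl F s c (Ω * (Fintype.card K : ℝ) ^ (k * c))) →
      ∀ (ζ : J →ₗ[K] X) (I : Submodule K X), (Fintype.card K : ℝ) ^ (finrank K E * n) *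
        ∑ Y : Submodule K X with Y ≤ I ∧ cod Y + cod I = n, ‖kap (trunc d (phi F)) ζ Y‖ ^ 2 ≤
          C * (Ω * (Fintype.card K : ℝ) ^ (k * n)) := by
  choose Z hZ0 hZ using fun b c => exists_sum_sq_phi_le K b c
  set q : ℝ := (Fintype.card K : ℝ) with hqd
  have hq : 1 ≤ q := one_le_card K
  have hq0 : 0 ≤ q := by linarith
  set B : ℝ := 2 ^ Fintype.card K ^ i with hB
  have hB0 : 0 ≤ B := by positivity
  set L : ℝ := B * (q ^ (n * i) * (1 + B) ^ d) with hL
  have hL0 : 0 ≤ L := by positivity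
  set C₀ : ℝ := ∑ b ∈ Finset.range (n + 1), Z b (n - 2 * b) with hC₀
  have hC₀0 : 0 ≤ C₀ := Finset.sum_nonneg fun _ _ => hZ0 _ _
  refine ⟨L ^ 2 * (B * (B * (q ^ (d * n) * C₀))), by positivity, ?_⟩
  intro E X J _ _ _ _ _ _ _ _ _ F Ω k hF hΩ hE hJ hctl ζ I
  set b := cod I with hb
  rcases lt_or_ge n (2 * b) with hnb | hnb
  · rw [Finset.sum_eq_zero, mul_zero]
    · positivity
    · intro Y hY
      obtain ⟨-, h1, h2⟩ := Finset.mem_filter.1 hY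
      have := cod_antitone h1
      omega
  set s := Finset.univ.filter fun Y : Submodule K X => Y ≤ I ∧ cod Y + b = n with hs
  have hg : ∀ Y ∈ s, cod Y = n - b := fun Y hY => by
    have := (Finset.mem_filter.1 hY).2.2; omega
  set t := Finset.univ.filter fun J₀ : Submodule K J => finrank K J₀ + (n - b) ≤ d with ht
  have hcard : (Fintype.card (Submodule K J) : ℝ) ≤ B := by
    have := card_submodule_le (K := K) (X := J)
    rw [hJ] at this
    calc (Fintype.card (Submodule K J) : ℝ) ≤ ((2 ^ Fintype.card K ^ i : ℕ) : ℝ) := by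
          exact_mod_cast this
      _ = B := by push_cast; rfl
  have htB : (t.card : ℝ) ≤ B := le_trans (by exact_mod_cast Finset.card_le_univ _) hcard
  have h1 : ∀ Y ∈ s, ‖kap (trunc d (phi F)) ζ Y‖ ^ 2 ≤
      L ^ 2 * (B * ∑ J₀ ∈ t, ‖kap (phi F) (ζ ∘ₗ J₀.subtype) Y‖ ^ 2) := by
    intro Y hY
    have h := norm_kap_trunc_le (phi F) d ζ Y
    rw [hJ, hg Y hY] at h
    have h2 : ‖kap (trunc d (phi F)) ζ Y‖ ≤
        L * ∑ J₀ ∈ t, ‖kap (phi F) (ζ ∘ₗ J₀.subtype) Y‖ := by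
      refine h.trans (mul_le_mul_of_nonneg_right ?_ (Finset.sum_nonneg fun _ _ => norm_nonneg _))
      refine mul_le_mul_of_nonneg_left (mul_le_mul_of_nonneg_right ?_ (by positivity)) hB0
      exact pow_le_pow_right₀ hq (Nat.mul_le_mul_right _ (Nat.sub_le _ _))
    refine (pow_le_pow_left₀ (norm_nonneg _) h2 2).trans ?_
    rw [mul_pow]
    refine mul_le_mul_of_nonneg_left ?_ (by positivity)
    refine sq_sum_le_card_mul_sum_sq.trans ?_
    exact mul_le_mul_of_nonneg_right htB (Finset.sum_nonneg fun _ _ => by positivity)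
  have h3 : ∀ J₀ ∈ t, q ^ (finrank K E * n) *
      ∑ Y ∈ s, ‖kap (phi F) (ζ ∘ₗ J₀.subtype) Y‖ ^ 2 ≤
        q ^ (d * n) * C₀ * (Ω * q ^ (k * n)) := by
    intro J₀ hJ₀
    have hj := (Finset.mem_filter.1 hJ₀).2
    set j := finrank K J₀ with hjd
    let E' := Fin (finrank K E - j) → K
    have hE' : finrank K E' = finrank K E - j := by simp [E']
    have θ : (J₀ × E') ≃ₗ[K] E := LinearEquiv.ofFinrankEq _ _ (by
      rw [finrank_prod, hE', ← hjd]; omega)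
    have h4 : ∑ Y ∈ s, ‖kap (phi F) (ζ ∘ₗ J₀.subtype) Y‖ ^ 2 =
        ∑ Y : Submodule K X with Y ≤ I ∧ cod Y = b + (n - 2 * b),
          ‖phi (zin F θ (ζ ∘ₗ J₀.subtype)) Y‖ ^ 2 := by
      refine Finset.sum_congr ?_ fun Y hY => ?_
      · ext Y
        simp only [hs, Finset.mem_filter]
        refine and_congr_right fun _ => and_congr_right fun _ => ?_
        omega
      · rw [kap_phi_eq hF θ]
        have := (Finset.mem_filter.1 hY).2.2
        rw [hE']; omega
    have h5 := hZ b (n - 2 * b) E' X (zin F θ (ζ ∘ₗ J₀.subtype)) (Ω * q ^ (k * (n - 2 * b)))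
      (hF.zin _ _) (by rw [hE']; omega) (fun Y _ _ _ ι hι hY =>
        hctl (j + b) (n - 2 * b) (by omega) J₀ E' Y θ _ ι hι (by omega)) I rfl
    rw [h4]
    rw [show 2 * b + (n - 2 * b) = n by omega, hE'] at h5
    have h6 : q ^ (finrank K E * n) = q ^ (j * n) * q ^ ((finrank K E - j) * n) := by
      rw [← pow_add, ← add_mul]; congr 2; omega
    rw [h6, mul_assoc]
    have h7 : Z b (n - 2 * b) ≤ C₀ := Finset.single_le_sum (f := fun b => Z b (n - 2 * b))
      (fun _ _ => hZ0 _ _) (Finset.mem_range.2 (by omega))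
    calc _ ≤ q ^ (d * n) * (Z b (n - 2 * b) * (Ω * q ^ (k * (n - 2 * b)))) := by
          refine mul_le_mul ?_ h5 ?_ (by positivity)
          · exact pow_le_pow_right₀ hq (Nat.mul_le_mul_right _ (by omega))
          · exact mul_nonneg (by positivity) (Finset.sum_nonneg fun _ _ => by positivity)
      _ ≤ q ^ (d * n) * (C₀ * (Ω * q ^ (k * n))) := by
          refine mul_le_mul_of_nonneg_left ?_ (by positivity)
          refine mul_le_mul h7 (mul_le_mul_of_nonneg_left ?_ hΩ) (by positivity) hC₀0
          exact pow_le_pow_right₀ hq (Nat.mul_le_mul_left _ (by omega))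
      _ = _ := by ring
  calc _ ≤ q ^ (finrank K E * n) * ∑ Y ∈ s,
        L ^ 2 * (B * ∑ J₀ ∈ t, ‖kap (phi F) (ζ ∘ₗ J₀.subtype) Y‖ ^ 2) :=
        mul_le_mul_of_nonneg_left (Finset.sum_le_sum h1) (by positivity)
    _ = L ^ 2 * (B * ∑ J₀ ∈ t, q ^ (finrank K E * n) *
        ∑ Y ∈ s, ‖kap (phi F) (ζ ∘ₗ J₀.subtype) Y‖ ^ 2) := by
        rw [← Finset.mul_sum, ← Finset.mul_sum, ← Finset.mul_sum, Finset.sum_comm]; ring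
    _ ≤ L ^ 2 * (B * (B * (q ^ (d * n) * C₀ * (Ω * q ^ (k * n))))) := by
        refine mul_le_mul_of_nonneg_left (mul_le_mul_of_nonneg_left ?_ hB0) (by positivity)
        refine (Finset.sum_le_card_nsmul _ _ _ h3).trans ?_
        rw [nsmul_eq_mul]
        exact mul_le_mul_of_nonneg_right htB (by positivity)
    _ = _ := by ring

end Control

section Trilinear

lemma norm_sq_sum_le_card_mul {ι : Type} (s : Finset ι) (T : ι → ℂ) :
    ‖∑ i ∈ s, T i‖ ^ 2 ≤ s.card * ∑ i ∈ s, ‖T i‖ ^ 2 :=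
  (pow_le_pow_left₀ (norm_nonneg _) (norm_sum_le _ _) 2).trans sq_sum_le_card_mul_sum_sq

lemma sum_pairs_le {K E : Type} [Field K] [Fintype K] [AddCommGroup E] [Module K E] [Finite E]
    (a : Submodule K E → ℝ) (ha : ∀ Q, 0 ≤ a Q) (e e' i : ℕ) :
    ∑ p ∈ Finset.univ.filter (fun p : Submodule K E × Submodule K E =>
      finrank K p.1 = e ∧ finrank K p.2 = e' ∧ finrank K ↥(p.1 ⊓ p.2) = i), a p.1 ≤
      2 ^ Fintype.card K ^ e * (Fintype.card K : ℝ) ^ (finrank K E * (e' - i)) * ∑ Q, a Q := by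
  rw [Finset.sum_filter, Fintype.sum_prod_type, Finset.mul_sum]
  refine Finset.sum_le_sum fun Q _ => ?_
  dsimp only
  rw [← Finset.sum_filter, Finset.sum_const, nsmul_eq_mul]
  refine mul_le_mul_of_nonneg_right ?_ (ha Q)
  by_cases hQ : finrank K Q = e
  · have := card_finrank_inf_le Q e' i
    rw [hQ] at this
    simp only [hQ, true_and]
    exact_mod_cast this
  · simp only [hQ, false_and, Finset.filter_false, Finset.card_empty, Nat.cast_zero]
    positivity

theorem exists_norm_sq_sum_trunc_le (K : Type) [Field K] [Fintype K] (d e e' : ℕ) :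
    ∃ C : ℝ, 0 ≤ C ∧ ∀ (E E₁ X : Type) [AddCommGroup E] [Module K E] [Finite E]
      [AddCommGroup E₁] [Module K E₁] [Finite E₁] [AddCommGroup X] [Module K X] [Finite X]
      (F : (E →ₗ[K] X) → ℂ) (Ω : ℝ) (k : ℕ), Inv F → 0 ≤ Ω → d + 1 ≤ finrank K E →
      finrank K E₁ + k = finrank K E →
      (∀ s c, s + c ≤ d → Ctl F s c (Ω * (Fintype.card K : ℝ) ^ (k * c))) →
      ∀ u v : (X →ₗ[K] E₁) → ℂ, ‖∑ S : X →ₗ[K] E₁ with rk S = e, ∑ S' : X →ₗ[K] E₁ with rk S' = e',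
        trunc d (phi F) (LinearMap.ker (S - S')) * u S * v S'‖ ^ 2 ≤
          C * Ω * (∑ S, ‖u S‖ ^ 2) * ∑ S, ‖v S‖ ^ 2 := by
  choose Z hZ0 hZ using fun i => exists_sum_sq_kap_trunc_le K d i ((e - i) + (e' - i))
  set q : ℝ := (Fintype.card K : ℝ) with hqd
  have hq : 1 ≤ q := one_le_card K
  have hq0 : 0 < q := by linarith
  set D : ℕ → ℝ := fun i => q ^ ((e - i) + (e' - i)) ^ 2 * 2 ^ Fintype.card K ^ (e - i) *
    2 ^ Fintype.card K ^ (e' - i) * Z i * 2 ^ Fintype.card K ^ e * 2 ^ Fintype.card K ^ e' with hD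
  have hD0 : ∀ i, 0 ≤ D i := fun i => by have := hZ0 i; positivity
  refine ⟨((e + 1 : ℕ) : ℝ) * ∑ i ∈ Finset.range (e + 1), D i,
    mul_nonneg (by positivity) (Finset.sum_nonneg fun i _ => hD0 i), ?_⟩
  intro E E₁ X _ _ _ _ _ _ _ _ _ F Ω k hF hΩ hE hk hctl u v
  set Φ := trunc d (phi F)
  let T (p : Submodule K E₁ × Submodule K E₁) : ℂ :=
    ∑ S : X →ₗ[K] E₁ with LinearMap.range S = p.1, ∑ S' : X →ₗ[K] E₁ with LinearMap.range S' = p.2,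
      Φ (LinearMap.ker (S - S')) * u S * v S'
  let pr (i : ℕ) := Finset.univ.filter fun p : Submodule K E₁ × Submodule K E₁ =>
    finrank K p.1 = e ∧ finrank K p.2 = e' ∧ finrank K ↥(p.1 ⊓ p.2) = i
  have hfib : ∀ (e : ℕ) (f : (X →ₗ[K] E₁) → ℂ), ∑ S : X →ₗ[K] E₁ with rk S = e, f S =
      ∑ Q ∈ Finset.univ.filter (fun Q : Submodule K E₁ => finrank K Q = e),
        ∑ S : X →ₗ[K] E₁ with LinearMap.range S = Q, f S := by
    intro e f
    have hm : ∀ S ∈ Finset.univ.filter (fun S : X →ₗ[K] E₁ => rk S = e),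
        LinearMap.range S ∈ Finset.univ.filter fun Q : Submodule K E₁ => finrank K Q = e := by
      intro S hS; exact Finset.mem_filter.2 ⟨Finset.mem_univ _, (Finset.mem_filter.1 hS).2⟩
    rw [← Finset.sum_fiberwise_of_maps_to hm]
    refine Finset.sum_congr rfl fun Q hQ => Finset.sum_congr ?_ fun _ _ => rfl
    have hQ := (Finset.mem_filter.1 hQ).2
    ext S
    simp only [Finset.mem_filter, Finset.mem_univ, true_and]
    exact ⟨fun h => h.2, fun h => ⟨by rw [rk, h, hQ], h⟩⟩
  have hsum : ∑ S : X →ₗ[K] E₁ with rk S = e, ∑ S' : X →ₗ[K] E₁ with rk S' = e',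
        Φ (LinearMap.ker (S - S')) * u S * v S' =
      ∑ i ∈ Finset.range (e + 1), ∑ p ∈ pr i, T p := by
    rw [hfib e]
    have hm : ∀ p ∈ Finset.univ.filter (fun p : Submodule K E₁ × Submodule K E₁ =>
        finrank K p.1 = e ∧ finrank K p.2 = e'), finrank K ↥(p.1 ⊓ p.2) ∈ Finset.range (e + 1) := by
      intro p hp
      have := Submodule.finrank_mono (inf_le_left : p.1 ⊓ p.2 ≤ p.1)
      have h1 := (Finset.mem_filter.1 hp).2.1
      rw [Finset.mem_range]; omega
    have h2 := Finset.sum_fiberwise_of_maps_to hm T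
    simp only [Finset.filter_filter, and_assoc] at h2
    rw [show ∑ i ∈ Finset.range (e + 1), ∑ p ∈ pr i, T p = _ from h2,
      show (Finset.univ.filter fun p : Submodule K E₁ × Submodule K E₁ =>
        finrank K p.1 = e ∧ finrank K p.2 = e') =
        (Finset.univ.filter fun Q : Submodule K E₁ => finrank K Q = e) ×ˢ
        (Finset.univ.filter fun Q : Submodule K E₁ => finrank K Q = e') by ext; simp,
      Finset.sum_product]
    refine Finset.sum_congr rfl fun Q _ => ?_
    refine Eq.trans (Finset.sum_congr rfl fun S _ => ?_) Finset.sum_comm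
    exact hfib e' fun S' => Φ (LinearMap.ker (S - S')) * u S * v S'
  rw [hsum]
  refine (norm_sq_sum_le_card_mul _ _).trans ?_
  rw [Finset.card_range, mul_assoc (_ * _) Ω, mul_assoc (_ * _), mul_assoc, Finset.sum_mul]
  refine mul_le_mul_of_nonneg_left (Finset.sum_le_sum fun i hi => ?_) (by positivity)
  rcases lt_or_ge e' i with hi' | hi'
  · have : pr i = ∅ := by
      rw [Finset.filter_eq_empty_iff]
      rintro p - ⟨h1, h2, h3⟩
      have := Submodule.finrank_mono (inf_le_right : p.1 ⊓ p.2 ≤ p.2)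
      omega
    rw [this]
    simp only [Finset.sum_empty, norm_zero, ne_eq, OfNat.ofNat_ne_zero, not_false_eq_true, zero_pow]
    have := hD0 i
    have h1 : 0 ≤ ∑ S, ‖u S‖ ^ 2 := Finset.sum_nonneg fun _ _ => by positivity
    have h2 : 0 ≤ ∑ S, ‖v S‖ ^ 2 := Finset.sum_nonneg fun _ _ => by positivity
    positivity
  have hie : i ≤ e := by have := Finset.mem_range.1 hi; omega
  set n := (e - i) + (e' - i) with hn
  set Γ : ℝ := Z i * Ω * (q ^ (finrank K E₁ * n))⁻¹ with hΓ
  have hΓ0 : 0 ≤ Γ := by have := hZ0 i; positivity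
  set a : Submodule K E₁ → ℝ := fun Q => ∑ S : X →ₗ[K] E₁ with LinearMap.range S = Q, ‖u S‖ ^ 2
  set b : Submodule K E₁ → ℝ := fun Q => ∑ S : X →ₗ[K] E₁ with LinearMap.range S = Q, ‖v S‖ ^ 2
  have ha0 : ∀ Q, 0 ≤ a Q := fun Q => Finset.sum_nonneg fun _ _ => by positivity
  have hb0 : ∀ Q, 0 ≤ b Q := fun Q => Finset.sum_nonneg fun _ _ => by positivity
  have hT : ∀ p ∈ pr i, ‖T p‖ ^ 2 ≤ (q ^ n ^ 2 * 2 ^ Fintype.card K ^ (e - i) *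
      2 ^ Fintype.card K ^ (e' - i) * Γ) * a p.1 * b p.2 := by
    intro p hp
    obtain ⟨-, h1, h2, h3⟩ := Finset.mem_filter.1 hp
    refine norm_sq_sum_range_le Φ p.1 p.2 (by omega) (by omega) hΓ0 (fun ζ I => ?_) u v
    have h := hZ i E X ↥(p.1 ⊓ p.2) F Ω k hF hΩ hE h3 hctl ζ I
    have hpow : q ^ (finrank K E * n) = q ^ (finrank K E₁ * n) * q ^ (k * n) := by
      rw [← pow_add, ← add_mul, hk]
    rw [hpow] at h
    have hkn : 0 < q ^ (k * n) := by positivity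
    have hmn : 0 < q ^ (finrank K E₁ * n) := by positivity
    rw [hΓ, ← div_eq_mul_inv, le_div_iff₀ hmn]
    refine le_of_mul_le_mul_right ?_ hkn
    calc _ = _ := by ring
      _ ≤ _ := h
      _ = _ := by ring
  have hG0 : 0 ≤ q ^ n ^ 2 * 2 ^ Fintype.card K ^ (e - i) * 2 ^ Fintype.card K ^ (e' - i) * Γ := by
    positivity
  refine (norm_sq_sum_le_of_sq_le _ T (fun p => a p.1) (fun p => b p.2) hG0
    (fun p _ => ha0 _) (fun p _ => hb0 _) hT).trans ?_
  have hsa : ∑ Q, a Q = ∑ S, ‖u S‖ ^ 2 := Finset.sum_fiberwise _ _ _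
  have hsb : ∑ Q, b Q = ∑ S, ‖v S‖ ^ 2 := Finset.sum_fiberwise _ _ _
  have h1 := sum_pairs_le a ha0 e e' i
  have h2 : ∑ p ∈ pr i, b p.2 ≤ 2 ^ Fintype.card K ^ e' * q ^ (finrank K E₁ * (e - i)) *
      ∑ Q, b Q := by
    refine le_trans (le_of_eq ?_) (sum_pairs_le b hb0 e' e i)
    refine Finset.sum_equiv (Equiv.prodComm _ _) (fun p => ?_) fun p _ => rfl
    simp only [pr, Finset.mem_filter, Finset.mem_univ, true_and, Equiv.prodComm_apply,
      Prod.fst_swap, Prod.snd_swap]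
    have hc : finrank K ↥(p.2 ⊓ p.1) = finrank K ↥(p.1 ⊓ p.2) := by rw [inf_comm]
    exact ⟨fun h => ⟨h.2.1, h.1, hc.trans h.2.2⟩, fun h => ⟨h.2.1, h.1, hc.symm.trans h.2.2⟩⟩
  have hm : q ^ (finrank K E₁ * (e' - i)) * q ^ (finrank K E₁ * (e - i)) =
      q ^ (finrank K E₁ * n) := by
    rw [← pow_add, ← mul_add, add_comm]
  rw [hsa] at h1
  rw [hsb] at h2
  calc _ ≤ (q ^ n ^ 2 * 2 ^ Fintype.card K ^ (e - i) * 2 ^ Fintype.card K ^ (e' - i) * Γ) *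
        (2 ^ Fintype.card K ^ e * q ^ (finrank K E₁ * (e' - i)) * ∑ S, ‖u S‖ ^ 2) *
        (2 ^ Fintype.card K ^ e' * q ^ (finrank K E₁ * (e - i)) * ∑ S, ‖v S‖ ^ 2) := by
        refine mul_le_mul (mul_le_mul_of_nonneg_left h1 hG0) h2
          (Finset.sum_nonneg fun _ _ => hb0 _) ?_
        refine mul_nonneg hG0 (mul_nonneg (by positivity)
          (Finset.sum_nonneg fun _ _ => by positivity))
    _ = D i * Ω * (∑ S, ‖u S‖ ^ 2) * (∑ S, ‖v S‖ ^ 2) *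
        ((q ^ (finrank K E₁ * (e' - i)) * q ^ (finrank K E₁ * (e - i))) *
          (q ^ (finrank K E₁ * n))⁻¹) := by
        rw [hΓ, hD]; ring
    _ = _ := by
        rw [hm, mul_inv_cancel₀ (by positivity)]; ring

end Trilinear

section Low

variable {K E E₁ X : Type} [Field K] [Fintype K] [AddCommGroup E] [Module K E] [Finite E]
  [AddCommGroup E₁] [Module K E₁] [Finite E₁]
  [AddCommGroup X] [Module K X] [Finite X]

/-- The truncation to rank at most `d` of the Fourier coefficients of `F`, transported to maps
into another space. -/
noncomputable def low (E₁ : Type) [AddCommGroup E₁] [Module K E₁] [Finite E₁]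
    (d : ℕ) (F : (E →ₗ[K] X) → ℂ) (S : X →ₗ[K] E₁) : ℂ :=
  if rk S ≤ d then phi F (LinearMap.ker S) else 0

lemma low_eq_sum_trunc (d : ℕ) (F : (E →ₗ[K] X) → ℂ) (S : X →ₗ[K] E₁) :
    low E₁ d F S = ∑ j ∈ Finset.range (d + 1), trunc j (phi F) (LinearMap.ker S) := by
  unfold low trunc
  rw [rk_eq_cod_ker, Finset.sum_ite_eq]
  simp

lemma sum_eq_sum_rk {R : Type} [AddCommMonoid R] {D : ℕ} (f : (X →ₗ[K] E₁) → R)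
    (hf : ∀ S, D < rk S → f S = 0) :
    ∑ S, f S = ∑ e ∈ Finset.range (D + 1), ∑ S : X →ₗ[K] E₁ with rk S = e, f S := by
  have hm : ∀ S ∈ Finset.univ.filter (fun S : X →ₗ[K] E₁ => rk S ≤ D),
      rk S ∈ Finset.range (D + 1) := by
    intro S hS; have := (Finset.mem_filter.1 hS).2; rw [Finset.mem_range]; omega
  have h1 : ∑ S, f S = ∑ S : X →ₗ[K] E₁ with rk S ≤ D, f S := by
    rw [Finset.sum_filter]
    refine Finset.sum_congr rfl fun S _ => ?_
    split_ifs with h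
    · rfl
    · exact hf S (by omega)
  rw [h1, ← Finset.sum_fiberwise_of_maps_to hm]
  refine Finset.sum_congr rfl fun e he => Finset.sum_congr ?_ fun _ _ => rfl
  have := Finset.mem_range.1 he
  ext S
  simp only [Finset.mem_filter, Finset.mem_univ, true_and]
  exact ⟨fun h => h.2, fun h => ⟨by omega, h⟩⟩

theorem exists_norm_sq_sum_low_le (K : Type) [Field K] [Fintype K] (d D D' : ℕ) :
    ∃ C : ℝ, 0 ≤ C ∧ ∀ (E E₁ X : Type) [AddCommGroup E] [Module K E] [Finite E]
      [AddCommGroup E₁] [Module K E₁] [Finite E₁] [AddCommGroup X] [Module K X] [Finite X]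
      (F : (E →ₗ[K] X) → ℂ) (Ω : ℝ) (k : ℕ), Inv F → 0 ≤ Ω → d + 1 ≤ finrank K E →
      finrank K E₁ + k = finrank K E →
      (∀ s c, s + c ≤ d → Ctl F s c (Ω * (Fintype.card K : ℝ) ^ (k * c))) →
      ∀ u v : (X →ₗ[K] E₁) → ℂ, (∀ S, D < rk S → u S = 0) → (∀ S, D' < rk S → v S = 0) →
        ‖∑ S, ∑ S', low E₁ d F (S - S') * u S * v S'‖ ^ 2 ≤
          C * Ω * (∑ S, ‖u S‖ ^ 2) * ∑ S, ‖v S‖ ^ 2 := by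
  choose Z hZ0 hZ using fun j e e' => exists_norm_sq_sum_trunc_le K j e e'
  let I := (Finset.range (d + 1) ×ˢ Finset.range (D + 1)) ×ˢ Finset.range (D' + 1)
  refine ⟨I.card * ∑ p ∈ I, Z p.1.1 p.1.2 p.2,
    mul_nonneg (by positivity) (Finset.sum_nonneg fun _ _ => hZ0 _ _ _), ?_⟩
  intro E E₁ X _ _ _ _ _ _ _ _ _ F Ω k hF hΩ hE hk hctl u v hu hv
  have hsum : ∑ S, ∑ S', low E₁ d F (S - S') * u S * v S' =
      ∑ p ∈ I, ∑ S : X →ₗ[K] E₁ with rk S = p.1.2, ∑ S' : X →ₗ[K] E₁ with rk S' = p.2,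
        trunc p.1.1 (phi F) (LinearMap.ker (S - S')) * u S * v S' := by
    rw [Finset.sum_product, Finset.sum_product]
    simp_rw [low_eq_sum_trunc, Finset.sum_mul]
    rw [Finset.sum_congr rfl fun S _ => Finset.sum_comm, Finset.sum_comm]
    refine Finset.sum_congr rfl fun j _ => ?_
    rw [sum_eq_sum_rk (D := D) _ fun S hS => by simp [hu S hS]]
    refine Finset.sum_congr rfl fun e _ => ?_
    refine Eq.trans (Finset.sum_congr rfl fun S _ => ?_) Finset.sum_comm
    exact sum_eq_sum_rk (D := D') _ fun S hS => by simp [hv S hS]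
  rw [hsum]
  refine (norm_sq_sum_le_card_mul _ _).trans ?_
  rw [mul_assoc, mul_assoc, mul_assoc, Finset.sum_mul]
  refine mul_le_mul_of_nonneg_left (Finset.sum_le_sum fun p hp => ?_) (by positivity)
  have hj : p.1.1 ≤ d := by
    have := Finset.mem_range.1 (Finset.mem_product.1 (Finset.mem_product.1 hp).1).1; omega
  rw [← mul_assoc, ← mul_assoc]
  exact hZ _ _ _ E E₁ X F Ω k hF hΩ (by omega) hk (fun s c h => hctl s c (by omega)) u v

end Low

section Moment

variable {K E X : Type} [Field K] [Fintype K] [AddCommGroup E] [Module K E] [Finite E]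
  [AddCommGroup X] [Module K X] [Finite X]

/-- Convolution of functions on a space of linear maps. -/
noncomputable def conv (α u : (X →ₗ[K] E) → ℂ) (T : X →ₗ[K] E) : ℂ := ∑ S, α (T - S) * u S

lemma syn_conv (α u : (X →ₗ[K] E) → ℂ) (M : E →ₗ[K] X) :
    syn (conv α u) M = syn α M * syn u M := by
  unfold syn conv
  rw [Finset.mul_sum, Finset.sum_congr rfl fun T _ => Finset.sum_mul _ _ _, Finset.sum_comm]
  refine Finset.sum_congr rfl fun S _ => ?_
  rw [Finset.sum_mul]
  rw [← Equiv.sum_comp (Equiv.addRight S)]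
  refine Finset.sum_congr rfl fun T _ => ?_
  simp only [Equiv.coe_addRight, add_sub_cancel_right, pair_add_left, star_mul']
  ring

lemma rk_add_le (S T : X →ₗ[K] E) : rk (S + T) ≤ rk S + rk T := by
  unfold rk
  have h : LinearMap.range (S + T) ≤ LinearMap.range S ⊔ LinearMap.range T := by
    rintro _ ⟨x, rfl⟩
    exact Submodule.add_mem_sup ⟨x, rfl⟩ ⟨x, rfl⟩
  exact (Submodule.finrank_mono h).trans (Submodule.finrank_add_le_finrank_add_finrank _ _)

lemma rk_neg (S : X →ₗ[K] E) : rk (-S) = rk S := by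
  unfold rk; rw [LinearMap.range_neg]

lemma conv_eq_zero {α u : (X →ₗ[K] E) → ℂ} {d D : ℕ} (hα : ∀ S, d < rk S → α S = 0)
    (hu : ∀ S, D < rk S → u S = 0) (T : X →ₗ[K] E) (hT : D + d < rk T) : conv α u T = 0 := by
  refine Finset.sum_eq_zero fun S _ => ?_
  by_cases h : D < rk S
  · rw [hu S h, mul_zero]
  · rw [hα, zero_mul]
    have := rk_add_le (T - S) S
    rw [sub_add_cancel] at this
    omega

lemma sum_norm_sq_conv_le {α u : (X →ₗ[K] E) → ℂ} {C : ℝ} (hC : 0 ≤ C) {d D : ℕ}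
    (hα : ∀ S, d < rk S → α S = 0) (hu : ∀ S, D < rk S → u S = 0)
    (h : ∀ v : (X →ₗ[K] E) → ℂ, (∀ S, D + d < rk S → v S = 0) →
      ‖∑ T, ∑ S, α (T - S) * v T * u S‖ ^ 2 ≤ C * (∑ T, ‖v T‖ ^ 2) * ∑ S, ‖u S‖ ^ 2) :
    ∑ T, ‖conv α u T‖ ^ 2 ≤ C * ∑ S, ‖u S‖ ^ 2 := by
  have h1 := h (fun T => star (conv α u T)) fun T hT => by rw [conv_eq_zero hα hu T hT, star_zero]
  have h2 : ∑ T, ∑ S, α (T - S) * star (conv α u T) * u S =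
      ((∑ T, ‖conv α u T‖ ^ 2 : ℝ) : ℂ) := by
    push_cast
    refine Finset.sum_congr rfl fun T _ => ?_
    have := Complex.conj_mul' (conv α u T)
    rw [← this, show (starRingEnd ℂ) (conv α u T) = star (conv α u T) from rfl]
    conv_rhs => rw [conv, Finset.mul_sum]
    refine Finset.sum_congr rfl fun S _ => ?_
    rw [conv]; ring
  have h0 : 0 ≤ ∑ T, ‖conv α u T‖ ^ 2 := Finset.sum_nonneg fun _ _ => by positivity
  rw [h2, Complex.norm_real, Real.norm_of_nonneg h0] at h1
  simp only [norm_star] at h1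
  rcases h0.eq_or_lt with h3 | h3
  · rw [← h3]
    exact mul_nonneg hC (Finset.sum_nonneg fun _ _ => by positivity)
  · refine le_of_mul_le_mul_left ?_ h3
    calc _ = (∑ T, ‖conv α u T‖ ^ 2) ^ 2 := by ring
      _ ≤ _ := h1
      _ = _ := by ring

theorem exists_moment_le (K : Type) [Field K] [Fintype K] (d t : ℕ) :
    ∃ C : ℝ, 0 ≤ C ∧ ∀ (E E₁ X : Type) [AddCommGroup E] [Module K E] [Finite E]
      [AddCommGroup E₁] [Module K E₁] [Finite E₁] [AddCommGroup X] [Module K X] [Finite X]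
      (F : (E →ₗ[K] X) → ℂ) (Ω : ℝ) (k : ℕ), Inv F → 0 ≤ Ω → d + 1 ≤ finrank K E →
      finrank K E₁ + k = finrank K E →
      (∀ s c, s + c ≤ d → Ctl F s c (Ω * (Fintype.card K : ℝ) ^ (k * c))) →
      ∑ M : E₁ →ₗ[K] X, ‖syn (low E₁ d F) M‖ ^ (2 * t) ≤
        Fintype.card (E₁ →ₗ[K] X) * (C * Ω) ^ t := by
  choose Z hZ0 hZ using fun j : ℕ => exists_norm_sq_sum_low_le K d (j * d + d) (j * d)
  refine ⟨∑ j ∈ Finset.range t, Z j, Finset.sum_nonneg fun _ _ => hZ0 _, ?_⟩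
  intro E E₁ X _ _ _ _ _ _ _ _ _ F Ω k hF hΩ hE hk hctl
  set C : ℝ := ∑ j ∈ Finset.range t, Z j
  have hC : 0 ≤ C := Finset.sum_nonneg fun _ _ => hZ0 _
  set α : (X →ₗ[K] E₁) → ℂ := low E₁ d F with hα
  have hα0 : ∀ S, d < rk S → α S = 0 := fun S hS => if_neg (by omega)
  let u : ℕ → (X →ₗ[K] E₁) → ℂ := fun j => (conv α)^[j] fun S => if S = 0 then 1 else 0
  have hu1 : ∀ j, u (j + 1) = conv α (u j) := fun j => Function.iterate_succ_apply' _ _ _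
  have hsupp : ∀ j, ∀ S, j * d < rk S → u j S = 0 := by
    intro j
    induction j with
    | zero =>
      intro S hS
      refine if_neg fun h => ?_
      rw [h, rk, LinearMap.range_zero, finrank_bot] at hS
      omega
    | succ j ih =>
      intro S hS
      rw [hu1]
      exact conv_eq_zero hα0 ih S (by rw [add_mul] at hS; omega)
  have hsyn : ∀ j M, syn (u j) M = syn α M ^ j := by
    intro j M
    induction j with
    | zero => simp [u, syn, pair_zero_left]
    | succ j ih => rw [hu1, syn_conv, ih, pow_succ']
  have hnorm : ∀ j, j ≤ t → ∑ S, ‖u j S‖ ^ 2 ≤ (C * Ω) ^ j := by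
    intro j
    induction j with
    | zero => intro _; simp [u, apply_ite]
    | succ j ih =>
      intro hj
      have hZC : Z j ≤ C := Finset.single_le_sum (f := Z) (fun _ _ => hZ0 _)
        (Finset.mem_range.2 (by omega))
      have h := sum_norm_sq_conv_le (α := α) (C := Z j * Ω) (mul_nonneg (hZ0 j) hΩ) hα0 (hsupp j)
        fun v hv => hZ j E E₁ X F Ω k hF hΩ hE hk hctl v (u j) hv (hsupp j)
      rw [hu1, pow_succ']
      refine h.trans (mul_le_mul (mul_le_mul_of_nonneg_right hZC hΩ) (ih (by omega))
        (Finset.sum_nonneg fun _ _ => by positivity) (mul_nonneg hC hΩ))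
  have h := sum_norm_sq_syn (u t)
  simp only [hsyn, norm_pow] at h
  calc _ = ∑ M : E₁ →ₗ[K] X, (‖syn α M‖ ^ t) ^ 2 :=
        Finset.sum_congr rfl fun M _ => by rw [← pow_mul, mul_comm]
    _ = _ := h
    _ ≤ _ := mul_le_mul_of_nonneg_left (hnorm t le_rfl) (by positivity)

end Moment

section Good

variable {K E X : Type} [Field K] [Fintype K] [AddCommGroup E] [Module K E] [Finite E]
  [AddCommGroup X] [Module K X] [Finite X]

/-- All values are real numbers of the unit interval. -/
def Nice {ι : Type} (F : ι → ℂ) : Prop := ∀ M, ∃ x : ℝ, 0 ≤ x ∧ x ≤ 1 ∧ F M = x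

/-- All restrictions obtained by prescribing values and shrinking the target, of total
codimension at most `s`, have average at most `ξ`. -/
def Good (F : (E →ₗ[K] X) → ℂ) (s : ℕ) (ξ : ℝ) : Prop :=
  ∀ (P E' Y : Type) [AddCommGroup P] [Module K P] [Finite P] [AddCommGroup E'] [Module K E']
    [Finite E'] [AddCommGroup Y] [Module K Y] [Finite Y] (θ : (P × E') ≃ₗ[K] E)
    (ζ : P →ₗ[K] X) (ι : Y →ₗ[K] X), Function.Injective ι →
    finrank K P + finrank K X ≤ finrank K Y + s → ‖avg (zout (zin F θ ζ) ι)‖ ≤ ξ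

lemma Nice.zoom {F : (E →ₗ[K] X) → ℂ} (hF : Nice F) {P E' Y : Type} [AddCommGroup P] [Module K P]
    [AddCommGroup E'] [Module K E'] [AddCommGroup Y] [Module K Y]
    (θ : (P × E') ≃ₗ[K] E) (ζ : P →ₗ[K] X) (ι : Y →ₗ[K] X) : Nice (zout (zin F θ ζ) ι) :=
  fun _ => hF _

lemma Good.zoom {F : (E →ₗ[K] X) → ℂ} {s s' : ℕ} {ξ : ℝ} (hF : Good F (s' + s) ξ)
    {P E' Y : Type} [AddCommGroup P] [Module K P] [Finite P]
    [AddCommGroup E'] [Module K E'] [Finite E'] [AddCommGroup Y] [Module K Y] [Finite Y]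
    (θ : (P × E') ≃ₗ[K] E) (ζ : P →ₗ[K] X) (ι : Y →ₗ[K] X) (hι : Function.Injective ι)
    (h : finrank K P + finrank K X ≤ finrank K Y + s') : Good (zout (zin F θ ζ) ι) s ξ := by
  intro P' E'' Y' _ _ _ _ _ _ _ _ _ θ' ζ' ι' hι' h'
  let θ'' : ((P × P') × E'') ≃ₗ[K] E :=
    (LinearEquiv.prodAssoc K P P' E'').trans (((LinearEquiv.refl K P).prodCongr θ').trans θ)
  have key : zout (zin (zout (zin F θ ζ) ι) θ' ζ') ι' =
      zout (zin F θ'' (LinearMap.coprod ζ (ι ∘ₗ ζ'))) (ι ∘ₗ ι') := by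
    funext y
    refine congrArg F (LinearMap.ext fun e => ?_)
    simp only [LinearMap.comp_apply, LinearMap.coprod_apply, LinearEquiv.coe_coe, θ'',
      LinearEquiv.trans_symm, LinearEquiv.trans_apply, map_add]
    simp [add_assoc]
    rfl
  rw [key]
  refine hF (P × P') E'' Y' θ'' _ _ (hι.comp hι') ?_
  rw [finrank_prod]
  omega

lemma Good.norm_avg_le {F : (E →ₗ[K] X) → ℂ} {s : ℕ} {ξ : ℝ} (hF : Good F s ξ) :
    ‖avg F‖ ≤ ξ := by
  let θ : (PUnit × E) ≃ₗ[K] E := LinearEquiv.uniqueProd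
  have key : zout (zin F θ 0) LinearMap.id = F := by
    funext y
    unfold zout zin
    congr 1
    ext e
    simp [θ]
  have := hF PUnit E X θ 0 LinearMap.id Function.injective_id (by
    rw [finrank_eq_zero_of_subsingleton, zero_add]; omega)
  rwa [key] at this

lemma norm_avg_of_nice {ι : Type} [Fintype ι] {F : ι → ℂ} (hF : Nice F) :
    ‖avg F‖ = (Fintype.card ι : ℝ)⁻¹ * ∑ i, ‖F i‖ := by
  choose x h0 h1 hx using hF
  unfold avg
  have h : ∑ i, F i = ((∑ i, x i : ℝ) : ℂ) := by push_cast; exact Finset.sum_congr rfl fun i _ => hx i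
  rw [h, norm_mul, norm_inv, Complex.norm_natCast, Complex.norm_real,
    Real.norm_of_nonneg (Finset.sum_nonneg fun i _ => h0 i)]
  congr 1
  refine Finset.sum_congr rfl fun i _ => ?_
  rw [hx, Complex.norm_real, Real.norm_of_nonneg (h0 i)]

lemma norm_sq_avg_mul_star_le {ι : Type} [Fintype ι] {F : ι → ℂ} (hF : Nice F) (g : ι → ℂ) :
    ‖avg fun i => F i * star (g i)‖ ^ 2 ≤ ‖avg F‖ * ‖avg fun i => F i * star (g i) * g i‖ := by
  choose x h0 h1 hx using id hF
  set c : ℝ := (Fintype.card ι : ℝ)⁻¹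
  have hc : 0 ≤ c := by positivity
  have e1 : ‖avg F‖ = c * ∑ i, x i := by
    rw [norm_avg_of_nice hF]
    congr 1
    refine Finset.sum_congr rfl fun i _ => ?_
    rw [hx, Complex.norm_real, Real.norm_of_nonneg (h0 i)]
  have e2 : ‖avg fun i => F i * star (g i) * g i‖ = c * ∑ i, x i * ‖g i‖ ^ 2 := by
    have : ∑ i, F i * star (g i) * g i = ((∑ i, x i * ‖g i‖ ^ 2 : ℝ) : ℂ) := by
      push_cast
      refine Finset.sum_congr rfl fun i _ => ?_
      rw [hx, mul_assoc, ← Complex.conj_mul']; rfl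
    unfold avg
    rw [this, norm_mul, norm_inv, Complex.norm_natCast, Complex.norm_real,
      Real.norm_of_nonneg (Finset.sum_nonneg fun i _ => mul_nonneg (h0 i) (by positivity))]
  have e3 : ‖avg fun i => F i * star (g i)‖ ≤ c * ∑ i, x i * ‖g i‖ := by
    unfold avg
    rw [norm_mul, norm_inv, Complex.norm_natCast]
    refine mul_le_mul_of_nonneg_left ((norm_sum_le _ _).trans (le_of_eq ?_)) hc
    refine Finset.sum_congr rfl fun i _ => ?_
    rw [norm_mul, norm_star, hx, Complex.norm_real, Real.norm_of_nonneg (h0 i)]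
  have e4 : (∑ i, x i * ‖g i‖) ^ 2 ≤ (∑ i, x i) * ∑ i, x i * ‖g i‖ ^ 2 :=
    Finset.sum_sq_le_sum_mul_sum_of_sq_le_mul _ (fun i _ => h0 i)
      (fun i _ => mul_nonneg (h0 i) (by positivity)) fun i _ => le_of_eq (by ring)
  rw [e1, e2]
  calc _ ≤ (c * ∑ i, x i * ‖g i‖) ^ 2 := by gcongr
    _ = c ^ 2 * (∑ i, x i * ‖g i‖) ^ 2 := by ring
    _ ≤ c ^ 2 * ((∑ i, x i) * ∑ i, x i * ‖g i‖ ^ 2) := by gcongr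
    _ = _ := by ring

lemma sum_norm_sq_hat (F : (E →ₗ[K] X) → ℂ) :
    ∑ S, ‖hat F S‖ ^ 2 = (Fintype.card (E →ₗ[K] X) : ℝ)⁻¹ * ∑ M, ‖F M‖ ^ 2 := by
  have h := sum_norm_sq_syn (hat F)
  simp only [syn_hat] at h
  rw [h, ← mul_assoc, inv_mul_cancel₀, one_mul]
  exact_mod_cast Fintype.card_ne_zero

lemma sum_norm_sq_hat_le {F : (E →ₗ[K] X) → ℂ} (hF : Nice F) :
    ∑ S, ‖hat F S‖ ^ 2 ≤ ‖avg F‖ := by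
  rw [sum_norm_sq_hat, norm_avg_of_nice hF]
  refine mul_le_mul_of_nonneg_left (Finset.sum_le_sum fun M _ => ?_) (by positivity)
  obtain ⟨x, h0, h1, hx⟩ := hF M
  rw [hx, Complex.norm_real, Real.norm_of_nonneg h0]
  nlinarith

lemma Wt_sq_le {F : (E →ₗ[K] X) → ℂ} (hF : Inv F) (hN : Nice F) (c : ℕ) {D : ℝ}
    (h : ∀ u v : (X →ₗ[K] E) → ℂ, (∀ S, c < rk S → u S = 0) → (∀ S, c < rk S → v S = 0) →
      ‖∑ S, ∑ S', low E (2 * c) F (S - S') * u S * v S'‖ ^ 2 ≤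
        D * (∑ S, ‖u S‖ ^ 2) * ∑ S, ‖v S‖ ^ 2) :
    Wt c F ^ 2 ≤ ‖avg F‖ ^ 2 * D := by
  let u : (X →ₗ[K] E) → ℂ := fun S => if rk S = c then hat F S else 0
  have hu : ∀ S, c < rk S → u S = 0 := fun S hS => if_neg (by omega)
  have hW : Wt c F = ∑ S, ‖u S‖ ^ 2 := by
    refine Finset.sum_congr rfl fun S _ => ?_
    simp only [u]; split_ifs <;> simp
  have h1 := norm_sq_avg_mul_star_le hN (syn u)
  have h2 : avg (fun M => F M * star (syn u M)) = ((Wt c F : ℝ) : ℂ) := by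
    rw [avg_mul_syn, Wt]
    push_cast
    refine Finset.sum_congr rfl fun S _ => ?_
    simp only [u]
    split_ifs
    · rw [Complex.ofReal_pow, ← Complex.conj_mul']; rfl
    · simp
  have h3 : avg (fun M => F M * star (syn u M) * syn u M) =
      ∑ S, ∑ S', low E (2 * c) F (S - S') * star (u S) * u S' := by
    rw [avg_mul_syn_syn]
    refine Finset.sum_congr rfl fun S _ => Finset.sum_congr rfl fun S' _ => ?_
    by_cases hS : rk S = c
    · by_cases hS' : rk S' = c
      · have : rk (S - S') ≤ 2 * c := by
          have := rk_add_le S (-S')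
          rw [rk_neg] at this
          rw [sub_eq_add_neg]; omega
        rw [low, if_pos this, hat_eq_phi hF]
      · simp [u, hS']
    · simp [u, hS]
  rw [h2, h3, Complex.norm_real, Real.norm_of_nonneg (Wt_nonneg _ _)] at h1
  have h4 := h (fun S => star (u S)) u (fun S hS => by rw [hu S hS, star_zero]) hu
  simp only [norm_star] at h4
  rw [← hW] at h4
  set W := Wt c F
  set B := ‖∑ S, ∑ S', low E (2 * c) F (S - S') * star (u S) * u S'‖
  have hW0 : 0 ≤ W := Wt_nonneg _ _
  rcases hW0.eq_or_lt with h0 | h0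
  · have : 0 ≤ D := by
      by_contra hD
      push Not at hD
      have hz := h (fun S => if S = 0 then 1 else 0) (fun S => if S = 0 then 1 else 0)
        (fun S hS => if_neg fun h => by rw [h, rk, LinearMap.range_zero, finrank_bot] at hS; omega)
        (fun S hS => if_neg fun h => by rw [h, rk, LinearMap.range_zero, finrank_bot] at hS; omega)
      have e : ∑ S : X →ₗ[K] E, ‖(if S = 0 then 1 else 0 : ℂ)‖ ^ 2 = 1 := by simp [apply_ite]
      rw [e] at hz
      have := sq_nonneg ‖∑ S : X →ₗ[K] E, ∑ S' : X →ₗ[K] E,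
        low E (2 * c) F (S - S') * (if S = 0 then 1 else 0) * (if S' = 0 then 1 else 0)‖
      linarith
    rw [← h0, zero_pow two_ne_zero]; positivity
  · have h5 : (W ^ 2) ^ 2 ≤ (‖avg F‖ * B) ^ 2 := by gcongr
    rw [mul_pow] at h5
    have h6 : ‖avg F‖ ^ 2 * B ^ 2 ≤ ‖avg F‖ ^ 2 * (D * W * W) := by gcongr
    refine le_of_mul_le_mul_right (a := W ^ 2) ?_ (by positivity)
    calc _ = (W ^ 2) ^ 2 := by ring
      _ ≤ _ := h5
      _ ≤ _ := h6
      _ = _ := by ring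

end Good

/-- The level inequality: the rank `c` weight of a function all of whose restrictions have small
average. -/
theorem exists_Wt_le (K : Type) [Field K] [Fintype K] (p : ℕ) : ∀ c : ℕ,
    ∃ C : ℝ, 0 ≤ C ∧ ∀ (E X : Type) [AddCommGroup E] [Module K E] [Finite E]
      [AddCommGroup X] [Module K X] [Finite X]
      (F : (E →ₗ[K] X) → ℂ) (s : ℕ) (ξ : ℝ), Inv F → Nice F → Good F s ξ → 0 < ξ → ξ ≤ 1 →
      2 ^ p * c ≤ s → s + 1 ≤ finrank K E → Wt c F ≤ C * ξ ^ (2 - (1 / 2 : ℝ) ^ p) := by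
  induction p with
  | zero =>
    intro c
    refine ⟨1, zero_le_one, ?_⟩
    intro E X _ _ _ _ _ _ F s ξ hF hN hG h0 h1 hs hE
    norm_num
    refine le_trans ?_ ((sum_norm_sq_hat_le hN).trans hG.norm_avg_le)
    refine Finset.sum_le_sum fun S _ => ?_
    split_ifs
    · exact le_rfl
    · positivity
  | succ p ih =>
    intro c
    choose B hB0 hB using ih
    obtain ⟨C, hC0, hC⟩ := exists_norm_sq_sum_low_le K (2 * c) c c
    set A : ℝ := ∑ j ∈ Finset.range (2 * c + 1), B j
    have hA0 : 0 ≤ A := Finset.sum_nonneg fun _ _ => hB0 _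
    refine ⟨Real.sqrt (C * A), Real.sqrt_nonneg _, ?_⟩
    intro E X _ _ _ _ _ _ F s ξ hF hN hG h0 h1 hs hE
    have hp : 1 ≤ 2 ^ p := Nat.one_le_two_pow
    have hs' : 2 ^ p * (2 * c) ≤ s := by rw [← mul_assoc, ← pow_succ]; exact hs
    have hcs : 2 * c ≤ s := le_trans (Nat.le_mul_of_pos_left _ (by omega)) hs'
    have hctl : ∀ s' c', s' + c' ≤ 2 * c → Ctl F s' c'
        (A * ξ ^ (2 - (1 / 2 : ℝ) ^ p) * (Fintype.card K : ℝ) ^ (0 * c')) := by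
      intro s' c' hsc P E' Y _ _ _ _ _ _ _ _ _ θ ζ ι hι hd
      have hG' : Good (zout (zin F θ ζ) ι) (s - s') ξ :=
        Good.zoom (s' := s') (by rwa [Nat.add_sub_cancel' (by omega)]) θ ζ ι hι hd
      have hfin := θ.finrank_eq
      rw [finrank_prod] at hfin
      have hYX := LinearMap.finrank_le_finrank_of_injective hι
      have hle : 2 ^ p * c' ≤ s - s' := by
        have : 2 ^ p * (s' + c') ≤ s := le_trans (Nat.mul_le_mul_left _ hsc) hs'
        have h2 : s' ≤ 2 ^ p * s' := Nat.le_mul_of_pos_left _ (by omega)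
        rw [mul_add] at this
        omega
      refine (hB c' E' Y _ (s - s') ξ ((hF.zin θ ζ).zout ι) (hN.zoom θ ζ ι) hG' h0 h1 hle
        (by omega)).trans ?_
      rw [zero_mul, pow_zero, mul_one]
      have : B c' ≤ A := Finset.single_le_sum (f := B) (fun _ _ => hB0 _)
        (Finset.mem_range.2 (by omega))
      gcongr
    have hΩ : 0 ≤ A * ξ ^ (2 - (1 / 2 : ℝ) ^ p) := by positivity
    have h := Wt_sq_le hF hN c fun u v hu hv =>
      hC E E X F _ 0 hF hΩ (by omega) (by omega) hctl u v hu hv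
    have havg := hG.norm_avg_le
    have h3 : Wt c F ^ 2 ≤ (Real.sqrt (C * A) * ξ ^ (2 - (1 / 2 : ℝ) ^ (p + 1))) ^ 2 := by
      refine h.trans ?_
      have e : (ξ ^ (2 - (1 / 2 : ℝ) ^ (p + 1))) ^ 2 = ξ ^ 2 * ξ ^ (2 - (1 / 2 : ℝ) ^ p) := by
        rw [← Real.rpow_natCast (ξ ^ _), ← Real.rpow_mul h0.le, ← Real.rpow_natCast ξ 2,
          ← Real.rpow_add h0]
        congr 1
        rw [pow_succ]; push_cast; ring
      rw [mul_pow, Real.sq_sqrt (by positivity), e]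
      calc _ ≤ ξ ^ 2 * (C * (A * ξ ^ (2 - (1 / 2 : ℝ) ^ p))) := by gcongr
        _ = _ := by ring
    exact le_of_sq_le_sq h3 (by positivity)

lemma Wt_zero_le {K E X : Type} [Field K] [Fintype K] [AddCommGroup E] [Module K E] [Finite E]
    [AddCommGroup X] [Module K X] [Finite X] (F : (E →ₗ[K] X) → ℂ) : Wt 0 F ≤ ‖avg F‖ ^ 2 := by
  unfold Wt
  refine le_of_eq (Eq.trans (Finset.sum_congr rfl (g := fun S => if S = 0 then ‖avg F‖ ^ 2 else 0)
    fun S _ => ?_) (by simp))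
  have : rk S = 0 ↔ S = 0 := by rw [rk, Submodule.finrank_eq_zero, LinearMap.range_eq_bot]
  simp only [this]
  split_ifs with h
  · subst h; simp [hat]
  · rfl

section High

variable {K E E₁ E₂ X : Type} [Field K] [Fintype K] [AddCommGroup E] [Module K E] [Finite E]
  [AddCommGroup E₁] [Module K E₁] [Finite E₁] [AddCommGroup E₂] [Module K E₂] [Finite E₂]
  [AddCommGroup X] [Module K X] [Finite X]

lemma avg_zin_eq_syn {F : (E →ₗ[K] X) → ℂ} (hF : Inv F) (θ : (E₁ × E₂) ≃ₗ[K] E)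
    (M : E₁ →ₗ[K] X) :
    avg (zin F θ M) = syn (fun S => phi F (LinearMap.ker S)) M := by
  have h : avg (zin F θ M) = hat (zin F θ M) 0 := by simp [hat]
  rw [h, hat_zin, syn]
  refine Finset.sum_congr rfl fun S _ => ?_
  rw [hat_eq_phi hF]
  congr 2
  ext x
  simp

lemma sum_norm_sq_avg_zin_sub_le {F : (E →ₗ[K] X) → ℂ} (hF : Inv F) (hN : Nice F)
    (θ : (E₁ × E₂) ≃ₗ[K] E) {k : ℕ} (hk : finrank K E₁ + k = finrank K E) (d : ℕ) :
    (Fintype.card K : ℝ) ^ (k * (d + 1)) *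
      ∑ M : E₁ →ₗ[K] X, ‖avg (zin F θ M) - syn (low E₁ d F) M‖ ^ 2 ≤
        Fintype.card (E₁ →ₗ[K] X) := by
  let h : (X →ₗ[K] E₁) → ℂ := fun S => phi F (LinearMap.ker S) - low E₁ d F S
  have e1 : ∀ M : E₁ →ₗ[K] X, avg (zin F θ M) - syn (low E₁ d F) M = syn h M := by
    intro M
    rw [avg_zin_eq_syn hF]
    unfold syn
    rw [← Finset.sum_sub_distrib]
    exact Finset.sum_congr rfl fun S _ => by rw [← sub_mul]
  simp_rw [e1]
  rw [sum_norm_sq_syn, ← mul_assoc, mul_comm (_ ^ _), mul_assoc]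
  refine mul_le_of_le_one_right (by positivity) ?_
  have e2 : ∀ S, ‖h S‖ ^ 2 =
      (fun Y : Submodule K X => if d < cod Y then ‖phi F Y‖ ^ 2 else 0) (LinearMap.ker S) := by
    intro S
    simp only [h, low, rk_eq_cod_ker]
    split_ifs <;> first | omega | simp
  simp_rw [e2]
  rw [sum_ker (E := E₁) (fun Y : Submodule K X => if d < cod Y then ‖phi F Y‖ ^ 2 else 0)]
  have e3 : ∑ S : X →ₗ[K] E, ‖hat F S‖ ^ 2 ≤ 1 := by
    refine (sum_norm_sq_hat_le hN).trans ?_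
    rw [norm_avg_of_nice hN]
    refine inv_mul_le_one_of_le₀ ?_ (by positivity)
    refine (Finset.sum_le_sum (g := fun _ => (1 : ℝ)) fun M _ => ?_).trans (by simp)
    obtain ⟨x, h0, h1, hx⟩ := hN M
    rw [hx, Complex.norm_real, Real.norm_of_nonneg h0]; exact h1
  refine le_trans ?_ e3
  simp_rw [hat_eq_phi hF]
  rw [sum_ker (E := E) (fun Y : Submodule K X => ‖phi F Y‖ ^ 2), Finset.mul_sum]
  refine Finset.sum_le_sum fun Y _ => ?_
  simp only [nsmul_eq_mul]
  split_ifs with hd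
  · rw [← mul_assoc]
    refine mul_le_mul_of_nonneg_right ?_ (by positivity)
    by_cases hc : cod Y ≤ finrank K E₁
    · have h1 := card_ker_eq_mul_le hk Y hc
      have h2 : (Fintype.card K : ℝ) ^ (k * (d + 1)) ≤ (Fintype.card K : ℝ) ^ (k * cod Y) :=
        pow_le_pow_right₀ (one_le_card K) (Nat.mul_le_mul_left _ hd)
      refine (mul_le_mul_of_nonneg_right h2 (by positivity)).trans ?_
      exact_mod_cast h1
    · have : Fintype.card {S : X →ₗ[K] E₁ // LinearMap.ker S = Y} = 0 := by
        rw [Fintype.card_eq_zero_iff]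
        refine ⟨fun S => hc ?_⟩
        rw [← S.2, ← rk_eq_cod_ker]
        exact Submodule.finrank_le _
      rw [this, Nat.cast_zero, mul_zero]
      positivity
  · rw [mul_zero, mul_zero]; positivity

end High

lemma exists_Ctl (K : Type) [Field K] [Fintype K] {r d : ℕ} (hdr : 2 * d ≤ r) :
    ∃ C : ℝ, 0 ≤ C ∧ ∀ (E X : Type) [AddCommGroup E] [Module K E] [Finite E]
      [AddCommGroup X] [Module K X] [Finite X]
      (F : (E →ₗ[K] X) → ℂ) (ξ : ℝ) (k N : ℕ), Inv F → Nice F → Good F r ξ → 0 < ξ → ξ ≤ 1 →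
      r + 1 ≤ finrank K E → ξ⁻¹ ≤ (Fintype.card K : ℝ) ^ N → 2 * N ≤ k * (r - d) →
      ∀ s c, s + c ≤ d → Ctl F s c (C * ξ ^ 2 * (Fintype.card K : ℝ) ^ (k * c)) := by
  choose B hB0 hB using fun c : ℕ => exists_Wt_le K (Nat.log 2 ((r - d) / c)) c
  refine ⟨1 + ∑ c ∈ Finset.range (d + 1), B c,
    add_nonneg zero_le_one (Finset.sum_nonneg fun _ _ => hB0 _), ?_⟩
  set C : ℝ := 1 + ∑ c ∈ Finset.range (d + 1), B c with hC
  intro E X _ _ _ _ _ _ F ξ k N hF hN hG h0 h1 hE hξ hk s c hsc P E' Y _ _ _ _ _ _ _ _ _ θ ζ ι hι hd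
  have hS0 : 0 ≤ ∑ c ∈ Finset.range (d + 1), B c := Finset.sum_nonneg fun _ _ => hB0 _
  have hG' : Good (zout (zin F θ ζ) ι) (r - s) ξ :=
    Good.zoom (s' := s) (by rwa [Nat.add_sub_cancel' (by omega)]) θ ζ ι hι hd
  have hfin := θ.finrank_eq
  rw [finrank_prod] at hfin
  have hYX := LinearMap.finrank_le_finrank_of_injective hι
  rcases Nat.eq_zero_or_pos c with rfl | hc
  · refine (Wt_zero_le _).trans ?_
    have h2 := hG'.norm_avg_le
    have h3 : ‖avg (zout (zin F θ ζ) ι)‖ ^ 2 ≤ ξ ^ 2 := by gcongr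
    rw [mul_zero, pow_zero, mul_one]
    nlinarith [sq_nonneg ξ]
  · have hr : c ≤ r - d := by omega
    set p := Nat.log 2 ((r - d) / c)
    have hp1 : 2 ^ p * c ≤ r - d := by
      have : 2 ^ p ≤ (r - d) / c := Nat.pow_log_le_self 2 (Nat.div_pos hr hc).ne'
      calc _ ≤ (r - d) / c * c := Nat.mul_le_mul_right _ this
        _ ≤ _ := Nat.div_mul_le_self _ _
    have hp2 : r - d < 2 ^ (p + 1) * c := by
      have : (r - d) / c < 2 ^ (p + 1) := Nat.lt_pow_succ_log_self (by norm_num) _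
      exact (Nat.div_lt_iff_lt_mul hc).1 this
    have hp3 : N ≤ k * c * 2 ^ p := by
      have : k * (r - d) ≤ k * (2 ^ (p + 1) * c) := Nat.mul_le_mul_left _ hp2.le
      rw [pow_succ] at this
      have e : k * (2 ^ p * 2 * c) = 2 * (k * c * 2 ^ p) := by ring
      omega
    refine (hB c E' Y _ (r - s) ξ ((hF.zin θ ζ).zout ι) (hN.zoom θ ζ ι) hG' h0 h1
      (hp1.trans (by omega)) (by omega)).trans ?_
    have hBC : B c ≤ C := by
      have : B c ≤ ∑ c ∈ Finset.range (d + 1), B c :=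
        Finset.single_le_sum (f := B) (fun _ _ => hB0 _) (Finset.mem_range.2 (by omega))
      linarith
    have hx : ξ ^ (2 - (1 / 2 : ℝ) ^ p) ≤ ξ ^ 2 * (Fintype.card K : ℝ) ^ (k * c) := by
      rw [Real.rpow_sub h0, div_eq_mul_inv, ← Real.inv_rpow h0.le, Real.rpow_ofNat]
      refine mul_le_mul_of_nonneg_left ?_ (by positivity)
      calc ξ⁻¹ ^ ((1 / 2 : ℝ) ^ p)
          ≤ ((Fintype.card K : ℝ) ^ N) ^ ((1 / 2 : ℝ) ^ p) := by gcongr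
        _ ≤ ((Fintype.card K : ℝ) ^ (k * c * 2 ^ p)) ^ ((1 / 2 : ℝ) ^ p) := by
            gcongr; exact one_le_card K
        _ = _ := by
            rw [pow_mul _ (k * c), ← Real.rpow_natCast (_ ^ (k * c)), ← Real.rpow_mul (by positivity)]
            push_cast
            rw [← mul_pow]; norm_num
    rw [mul_assoc]
    exact mul_le_mul hBC hx (by positivity) (by positivity)
lemma mul_le_add_pow_div {x lam : ℝ} (hx : 0 ≤ x) (hl : 0 < lam) {t : ℕ} (ht : 1 ≤ t) {w : ℝ}
    (hw0 : 0 ≤ w) (hw1 : w ≤ 1) : x * w ≤ lam * w + x ^ (2 * t) / lam ^ (2 * t - 1) := by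
  rcases le_total x lam with h | h
  · have : 0 ≤ x ^ (2 * t) / lam ^ (2 * t - 1) := by positivity
    nlinarith
  · have h1 : x ≤ x ^ (2 * t) / lam ^ (2 * t - 1) := by
      rw [le_div_iff₀ (by positivity)]
      calc x * lam ^ (2 * t - 1) ≤ x * x ^ (2 * t - 1) := by gcongr
        _ = x ^ (2 * t) := by rw [← pow_succ', Nat.sub_add_cancel (by omega)]
    have : 0 ≤ lam * w := by positivity
    nlinarith

/-- The main estimate: averaging over the second factor a function with pseudorandom restrictions
gives a function that is small against bounded weights. -/
theorem exists_sum_norm_avg_zin_mul_le (K : Type) [Field K] [Fintype K] {r d : ℕ}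
    (hdr : 2 * d ≤ r) {t : ℕ} (ht : 1 ≤ t) :
    ∃ C : ℝ, 0 ≤ C ∧ ∀ (E E₁ E₂ X : Type) [AddCommGroup E] [Module K E] [Finite E]
      [AddCommGroup E₁] [Module K E₁] [Finite E₁] [AddCommGroup E₂] [Module K E₂] [Finite E₂]
      [AddCommGroup X] [Module K X] [Finite X] (θ : (E₁ × E₂) ≃ₗ[K] E)
      (F : (E →ₗ[K] X) → ℂ) (ξ lam : ℝ) (k N : ℕ), Inv F → Nice F → Good F r ξ → 0 < ξ →
      ξ ≤ 1 → r + 1 ≤ finrank K E → finrank K E₁ + k = finrank K E →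
      ξ⁻¹ ≤ (Fintype.card K : ℝ) ^ N → 2 * N ≤ k * (r - d) → 4 * N ≤ k * (d + 1) → 0 < lam →
      ∀ w : (E₁ →ₗ[K] X) → ℝ, (∀ M, 0 ≤ w M) → (∀ M, w M ≤ 1) →
        ∑ M, ‖avg (zin F θ M)‖ * w M ≤ lam * ∑ M, w M + Fintype.card (E₁ →ₗ[K] X) *
          ((C * ξ ^ 2) ^ t / lam ^ (2 * t - 1) + 2 * ((Fintype.card K : ℝ) ^ (2 * N))⁻¹) := by
  obtain ⟨C₁, hC₁, hctl⟩ := exists_Ctl K hdr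
  obtain ⟨C₂, hC₂, hmom⟩ := exists_moment_le K d t
  refine ⟨C₂ * C₁, mul_nonneg hC₂ hC₁, ?_⟩
  intro E E₁ E₂ X _ _ _ _ _ _ _ _ _ _ _ _ θ F ξ lam k N hF hN hG h0 h1 hE hk hξ hN1 hN2 hl w
    hw0 hw1
  set A : (E₁ →ₗ[K] X) → ℂ := syn (low E₁ d F)
  set η : ℝ := ((Fintype.card K : ℝ) ^ (2 * N))⁻¹ with hη
  have hq := one_le_card K
  have hη0 : 0 < η := by positivity
  have hm := hmom E E₁ X F (C₁ * ξ ^ 2) k hF (by positivity) (by omega) hk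
    (hctl E X F ξ k N hF hN hG h0 h1 hE hξ hN1)
  have hh := sum_norm_sq_avg_zin_sub_le hF hN θ hk d
  have hh' : ∑ M : E₁ →ₗ[K] X, ‖avg (zin F θ M) - A M‖ ^ 2 ≤
      Fintype.card (E₁ →ₗ[K] X) * η ^ 2 := by
    have h4 : (Fintype.card K : ℝ) ^ (4 * N) ≤ (Fintype.card K : ℝ) ^ (k * (d + 1)) :=
      pow_le_pow_right₀ hq hN2
    have hs : 0 ≤ ∑ M : E₁ →ₗ[K] X, ‖avg (zin F θ M) - A M‖ ^ 2 :=
      Finset.sum_nonneg fun _ _ => by positivity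
    have h5 := (mul_le_mul_of_nonneg_right h4 hs).trans hh
    have e : η ^ 2 = ((Fintype.card K : ℝ) ^ (4 * N))⁻¹ := by
      rw [hη, inv_pow, ← pow_mul]; congr 2; ring
    rw [e, ← div_eq_mul_inv, le_div_iff₀ (by positivity), mul_comm]
    exact h5
  have hp : ∀ M : E₁ →ₗ[K] X, ‖avg (zin F θ M)‖ * w M ≤ lam * w M +
      ‖A M‖ ^ (2 * t) / lam ^ (2 * t - 1) + (η + ‖avg (zin F θ M) - A M‖ ^ 2 / η) := by
    intro M
    have g1 : ‖avg (zin F θ M)‖ ≤ ‖A M‖ + ‖avg (zin F θ M) - A M‖ := by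
      have := norm_add_le (A M) (avg (zin F θ M) - A M)
      rwa [add_sub_cancel] at this
    have g2 := mul_le_add_pow_div (norm_nonneg (A M)) hl ht (hw0 M) (hw1 M)
    set z := ‖avg (zin F θ M) - A M‖ with hz
    have hz0 : 0 ≤ z := norm_nonneg _
    have g3 : z ≤ η + z ^ 2 / η := by
      rcases le_total z η with h | h
      · have : 0 ≤ z ^ 2 / η := by positivity
        linarith
      · have : z ≤ z ^ 2 / η := by rw [le_div_iff₀ hη0, sq]; gcongr
        linarith
    have g4 := mul_le_mul_of_nonneg_right g1 (hw0 M)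
    have g5 : z * w M ≤ z := mul_le_of_le_one_right hz0 (hw1 M)
    rw [add_mul] at g4
    linarith
  refine (Finset.sum_le_sum fun M _ => hp M).trans ?_
  rw [Finset.sum_add_distrib, Finset.sum_add_distrib, Finset.sum_add_distrib, ← Finset.mul_sum,
    ← Finset.sum_div, ← Finset.sum_div, Finset.sum_const, Finset.card_univ, nsmul_eq_mul, add_assoc,
    mul_add, mul_assoc C₂]
  gcongr
  · rw [mul_div_assoc']
    gcongr
  · rw [two_mul, mul_add]
    gcongr
    rw [div_le_iff₀ hη0]
    calc _ ≤ _ := hh'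
      _ = _ := by ring

section Counting

lemma card_eq_mul_of_fiber {α β : Type} [Finite α] [Finite β] (p : α → Prop) (c : α → β)
    (B : β → Prop) (κ : ℕ) (h : ∀ b, B b → Nat.card {a // p a ∧ c a = b} = κ) :
    Nat.card {a // p a ∧ B (c a)} = κ * Nat.card {b // B b} := by
  have e : {a // p a ∧ B (c a)} ≃ Σ b : {b // B b}, {a // p a ∧ c a = b.1} :=
    { toFun := fun a => ⟨⟨c a.1, a.2.2⟩, ⟨a.1, a.2.1, rfl⟩⟩
      invFun := fun x => ⟨x.2.1, x.2.2.1, by rw [x.2.2.2]; exact x.1.2⟩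
      left_inv := fun a => rfl
      right_inv := by rintro ⟨⟨b, hb⟩, ⟨a, ha, hc⟩⟩; dsimp only at hc; subst hc; rfl }
  have : Fintype {b // B b} := Fintype.ofFinite _
  rw [Nat.card_congr e, Nat.card_sigma, Finset.sum_congr rfl fun b _ => h b.1 b.2,
    Finset.sum_const, Finset.card_univ, Nat.card_eq_fintype_card, smul_eq_mul, mul_comm]

lemma card_mul_card_of_surjective {A B : Type} [AddGroup A] [AddGroup B] [Finite A] [Finite B]
    (Ψ : A →+ B) (hΨ : Function.Surjective Ψ) (p : B → Prop) :
    Nat.card {a // p (Ψ a)} * Nat.card B = Nat.card {b // p b} * Nat.card A := by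
  have hA : Fintype A := Fintype.ofFinite A
  have hfib : ∀ b, Nat.card {a // True ∧ Ψ a = b} = Nat.card {a // True ∧ Ψ a = 0} := by
    intro b
    have := AddMonoidHom.card_fiber_eq_of_mem_range Ψ (hΨ b) (hΨ 0)
    simpa [Nat.card_eq_fintype_card, Fintype.card_subtype] using this
  have h1 := card_eq_mul_of_fiber (fun _ => True) Ψ p _ fun b _ => hfib b
  have h2 := card_eq_mul_of_fiber (fun _ => True) Ψ (fun _ => True) _ fun b _ => hfib b
  simp only [true_and] at h1 h2
  have h3 : Nat.card {a : A // True} = Nat.card A :=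
    Nat.card_congr (Equiv.subtypeUnivEquiv fun _ => trivial)
  have h4 : Nat.card {a : B // True} = Nat.card B :=
    Nat.card_congr (Equiv.subtypeUnivEquiv fun _ => trivial)
  rw [h1, ← h3, h2, h4]
  ring

variable {K E X : Type} [Field K] [Fintype K] [AddCommGroup E] [Module K E] [Finite E]
  [AddCommGroup X] [Module K X] [Finite X]

lemma card_comp_eq {j : E →ₗ[K] X} (hj : Function.Injective j) (p : (E →ₗ[K] X) → Prop)
    (p' : (E →ₗ[K] E) → Prop) (h : ∀ g, p (j ∘ₗ g) ↔ p' g)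
    (hr : ∀ M, p M → LinearMap.range M ≤ LinearMap.range j) :
    Nat.card {M // p M} = Nat.card {g // p' g} := by
  refine (Nat.card_congr (Equiv.ofBijective (fun g : {g // p' g} =>
    (⟨j ∘ₗ g.1, (h _).2 g.2⟩ : {M // p M})) ⟨?_, ?_⟩)).symm
  · intro g g' hgg
    have := congrArg Subtype.val hgg
    refine Subtype.ext (LinearMap.ext fun x => hj ?_)
    exact LinearMap.congr_fun this x
  · rintro ⟨M, hM⟩
    have hr' := hr M hM
    let e := LinearEquiv.ofInjective j hj
    let g : E →ₗ[K] E := e.symm.toLinearMap ∘ₗ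
      M.codRestrict (LinearMap.range j) fun x => hr' ⟨x, rfl⟩
    have hg : j ∘ₗ g = M := by
      ext x
      have := e.apply_symm_apply (M.codRestrict (LinearMap.range j) (fun x => hr' ⟨x, rfl⟩) x)
      have := congrArg Subtype.val this
      exact this
    refine ⟨⟨g, (h g).1 (by rwa [hg])⟩, Subtype.ext hg⟩

variable {P E' : Type} [AddCommGroup P] [Module K P] [Finite P] [AddCommGroup E'] [Module K E']
  [Finite E']

lemma exists_coprod {ζ : P →ₗ[K] X} (hζ : Function.Injective ζ) {L : Submodule K X}
    (hL : finrank K L = finrank K P + finrank K E') (h : LinearMap.range ζ ≤ L) :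
    ∃ y : E' →ₗ[K] X, LinearMap.ker (LinearMap.coprod ζ y) = ⊥ ∧
      LinearMap.range (LinearMap.coprod ζ y) = L := by
  obtain ⟨C, hC⟩ := Submodule.exists_isCompl ((LinearMap.range ζ).comap L.subtype)
  have hQ : finrank K ((LinearMap.range ζ).comap L.subtype) = finrank K P := by
    rw [(Submodule.comapSubtypeEquivOfLe h).finrank_eq, LinearMap.finrank_range_of_inj hζ]
  have hCd := Submodule.finrank_add_eq_of_isCompl hC
  have e : E' ≃ₗ[K] C := LinearEquiv.ofFinrankEq _ _ (by omega)
  have hr : LinearMap.range (LinearMap.coprod ζ (L.subtype ∘ₗ C.subtype ∘ₗ e.toLinearMap)) = L := by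
    apply le_antisymm
    · rintro _ ⟨⟨x, y⟩, rfl⟩
      exact L.add_mem (h ⟨x, rfl⟩) (e y).1.2
    · intro x hx
      obtain ⟨a, ha, c, hc, hac⟩ := Submodule.mem_sup.1
        (hC.sup_eq_top ▸ Submodule.mem_top : (⟨x, hx⟩ : L) ∈ _ ⊔ C)
      obtain ⟨z, hz⟩ := ha
      refine ⟨(z, e.symm ⟨c, hc⟩), ?_⟩
      have := congrArg Subtype.val hac
      simp only [Submodule.coe_add] at this
      simp [hz, this]
  refine ⟨_, ?_, hr⟩
  rw [LinearMap.ker_eq_bot]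
  have h1 := LinearMap.finrank_range_add_finrank_ker
    (LinearMap.coprod ζ (L.subtype ∘ₗ C.subtype ∘ₗ e.toLinearMap))
  rw [hr, finrank_prod] at h1
  rw [← LinearMap.ker_eq_bot, ← Submodule.finrank_eq_zero (R := K)]
  omega

lemma finrank_range_of_ker_eq_bot {M : E →ₗ[K] X} (h : LinearMap.ker M = ⊥) :
    finrank K (LinearMap.range M) = finrank K E :=
  LinearMap.finrank_range_of_inj (LinearMap.ker_eq_bot.1 h)

/-- The number of extensions of an injective map to an injective map with range in a given family
is proportional to the size of the family. -/
lemma exists_card_coprod_eq {ζ : P →ₗ[K] X} (hζ : Function.Injective ζ) :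
    ∃ κ : ℕ, ∀ p : Submodule K X → Prop,
      Nat.card {y : E' →ₗ[K] X // LinearMap.ker (LinearMap.coprod ζ y) = ⊥ ∧
        p (LinearMap.range (LinearMap.coprod ζ y))} =
      κ * Nat.card {L : Submodule K X // finrank K L = finrank K P + finrank K E' ∧
        LinearMap.range ζ ≤ L ∧ p L} := by
  let κ := Nat.card {g : P × E' →ₗ[K] P × E' // LinearMap.ker g = ⊥ ∧
    g ∘ₗ LinearMap.inl K P E' = LinearMap.inl K P E'}
  refine ⟨κ, fun p => ?_⟩
  rw [← card_eq_mul_of_fiber (fun y : E' →ₗ[K] X => LinearMap.ker (LinearMap.coprod ζ y) = ⊥)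
    (fun y => LinearMap.range (LinearMap.coprod ζ y)) (fun L => finrank K L = finrank K P +
      finrank K E' ∧ LinearMap.range ζ ≤ L ∧ p L) κ]
  · refine Nat.card_congr (Equiv.subtypeEquivRight fun y => ?_)
    constructor
    · rintro ⟨h1, h2⟩
      refine ⟨h1, ?_, ?_, h2⟩
      · rw [finrank_range_of_ker_eq_bot h1, finrank_prod]
      · rintro _ ⟨x, rfl⟩; exact ⟨(x, 0), by simp⟩
    · exact fun h => ⟨h.1, h.2.2.2⟩
  · rintro L ⟨hL, hζL, -⟩
    obtain ⟨y₀, hk, hr⟩ := exists_coprod hζ hL hζL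
    have hj := LinearMap.ker_eq_bot.1 hk
    set j := LinearMap.coprod ζ y₀
    have hc : ∀ M : P × E' →ₗ[K] X, M ∘ₗ LinearMap.inl K P E' = ζ →
        LinearMap.coprod ζ (M ∘ₗ LinearMap.inr K P E') = M := by
      rintro M rfl; ext <;> simp
    refine Eq.trans (Nat.card_congr ?_) (card_comp_eq hj (fun M => (LinearMap.ker M = ⊥ ∧
      M ∘ₗ LinearMap.inl K P E' = ζ) ∧ LinearMap.range M = L) _ ?_ ?_)
    · refine
        { toFun := fun y => ⟨LinearMap.coprod ζ y.1, ⟨y.2.1, by simp⟩, y.2.2⟩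
          invFun := fun M => ⟨M.1 ∘ₗ LinearMap.inr K P E', ?_⟩
          left_inv := fun y => by simp
          right_inv := fun M => ?_ }
      · rw [hc M.1 M.2.1.2]; exact ⟨M.2.1.1, M.2.2⟩
      · exact Subtype.ext (hc M.1 M.2.1.2)
    · intro g
      have hkg : LinearMap.ker (j ∘ₗ g) = LinearMap.ker g := LinearMap.ker_comp_of_ker_eq_bot _ hk
      rw [hkg]
      have e1 : (j ∘ₗ g) ∘ₗ LinearMap.inl K P E' = ζ ↔
          g ∘ₗ LinearMap.inl K P E' = LinearMap.inl K P E' := by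
        have : ζ = j ∘ₗ LinearMap.inl K P E' := by simp [j]
        rw [this, LinearMap.comp_assoc]
        constructor
        · intro h; exact LinearMap.ext fun x => hj (LinearMap.congr_fun h x)
        · intro h; rw [h]
      rw [e1]
      refine ⟨fun h => h.1, fun h => ⟨h, ?_⟩⟩
      rw [LinearMap.range_comp_of_range_eq_top, hr]
      exact LinearMap.range_eq_top.2 (LinearMap.injective_iff_surjective.1
        (LinearMap.ker_eq_bot.1 h.1))
    · rintro M ⟨-, hM⟩
      rw [hM, hr]

/-- The number of injective maps with range in a given family is proportional to the size of the
family. -/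
lemma exists_card_ker_eq_bot_eq (K E X : Type) [Field K] [Fintype K] [AddCommGroup E] [Module K E]
    [Finite E] [AddCommGroup X] [Module K X] [Finite X] :
    ∃ κ : ℕ, ∀ p : Submodule K X → Prop,
      Nat.card {M : E →ₗ[K] X // LinearMap.ker M = ⊥ ∧ p (LinearMap.range M)} =
      κ * Nat.card {L : Submodule K X // finrank K L = finrank K E ∧ p L} := by
  have h0 : Function.Injective (0 : PUnit →ₗ[K] X) := fun _ _ _ => rfl
  obtain ⟨κ, hκ⟩ := exists_card_coprod_eq (E' := E) h0
  refine ⟨κ, fun p => ?_⟩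
  have hP : finrank K PUnit = 0 := finrank_eq_zero_of_subsingleton _ _
  have hr : LinearMap.range (0 : PUnit →ₗ[K] X) = ⊥ := LinearMap.range_zero
  have hk : ∀ y : E →ₗ[K] X, LinearMap.coprod (0 : PUnit →ₗ[K] X) y =
      y ∘ₗ (LinearEquiv.uniqueProd : (PUnit × E) ≃ₗ[K] E).toLinearMap := by
    intro y; ext x <;> simp
  have := hκ p
  simp only [hP, zero_add, hr, bot_le, true_and] at this
  rw [← this]
  refine Nat.card_congr (Equiv.subtypeEquivRight fun y => ?_)
  rw [hk, LinearMap.range_comp_of_range_eq_top _ (LinearEquiv.range _), LinearMap.ker_comp]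
  refine and_congr_left fun _ => ?_
  constructor
  · intro h; rw [h, Submodule.comap_bot]; exact LinearEquiv.ker _
  · intro h
    rw [eq_bot_iff]
    intro x hx
    have : ((PUnit.unit, x) : PUnit × E) ∈ Submodule.comap
        (LinearEquiv.uniqueProd : (PUnit × E) ≃ₗ[K] E).toLinearMap (LinearMap.ker y) := by
      simpa using hx
    rw [h] at this
    simpa using this

/-- The number of injective maps on a product with the pair of ranges in a given family of flags
is proportional to the size of the family. -/
lemma exists_card_flag_eq (K P E' X : Type) [Field K] [Fintype K] [AddCommGroup P] [Module K P]
    [Finite P] [AddCommGroup E'] [Module K E'] [Finite E'] [AddCommGroup X] [Module K X]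
    [Finite X] :
    ∃ κ : ℕ, ∀ p : Submodule K X × Submodule K X → Prop,
      Nat.card {M : P × E' →ₗ[K] X // LinearMap.ker M = ⊥ ∧
        p (LinearMap.range M, LinearMap.range (M ∘ₗ LinearMap.inl K P E'))} =
      κ * Nat.card {L : Submodule K X × Submodule K X // finrank K L.1 = finrank K P + finrank K E' ∧
        finrank K L.2 = finrank K P ∧ L.2 ≤ L.1 ∧ p L} := by
  let κ := Nat.card {g : P × E' →ₗ[K] P × E' // LinearMap.ker g = ⊥ ∧
    LinearMap.range (g ∘ₗ LinearMap.inl K P E') = LinearMap.range (LinearMap.inl K P E')}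
  refine ⟨κ, fun p => ?_⟩
  rw [← card_eq_mul_of_fiber (fun M : P × E' →ₗ[K] X => LinearMap.ker M = ⊥)
    (fun M => (LinearMap.range M, LinearMap.range (M ∘ₗ LinearMap.inl K P E')))
    (fun L => finrank K L.1 = finrank K P +
      finrank K E' ∧ finrank K L.2 = finrank K P ∧ L.2 ≤ L.1 ∧ p L) κ]
  · refine Nat.card_congr (Equiv.subtypeEquivRight fun M => ?_)
    constructor
    · rintro ⟨h1, h2⟩
      refine ⟨h1, ?_, ?_, ?_, h2⟩
      · rw [finrank_range_of_ker_eq_bot h1, finrank_prod]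
      · refine finrank_range_of_ker_eq_bot ?_
        rw [LinearMap.ker_comp_of_ker_eq_bot _ h1, LinearMap.ker_eq_bot]; exact LinearMap.inl_injective
      · exact LinearMap.range_comp_le_range _ _
    · exact fun h => ⟨h.1, h.2.2.2.2⟩
  · rintro ⟨L, R⟩ ⟨hL, hR, hRL, -⟩
    have e : P ≃ₗ[K] R := LinearEquiv.ofFinrankEq _ _ hR.symm
    have hζ : Function.Injective (R.subtype ∘ₗ e.toLinearMap) :=
      Subtype.val_injective.comp e.injective
    have hζr : LinearMap.range (R.subtype ∘ₗ e.toLinearMap) = R := by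
      rw [LinearMap.range_comp_of_range_eq_top _ (LinearEquiv.range _), Submodule.range_subtype]
    obtain ⟨y₀, hk, hr⟩ := exists_coprod (E' := E') hζ hL (by rwa [hζr])
    have hj := LinearMap.ker_eq_bot.1 hk
    set j := LinearMap.coprod (R.subtype ∘ₗ e.toLinearMap) y₀ with hjdef
    have hjl : Submodule.map j (LinearMap.range (LinearMap.inl K P E')) = R := by
      rw [← LinearMap.range_comp, hjdef, LinearMap.coprod_inl, hζr]
    refine card_comp_eq hj _ _ ?_ ?_
    · intro g
      have hkg : LinearMap.ker (j ∘ₗ g) = LinearMap.ker g := LinearMap.ker_comp_of_ker_eq_bot _ hk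
      rw [hkg, Prod.mk.injEq, LinearMap.comp_assoc]
      refine and_congr_right fun h => ?_
      have h1 : LinearMap.range (j ∘ₗ g) = L := by
        rw [LinearMap.range_comp_of_range_eq_top, hr]
        exact LinearMap.range_eq_top.2 (LinearMap.injective_iff_surjective.1
          (LinearMap.ker_eq_bot.1 h))
      rw [LinearMap.range_comp (g ∘ₗ _) j, and_iff_right h1]
      nth_rw 1 [← hjl]
      exact (Submodule.map_injective_of_injective hj).eq_iff
    · rintro M ⟨-, hM⟩
      rw [(Prod.mk.inj hM).1, hr]

end Counting

section Interval

lemma card_and_le_of_double_count {ι α : Type} [Finite ι] [Finite α] (I : ι → Prop)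
    (inc : ι → α → Prop) (A P : α → Prop) (κ : ℕ) (hκ : 0 < κ) (ξ : ℝ)
    (hA : ∀ a, A a → Nat.card {i // I i ∧ inc i a} = κ)
    (hI : ∀ i, I i → (Nat.card {a // A a ∧ inc i a ∧ P a} : ℝ) ≤
      ξ * Nat.card {a // A a ∧ inc i a}) :
    (Nat.card {a // A a ∧ P a} : ℝ) ≤ ξ * Nat.card {a // A a} := by
  have : Fintype ι := Fintype.ofFinite ι
  have : Fintype α := Fintype.ofFinite α
  have key : ∀ R : α → Prop, (κ : ℝ) * Nat.card {a // A a ∧ R a} =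
      ∑ i with I i, (Nat.card {a // A a ∧ inc i a ∧ R a} : ℝ) := by
    intro R
    simp only [Nat.card_eq_fintype_card, Fintype.card_subtype] at hA ⊢
    have h2 : ∀ i, ((Finset.univ.filter fun a => A a ∧ inc i a ∧ R a).card : ℝ) =
        ∑ a with A a ∧ R a, if inc i a then (1 : ℝ) else 0 := by
      intro i
      rw [Finset.sum_boole, Finset.filter_filter]
      congr 2
      ext a; simp only [Finset.mem_filter, Finset.mem_univ, true_and]; tauto
    rw [Finset.sum_congr rfl fun i _ => h2 i, Finset.sum_comm, mul_comm, ← nsmul_eq_mul]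
    refine (Finset.sum_eq_card_nsmul fun a ha => ?_).symm
    rw [Finset.mem_filter] at ha
    rw [Finset.sum_boole, Finset.filter_filter, hA a ha.2.1]
  have h1 := key P
  have h2 := key fun _ => True
  simp only [and_true] at h2
  have h3 : (κ : ℝ) * Nat.card {a // A a ∧ P a} ≤ κ * (ξ * Nat.card {a // A a}) := by
    rw [h1, mul_left_comm, h2, Finset.mul_sum]
    exact Finset.sum_le_sum fun i hi => hI i (Finset.mem_filter.1 hi).2
  exact le_of_mul_le_mul_left h3 (by exact_mod_cast hκ)

variable {K X : Type} [Field K] [Fintype K] [AddCommGroup X] [Module K X] [Finite X]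

/-- The family `P` has relative density at most `ξ` among the `N`-dimensional subspaces of every
interval `[Q, W]` with `dim Q = p` and `codim W = b`. -/
def DensityLE (P : Submodule K X → Prop) (N : ℕ) (ξ : ℝ) (p b : ℕ) : Prop :=
  ∀ Q W : Submodule K X, Q ≤ W → finrank K Q = p → cod W = b →
    (Nat.card {L : Submodule K X // finrank K L = N ∧ Q ≤ L ∧ L ≤ W ∧ P L} : ℝ) ≤
      ξ * Nat.card {L : Submodule K X // finrank K L = N ∧ Q ≤ L ∧ L ≤ W}

lemma finrank_sup_span_singleton {Q : Submodule K X} {v : X} (hv : v ∉ Q) :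
    finrank K (Q ⊔ K ∙ v : Submodule K X) = finrank K Q + 1 := by
  have h0 : v ≠ 0 := fun h => hv (h ▸ Q.zero_mem)
  have h1 := Submodule.finrank_sup_add_finrank_inf_eq Q (K ∙ v)
  have h2 : Q ⊓ K ∙ v = ⊥ := by
    rw [← disjoint_iff, Submodule.disjoint_span_singleton' h0]; exact hv
  rw [h2, finrank_bot, finrank_span_singleton h0] at h1
  exact h1

lemma card_mem_and_not_mem {Q L : Submodule K X} (h : Q ≤ L) :
    Nat.card {v : X // v ∈ L ∧ v ∉ Q} =
      Fintype.card K ^ finrank K L - Fintype.card K ^ finrank K Q := by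
  have hc : ∀ S : Submodule K X, Fintype.card K ^ finrank K S = (S : Set X).ncard := by
    intro S
    rw [← Nat.card_coe_set_eq, ← Nat.card_eq_fintype_card]
    exact (Module.natCard_eq_pow_finrank (K := K) (V := S)).symm
  rw [hc, hc, ← Set.ncard_sdiff (by exact h) (Set.toFinite _), ← Nat.card_coe_set_eq]
  rfl

lemma DensityLE.of_succ {P : Submodule K X → Prop} {N : ℕ} {ξ : ℝ} {p b : ℕ} (hp : p + 1 ≤ N)
    (h : DensityLE P N ξ (p + 1) b) : DensityLE P N ξ p b := by
  intro Q W hQW hQ hW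
  have hq : 1 < Fintype.card K := Fintype.one_lt_card
  have := card_and_le_of_double_count (fun v : X => v ∈ W ∧ v ∉ Q) (fun v L => v ∈ L)
    (fun L : Submodule K X => finrank K L = N ∧ Q ≤ L ∧ L ≤ W) P
    (Fintype.card K ^ N - Fintype.card K ^ p) (Nat.sub_pos_of_lt (Nat.pow_lt_pow_right hq hp)) ξ ?_ ?_
  · simpa only [and_assoc] using this
  · rintro L ⟨rfl, h1, h2⟩
    rw [← hQ, ← card_mem_and_not_mem h1]
    exact Nat.card_congr (Equiv.subtypeEquivRight fun v =>
      ⟨fun hv => ⟨hv.2, hv.1.2⟩, fun hv => ⟨⟨h2 hv.1, hv.2⟩, hv.1⟩⟩)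
  · rintro v ⟨hvW, hvQ⟩
    have hle : ∀ L : Submodule K X, Q ⊔ K ∙ v ≤ L ↔ Q ≤ L ∧ v ∈ L := fun L => by
      rw [sup_le_iff, Submodule.span_singleton_le_iff_mem]
    have := h (Q ⊔ K ∙ v) W ((hle W).2 ⟨hQW, hvW⟩) (by rw [finrank_sup_span_singleton hvQ, hQ]) hW
    simp only [hle] at this
    convert this using 5 <;> first | tauto | (ext L; tauto)

lemma cod_ker_of_ne_zero {f : Dual K X} (hf : f ≠ 0) : cod (LinearMap.ker f) = 1 := by
  rw [← rk_eq_cod_ker, rk, LinearMap.range_eq_top.2 (LinearMap.surjective hf), finrank_top,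
    finrank_self]

lemma DensityLE.of_codim_one {P : Submodule K X → Prop} {N : ℕ} {ξ : ℝ} {p : ℕ}
    (hN : N < finrank K X) (h : DensityLE P N ξ p 1) : DensityLE P N ξ p 0 := by
  intro Q W hQW hQ hW
  have hWt : W = ⊤ := by
    apply Submodule.eq_top_of_finrank_eq
    have := cod_add_finrank W
    omega
  subst hWt
  have hq : 1 < Fintype.card K := Fintype.one_lt_card
  have := card_and_le_of_double_count (fun f : Dual K X => f ≠ 0 ∧ Q ≤ LinearMap.ker f)
    (fun f L => L ≤ LinearMap.ker f)
    (fun L : Submodule K X => finrank K L = N ∧ Q ≤ L ∧ L ≤ ⊤) P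
    (Fintype.card K ^ (finrank K X - N) - 1)
    (Nat.sub_pos_of_lt (Nat.one_lt_pow (by omega) hq)) ξ ?_ ?_
  · simpa only [and_assoc] using this
  · rintro L ⟨rfl, h1, -⟩
    have h3 := card_mem_and_not_mem (K := K) (bot_le : ⊥ ≤ L.dualAnnihilator)
    have h4 := Subspace.finrank_add_finrank_dualAnnihilator_eq L
    rw [finrank_bot, pow_zero, show finrank K L.dualAnnihilator = finrank K X - finrank K L by omega]
      at h3
    rw [← h3]
    refine Nat.card_congr (Equiv.subtypeEquivRight fun f => ?_)
    have : f ∈ L.dualAnnihilator ↔ L ≤ LinearMap.ker f := by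
      rw [Submodule.mem_dualAnnihilator]; rfl
    rw [this, Submodule.mem_bot]
    exact ⟨fun hf => ⟨hf.2, hf.1.1⟩, fun hf => ⟨⟨hf.2, h1.trans hf.1⟩, hf.1⟩⟩
  · rintro f ⟨hf, hfQ⟩
    have := h Q (LinearMap.ker f) hfQ hQ (cod_ker_of_ne_zero hf)
    convert this using 5 <;> simp only [le_top, and_true] <;> first | tauto | (ext L; tauto)

lemma DensityLE.mono_left {P : Submodule K X → Prop} {N : ℕ} {ξ : ℝ} {p p' b : ℕ} (hp : p ≤ N)
    (hpp : p' ≤ p) (h : DensityLE P N ξ p b) : DensityLE P N ξ p' b := by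
  induction p, hpp using Nat.le_induction with
  | base => exact h
  | succ p _ ih => exact ih (by omega) (h.of_succ hp)

lemma DensityLE.of_antidiagonal {P : Submodule K X → Prop} {N s : ℕ} {ξ : ℝ}
    (hs : s + 1 ≤ N) (hs1 : 1 ≤ s) (hN : N < finrank K X)
    (h : ∀ p b, 0 < p → 0 < b → p + b = s + 1 → DensityLE P N ξ p b) (p b : ℕ) (hpb : p + b ≤ s) :
    DensityLE P N ξ p b := by
  rcases Nat.eq_zero_or_pos b with rfl | hb
  · exact ((h s 1 (by omega) (by omega) rfl).mono_left (by omega) hpb).of_codim_one hN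
  · exact (h (s + 1 - b) b (by omega) hb (by omega)).mono_left (by omega) (by omega)

end Interval

section Indicator

variable {K E X : Type} [Field K] [Fintype K] [AddCommGroup E] [Module K E] [Finite E]
  [AddCommGroup X] [Module K X] [Finite X]

/-- Injective maps with range in the family `P`. -/
def InjInto (P : Submodule K X → Prop) (M : E →ₗ[K] X) : Prop :=
  LinearMap.ker M = ⊥ ∧ P (LinearMap.range M)

/-- The indicator function of the injective maps with range in the family `P`. -/
noncomputable def ind (P : Submodule K X → Prop) (M : E →ₗ[K] X) : ℂ :=
  if InjInto P M then 1 else 0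

lemma injInto_comp_equiv {E₀ : Type} [AddCommGroup E₀] [Module K E₀] (P : Submodule K X → Prop)
    (M : E →ₗ[K] X) (g : E₀ ≃ₗ[K] E) : InjInto P (M ∘ₗ g.toLinearMap) ↔ InjInto P M := by
  unfold InjInto
  rw [LinearMap.range_comp_of_range_eq_top _ (LinearEquiv.range _), LinearMap.ker_eq_bot,
    LinearMap.ker_eq_bot, LinearMap.coe_comp]
  exact and_congr_left fun _ => g.injective_comp M

lemma inv_ind (P : Submodule K X → Prop) : Inv (ind P : (E →ₗ[K] X) → ℂ) := by
  intro g M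
  simp only [ind, injInto_comp_equiv]

lemma nice_indicator {ι : Type} (p : ι → Prop) : Nice (fun i => if p i then (1 : ℂ) else 0) := by
  intro i
  by_cases h : p i
  · exact ⟨1, zero_le_one, le_rfl, by simp [h]⟩
  · exact ⟨0, le_rfl, zero_le_one, by simp [h]⟩

lemma norm_avg_indicator {ι : Type} [Fintype ι] (p : ι → Prop) :
    ‖avg (fun i => if p i then (1 : ℂ) else 0)‖ = Nat.card {i // p i} / Nat.card ι := by
  rw [avg, Finset.sum_boole, norm_mul, norm_inv, Complex.norm_natCast, Complex.norm_natCast,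
    Nat.card_eq_fintype_card, Nat.card_eq_fintype_card, Fintype.card_subtype, div_eq_inv_mul]

variable {P' E' Y : Type} [AddCommGroup P'] [Module K P'] [Finite P'] [AddCommGroup E']
  [Module K E'] [Finite E'] [AddCommGroup Y] [Module K Y] [Finite Y]

lemma card_subtype_comp (W : Submodule K X) (p : (E' →ₗ[K] X) → Prop) :
    Nat.card {w : E' →ₗ[K] W // p (W.subtype ∘ₗ w)} =
      Nat.card {y : E' →ₗ[K] X // LinearMap.range y ≤ W ∧ p y} := by
  refine Nat.card_congr
    { toFun := fun w => ⟨W.subtype ∘ₗ w.1, ?_, w.2⟩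
      invFun := fun y => ⟨y.1.codRestrict W fun x => y.2.1 ⟨x, rfl⟩, y.2.2⟩
      left_inv := fun w => rfl
      right_inv := fun y => rfl }
  rintro _ ⟨x, rfl⟩
  exact (w.1 x).2

lemma injInto_coprod_add (P : Submodule K X → Prop) (ζ : P' →ₗ[K] X) (y : E' →ₗ[K] X)
    (z : E' →ₗ[K] P') :
    InjInto P (LinearMap.coprod ζ (y + ζ ∘ₗ z)) ↔ InjInto P (LinearMap.coprod ζ y) := by
  let g : (P' × E') ≃ₗ[K] (P' × E') := LinearEquiv.ofLinearMap
    (LinearMap.prod (LinearMap.fst K P' E' + z ∘ₗ LinearMap.snd K P' E') (LinearMap.snd K P' E'))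
    (LinearMap.prod (LinearMap.fst K P' E' - z ∘ₗ LinearMap.snd K P' E') (LinearMap.snd K P' E'))
    (by ext <;> simp) (by ext <;> simp)
  rw [← injInto_comp_equiv P (LinearMap.coprod ζ y) g]
  have : LinearMap.coprod ζ (y + ζ ∘ₗ z) = LinearMap.coprod ζ y ∘ₗ g.toLinearMap := by
    ext <;> simp [g, add_comm]
  rw [this]

/-- Restricting the target to the range of `ι` has the same effect as restricting it to the sum of
the ranges of `ι` and `ζ`. -/
lemma card_zoom_eq (P : Submodule K X → Prop) (ζ : P' →ₗ[K] X) (ι : Y →ₗ[K] X) :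
    Nat.card {y : E' →ₗ[K] Y // InjInto P (LinearMap.coprod ζ (ι ∘ₗ y))} *
      Nat.card (E' →ₗ[K] (LinearMap.range ι ⊔ LinearMap.range ζ : Submodule K X)) =
    Nat.card {y : E' →ₗ[K] X // LinearMap.range y ≤ LinearMap.range ι ⊔ LinearMap.range ζ ∧
      InjInto P (LinearMap.coprod ζ y)} * Nat.card (E' →ₗ[K] Y) := by
  set W := LinearMap.range ι ⊔ LinearMap.range ζ with hW
  let j : Y × P' →ₗ[K] W := (LinearMap.coprod ι ζ).codRestrict W fun x =>
    W.add_mem (Submodule.mem_sup_left ⟨_, rfl⟩) (Submodule.mem_sup_right ⟨_, rfl⟩)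
  have hj : LinearMap.range j = ⊤ := by
    rw [LinearMap.range_eq_top]
    rintro ⟨x, hx⟩
    rw [hW, ← LinearMap.range_coprod] at hx
    obtain ⟨a, ha⟩ := hx
    exact ⟨a, Subtype.ext ha⟩
  obtain ⟨s, hs⟩ := LinearMap.exists_rightInverse_of_surjective j hj
  let Ψ : (E' →ₗ[K] Y) × (E' →ₗ[K] P') →+ (E' →ₗ[K] W) :=
    { toFun := fun a => j ∘ₗ LinearMap.prod a.1 a.2
      map_zero' := LinearMap.ext fun _ => map_zero j
      map_add' := fun a b => LinearMap.ext fun x =>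
        map_add j (LinearMap.prod a.1 a.2 x) (LinearMap.prod b.1 b.2 x) }
  have hΨ : Function.Surjective Ψ := fun w => ⟨(LinearMap.fst K Y P' ∘ₗ s ∘ₗ w,
    LinearMap.snd K Y P' ∘ₗ s ∘ₗ w), LinearMap.ext fun x => LinearMap.congr_fun hs (w x)⟩
  have h := card_mul_card_of_surjective Ψ hΨ fun w =>
    InjInto P (LinearMap.coprod ζ (W.subtype ∘ₗ w))
  have h0 := card_subtype_comp (E' := E') W fun y => InjInto P (LinearMap.coprod ζ y)
  rw [h0] at h
  have h1 : ∀ a, InjInto P (LinearMap.coprod ζ (W.subtype ∘ₗ Ψ a)) ↔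
      InjInto P (LinearMap.coprod ζ (ι ∘ₗ a.1)) := by
    intro a
    rw [← injInto_coprod_add P ζ (ι ∘ₗ a.1) a.2]
    rfl
  have h2 : Nat.card {a // InjInto P (LinearMap.coprod ζ (W.subtype ∘ₗ Ψ a))} =
      Nat.card {y : E' →ₗ[K] Y // InjInto P (LinearMap.coprod ζ (ι ∘ₗ y))} *
        Nat.card (E' →ₗ[K] P') := by
    rw [← Nat.card_prod]
    simp only [h1]
    exact Nat.card_congr
      { toFun := fun a => (⟨a.1.1, a.2⟩, a.1.2)
        invFun := fun a => ⟨(a.1.1, a.2), a.1.2⟩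
        left_inv := fun a => rfl
        right_inv := fun a => rfl }
  rw [h2, Nat.card_prod, ← mul_assoc, mul_right_comm] at h
  exact Nat.eq_of_mul_eq_mul_right Nat.card_pos h

lemma card_injInto_coprod_le {P : Submodule K X → Prop} {N : ℕ} {ξ : ℝ} {ζ : P' →ₗ[K] X}
    (hζ : Function.Injective ζ) {W : Submodule K X} (hW : LinearMap.range ζ ≤ W) (hξ : 0 ≤ ξ)
    (hN : N = finrank K P' + finrank K E') (h : DensityLE P N ξ (finrank K P') (cod W)) :
    (Nat.card {y : E' →ₗ[K] X // LinearMap.range y ≤ W ∧ InjInto P (LinearMap.coprod ζ y)} : ℝ) ≤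
      ξ * Nat.card (E' →ₗ[K] W) := by
  subst hN
  obtain ⟨κ, hκ⟩ := exists_card_coprod_eq (E' := E') hζ
  have hr : ∀ y : E' →ₗ[K] X, LinearMap.range y ≤ W ↔
      LinearMap.range (LinearMap.coprod ζ y) ≤ W := by
    intro y
    rw [LinearMap.range_coprod, sup_le_iff, and_iff_right hW]
  have h1 := hκ fun L => L ≤ W ∧ P L
  have h2 := hκ fun L => L ≤ W
  have h3 := h (LinearMap.range ζ) W hW (LinearMap.finrank_range_of_inj hζ) rfl
  have h4 : Nat.card {y : E' →ₗ[K] X // LinearMap.ker (LinearMap.coprod ζ y) = ⊥ ∧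
      LinearMap.range (LinearMap.coprod ζ y) ≤ W} ≤ Nat.card (E' →ₗ[K] W) := by
    have h5 := card_subtype_comp (E' := E') W fun y => LinearMap.ker (LinearMap.coprod ζ y) = ⊥
    simp only [hr] at h5
    rw [show Nat.card {y : E' →ₗ[K] X // LinearMap.ker (LinearMap.coprod ζ y) = ⊥ ∧
      LinearMap.range (LinearMap.coprod ζ y) ≤ W} = _ from
      Nat.card_congr (Equiv.subtypeEquivRight fun y => and_comm), ← h5]
    exact Nat.card_le_card_of_injective _ Subtype.val_injective
  have h6 : Nat.card {y : E' →ₗ[K] X // LinearMap.range y ≤ W ∧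
      InjInto P (LinearMap.coprod ζ y)} = κ * Nat.card {L : Submodule K X //
        finrank K L = finrank K P' + finrank K E' ∧ LinearMap.range ζ ≤ L ∧ L ≤ W ∧ P L} := by
    rw [← h1]
    refine Nat.card_congr (Equiv.subtypeEquivRight fun y => ?_)
    rw [hr, InjInto]
    tauto
  rw [h6]
  have h4' : (κ : ℝ) * Nat.card {L : Submodule K X //
        finrank K L = finrank K P' + finrank K E' ∧ LinearMap.range ζ ≤ L ∧ L ≤ W} ≤
      Nat.card (E' →ₗ[K] W) := by
    rw [h2] at h4
    exact_mod_cast h4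
  push_cast
  refine (mul_le_mul_of_nonneg_left h3 (Nat.cast_nonneg κ)).trans ?_
  rw [mul_left_comm]
  exact mul_le_mul_of_nonneg_left h4' hξ

lemma good_ind {P : Submodule K X → Prop} {s : ℕ} {ξ : ℝ} (hξ : 0 ≤ ξ)
    (h : ∀ p b, p + b ≤ s → DensityLE P (finrank K E) ξ p b) :
    Good (ind P : (E →ₗ[K] X) → ℂ) s ξ := by
  intro P' E' Y _ _ _ _ _ _ _ _ _ θ ζ ι hι hd
  have e : zout (zin (ind P) θ ζ) ι = fun y : E' →ₗ[K] Y =>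
      if InjInto P (LinearMap.coprod ζ (ι ∘ₗ y)) then 1 else 0 := by
    funext y
    simp only [zout, zin, ind, injInto_comp_equiv]
  rw [e, norm_avg_indicator, div_le_iff₀ (by exact_mod_cast Nat.card_pos)]
  by_cases hζ : Function.Injective ζ
  · set W := LinearMap.range ι ⊔ LinearMap.range ζ with hW
    have hN : finrank K E = finrank K P' + finrank K E' := by
      rw [← θ.finrank_eq, finrank_prod]
    have hc : cod W ≤ cod (LinearMap.range ι) := cod_antitone le_sup_left
    have h1 := cod_add_finrank (LinearMap.range ι)
    rw [LinearMap.finrank_range_of_inj hι] at h1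
    have h2 := card_injInto_coprod_le hζ (W := W) le_sup_right hξ hN (h _ _ (by omega))
    have h3 := card_zoom_eq (E' := E') P ζ ι
    rw [← hW] at h3
    have h3' : (Nat.card {y : E' →ₗ[K] Y // InjInto P (LinearMap.coprod ζ (ι ∘ₗ y))} : ℝ) *
        Nat.card (E' →ₗ[K] W) = (Nat.card {y : E' →ₗ[K] X // LinearMap.range y ≤ W ∧
          InjInto P (LinearMap.coprod ζ y)} : ℝ) * Nat.card (E' →ₗ[K] Y) := by
      exact_mod_cast h3
    have h5 : (0 : ℝ) < Nat.card (E' →ₗ[K] W) := by exact_mod_cast Nat.card_pos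
    refine le_of_mul_le_mul_right ?_ h5
    rw [h3', mul_right_comm]
    gcongr
  · have : IsEmpty {y : E' →ₗ[K] Y // InjInto P (LinearMap.coprod ζ (ι ∘ₗ y))} := by
      refine ⟨fun y => hζ ?_⟩
      have h1 := LinearMap.ker_eq_bot.1 y.2.1
      intro a b hab
      have := @h1 (a, 0) (b, 0) (by simpa using hab)
      exact (Prod.mk.inj this).1
    rw [Nat.card_of_isEmpty, Nat.cast_zero]
    positivity

end Indicator

section Tables

variable {K X : Type} [Field K] [Fintype K] [AddCommGroup X] [Module K X] [Finite X]

lemma card_extensions (L : Submodule K X) (h : L →ₗ[K] K) :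
    Nat.card {f : Dual K X // f ∘ₗ L.subtype = h} = Fintype.card K ^ (finrank K X - finrank K L) := by
  let Φ : Dual K X →+ (L →ₗ[K] K) := (LinearMap.lcomp K K L.subtype).toAddMonoidHom
  have hΦ : Function.Surjective Φ := fun g => (LinearMap.exists_extend g).imp fun _ h => h
  have h1 := card_mul_card_of_surjective Φ hΦ fun g => g = h
  have h2 : Nat.card {g : L →ₗ[K] K // g = h} = 1 := Nat.card_unique
  rw [h2, one_mul, Nat.card_eq_fintype_card (α := L →ₗ[K] K),
    Nat.card_eq_fintype_card (α := Dual K X), card_linearMap, card_linearMap, finrank_self, mul_one,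
    mul_one] at h1
  refine Nat.eq_of_mul_eq_mul_right (pow_pos (Fintype.card_pos (α := K)) (finrank K L)) ?_
  rw [← pow_add, Nat.sub_add_cancel (Submodule.finrank_le L), ← h1]
  rfl

/-- The subspaces of the family `S` on which the table `T` is given by the function `f`. -/
def Agree (T : (L : Submodule K X) → (L →ₗ[K] K)) (S : Submodule K X → Prop) (f : Dual K X)
    (L : Submodule K X) : Prop := S L ∧ f ∘ₗ L.subtype = T L

/-- The table `T₁` on the larger subspace restricts to the table `T₂` on the smaller one. -/
def Consistent (T₁ T₂ : (L : Submodule K X) → (L →ₗ[K] K)) (p : Submodule K X × Submodule K X) :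
    Prop := ∀ (x : X) (hx2 : x ∈ p.2) (hx1 : x ∈ p.1), T₁ p.1 ⟨x, hx1⟩ = T₂ p.2 ⟨x, hx2⟩

lemma Consistent.comp_subtype_eq {T₁ T₂ : (L : Submodule K X) → (L →ₗ[K] K)}
    {p : Submodule K X × Submodule K X} (h : Consistent T₁ T₂ p) (hp : p.2 ≤ p.1) {f : Dual K X}
    (hf : f ∘ₗ p.1.subtype = T₁ p.1) : f ∘ₗ p.2.subtype = T₂ p.2 := by
  ext ⟨x, hx⟩
  rw [← h x hx (hp hx), ← hf]
  rfl

variable {E₁ E₂ : Type} [AddCommGroup E₁] [Module K E₁] [Finite E₁]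
  [AddCommGroup E₂] [Module K E₂] [Finite E₂]

lemma sum_card_agree_ge (T₁ T₂ : (L : Submodule K X) → (L →ₗ[K] K)) (S : Submodule K X → Prop) :
    (Fintype.card K : ℝ) ^ (finrank K X - (finrank K E₁ + finrank K E₂)) *
      Nat.card {M : E₁ × E₂ →ₗ[K] X // LinearMap.ker M = ⊥ ∧ (S (LinearMap.range M) ∧
        Consistent T₁ T₂ (LinearMap.range M, LinearMap.range (M ∘ₗ LinearMap.inl K E₁ E₂)))} ≤
    ∑ f : Dual K X, ∑ M : E₁ →ₗ[K] X, (Nat.card {y : E₂ →ₗ[K] X //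
      InjInto (Agree T₁ S f) (LinearMap.coprod M y)} : ℝ) *
        (if InjInto (Agree T₂ (fun _ => True) f) M then 1 else 0) := by
  simp only [Nat.card_eq_fintype_card, Fintype.card_subtype, ← Finset.sum_boole (R := ℝ)]
  simp only [Finset.sum_mul]
  rw [Finset.sum_comm, Finset.mul_sum, ← (LinearMap.coprodEquiv K (M := E₁) (M₂ := E₂)
    (M₃ := X)).toEquiv.sum_comp, Fintype.sum_prod_type]
  refine Finset.sum_le_sum fun M₁ _ => ?_
  rw [Finset.sum_comm]
  refine Finset.sum_le_sum fun M₂ _ => ?_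
  simp only [LinearEquiv.coe_toEquiv, LinearMap.coprodEquiv_apply, LinearMap.coprod_inl]
  split_ifs with h
  · have h2 := card_extensions _ (T₁ (LinearMap.range (LinearMap.coprod M₁ M₂)))
    rw [finrank_range_of_ker_eq_bot h.1, finrank_prod, Nat.card_eq_fintype_card,
      Fintype.card_subtype] at h2
    rw [mul_one, ← Nat.cast_pow, ← h2, ← Finset.sum_boole]
    refine Finset.sum_le_sum fun f _ => ?_
    split_ifs with h3 h4 h5 <;> norm_num
    · refine h5 ⟨?_, trivial, ?_⟩
      · rw [LinearMap.ker_eq_bot]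
        have := LinearMap.ker_eq_bot.1 h.1
        intro a b hab
        exact (Prod.mk.inj (@this (a, 0) (b, 0) (by simpa using hab))).1
      · refine h.2.2.comp_subtype_eq ?_ h3
        rw [LinearMap.range_coprod]
        exact le_sup_left
    all_goals exact h4 ⟨h.1, h.2.1, h3⟩
  · rw [mul_zero]
    exact Finset.sum_nonneg fun _ _ => by positivity

lemma sum_card_agree_le (T : (L : Submodule K X) → (L →ₗ[K] K)) :
    ∑ f : Dual K X, ∑ M : E₁ →ₗ[K] X,
        (if InjInto (Agree T (fun _ => True) f) M then (1 : ℝ) else 0) ≤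
      Fintype.card (E₁ →ₗ[K] X) * (Fintype.card K : ℝ) ^ (finrank K X - finrank K E₁) := by
  rw [Finset.sum_comm, ← nsmul_eq_mul, ← Finset.card_univ]
  refine Finset.sum_le_card_nsmul _ _ _ fun M _ => ?_
  by_cases h : LinearMap.ker M = ⊥
  · have h2 := card_extensions _ (T (LinearMap.range M))
    rw [finrank_range_of_ker_eq_bot h, Nat.card_eq_fintype_card, Fintype.card_subtype] at h2
    rw [← Nat.cast_pow, ← h2, ← Finset.sum_boole]
    refine Finset.sum_le_sum fun f _ => ?_
    split_ifs with h3 h4 <;> norm_num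
    exact h4 h3.2.2
  · simp only [InjInto, h, false_and, if_false, Finset.sum_const_zero]
    positivity

/-- The main analytic estimate: a large number of consistent pairs is incompatible with small
density of agreement in all intervals. -/
lemma exists_le_of_densityLE (K : Type) [Field K] [Fintype K] {r d : ℕ} (hdr : 2 * d ≤ r)
    (hr : 1 ≤ r) {t : ℕ} (ht : 1 ≤ t) : ∃ C : ℝ, 0 ≤ C ∧
    ∀ (E₁ E₂ X : Type) [AddCommGroup E₁] [Module K E₁] [Finite E₁] [AddCommGroup E₂] [Module K E₂]
      [Finite E₂] [AddCommGroup X] [Module K X] [Finite X]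
      (T₁ T₂ : (L : Submodule K X) → (L →ₗ[K] K)) (S : Submodule K X → Prop) (ξ lam c : ℝ) (N : ℕ),
      N = finrank K E₁ + finrank K E₂ → N < finrank K X → r + 1 ≤ N →
      (∀ f p b, 0 < p → 0 < b → p + b = r + 1 → DensityLE (Agree T₁ S f) N ξ p b) →
      0 < ξ → ξ ≤ 1 → ξ⁻¹ ≤ (Fintype.card K : ℝ) ^ N →
      2 * N ≤ finrank K E₂ * (r - d) → 4 * N ≤ finrank K E₂ * (d + 1) → 0 < lam →
      c * (Fintype.card K : ℝ) ^ (N * finrank K X) ≤ Nat.card {M : E₁ × E₂ →ₗ[K] X //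
        LinearMap.ker M = ⊥ ∧ (S (LinearMap.range M) ∧
          Consistent T₁ T₂ (LinearMap.range M, LinearMap.range (M ∘ₗ LinearMap.inl K E₁ E₂)))} →
      c ≤ lam * (Fintype.card K : ℝ) ^ finrank K E₂ + (Fintype.card K : ℝ) ^ N *
        ((C * ξ ^ 2) ^ t / lam ^ (2 * t - 1) + 2 * ((Fintype.card K : ℝ) ^ (2 * N))⁻¹) := by
  obtain ⟨C, hC, hmain⟩ := exists_sum_norm_avg_zin_mul_le K hdr ht
  refine ⟨C, hC, ?_⟩
  intro E₁ E₂ X _ _ _ _ _ _ _ _ _ T₁ T₂ S ξ lam c N hN hNX hrN hD hξ0 hξ1 hξ hN1 hN2 hl hc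
  have hEN : finrank K (E₁ × E₂) = N := by rw [finrank_prod, hN]
  have hf : ∀ f : Dual K X, _ := fun f => hmain (E₁ × E₂) E₁ E₂ X (LinearEquiv.refl K _)
    (ind (Agree T₁ S f)) ξ lam (finrank K E₂) N (inv_ind _) (nice_indicator _)
    (good_ind hξ0.le fun p b hpb => by
      rw [hEN]
      exact DensityLE.of_antidiagonal hrN hr hNX (hD f) p b hpb) hξ0 hξ1 (by omega)
    (by rw [finrank_prod]) hξ hN1 hN2 hl
    (fun M => if InjInto (Agree T₂ (fun _ => True) f) M then 1 else 0)
    (fun M => by positivity) (fun M => by split_ifs <;> norm_num)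
  set R : ℝ := (C * ξ ^ 2) ^ t / lam ^ (2 * t - 1) + 2 * ((Fintype.card K : ℝ) ^ (2 * N))⁻¹
  have e : ∀ (f : Dual K X) (M : E₁ →ₗ[K] X),
      ‖avg (zin (ind (Agree T₁ S f)) (LinearEquiv.refl K (E₁ × E₂)) M)‖ =
        (Nat.card (E₂ →ₗ[K] X) : ℝ)⁻¹ * Nat.card {y : E₂ →ₗ[K] X //
          InjInto (Agree T₁ S f) (LinearMap.coprod M y)} := by
    intro f M
    rw [← div_eq_inv_mul, ← norm_avg_indicator]
    rfl
  have hs := Finset.sum_le_sum fun f (_ : f ∈ Finset.univ) => hf f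
  simp only [e, mul_assoc, ← Finset.mul_sum, Finset.sum_add_distrib, Finset.sum_const] at hs
  have h1 := sum_card_agree_ge (E₁ := E₁) (E₂ := E₂) T₁ T₂ S
  have h2 := sum_card_agree_le (E₁ := E₁) T₂
  have hq := one_le_card K
  rw [Nat.card_eq_fintype_card, card_linearMap, Finset.card_univ,
    card_linearMap (E := X) (X := K), finrank_self, mul_one, nsmul_eq_mul, card_linearMap] at hs
  rw [card_linearMap] at h2
  push_cast at hs h2
  set q : ℝ := (Fintype.card K : ℝ)
  set n := finrank K X
  set m := finrank K E₁
  set k := finrank K E₂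
  have hq0 : 0 < q := by linarith
  have hlow : q ^ (n - N) * (c * q ^ (m * n)) ≤ (q ^ (k * n))⁻¹ * ∑ f : Dual K X,
      ∑ M : E₁ →ₗ[K] X, (Nat.card {y : E₂ →ₗ[K] X //
      InjInto (Agree T₁ S f) (LinearMap.coprod M y)} : ℝ) *
        (if InjInto (Agree T₂ (fun _ => True) f) M then 1 else 0) := by
    rw [inv_mul_eq_div, le_div_iff₀ (by positivity)]
    refine le_trans ?_ h1
    rw [← hN, mul_assoc, mul_assoc, ← pow_add, ← add_mul, ← hN]
    gcongr
  have hfin := hlow.trans (hs.trans (add_le_add_left (mul_le_mul_of_nonneg_left h2 hl.le) _))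
  have p1 : q ^ n = q ^ (n - N) * q ^ N := by rw [← pow_add]; congr 1; omega
  have p2 : q ^ (n - m) = q ^ (n - N) * q ^ k := by rw [← pow_add]; congr 1; omega
  rw [p1, p2] at hfin
  refine le_of_mul_le_mul_left ?_ (show 0 < q ^ (n - N) * q ^ (m * n) by positivity)
  calc _ = q ^ (n - N) * (c * q ^ (m * n)) := by ring
    _ ≤ _ := hfin
    _ = _ := by ring

end Tables

section Abundance

variable {K X E : Type} [Field K] [Fintype K] [AddCommGroup X] [Module K X] [Finite X]
  [AddCommGroup E] [Module K E] [Finite E]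

lemma half_le_card_injective (h : 2 * finrank K E + 1 ≤ finrank K X) :
    (1 / 2 : ℝ) * (Fintype.card K : ℝ) ^ (finrank K E * finrank K X) ≤
      Nat.card {M : E →ₗ[K] X // LinearMap.ker M = ⊥} := by
  have hc : cod (⊥ : Submodule K E) = finrank K E := by
    have := cod_add_finrank (⊥ : Submodule K E)
    rwa [finrank_bot, add_zero] at this
  have h1 := card_ker_eq (E := X) (⊥ : Submodule K E) (by omega)
  rw [Nat.card_eq_fintype_card, h1, hc]
  push_cast
  set N := finrank K E
  set n := finrank K X
  have hq1 : 1 < Fintype.card K := Fintype.one_lt_card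
  have hq : (2 : ℝ) ≤ Fintype.card K := by exact_mod_cast hq1
  have hq' := one_le_card K
  set a : ℝ := 1 / 2 ^ (N + 1)
  have ha : (N : ℝ) * a ≤ 1 / 2 := by
    have : (N : ℝ) ≤ 2 ^ N := by exact_mod_cast Nat.lt_two_pow_self.le
    simp only [a]
    rw [mul_one_div, div_le_div_iff₀ (by positivity) (by positivity), pow_succ]
    linarith
  have ha1 : a ≤ 1 := by
    simp only [a]
    rw [div_le_one (by positivity)]
    exact one_le_pow₀ (by norm_num)
  have hb := one_add_mul_le_pow (a := -a) (by linarith) N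
  have hfac : ∀ i : Fin N, (Fintype.card K : ℝ) ^ n * (1 + -a) ≤
      ((Fintype.card K ^ n - Fintype.card K ^ (i : ℕ) : ℕ) : ℝ) := by
    intro i
    rw [Nat.cast_sub (Nat.pow_le_pow_right (by omega) (by omega))]
    push_cast
    have h3 : (Fintype.card K : ℝ) ^ (i : ℕ) ≤ (Fintype.card K : ℝ) ^ n * a := by
      simp only [a]
      rw [mul_one_div, le_div_iff₀ (by positivity)]
      calc (Fintype.card K : ℝ) ^ (i : ℕ) * 2 ^ (N + 1)
          ≤ (Fintype.card K : ℝ) ^ N * (Fintype.card K : ℝ) ^ (N + 1) := by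
            gcongr
            exact i.2.le
        _ = (Fintype.card K : ℝ) ^ (2 * N + 1) := by rw [← pow_add]; congr 1; ring
        _ ≤ _ := pow_le_pow_right₀ hq' h
    linarith
  calc _ ≤ (1 + -a) ^ N * (Fintype.card K : ℝ) ^ (N * n) := by
        gcongr; linarith
    _ = ∏ _i : Fin N, (Fintype.card K : ℝ) ^ n * (1 + -a) := by
        rw [Finset.prod_const, Finset.card_univ, Fintype.card_fin, mul_pow, ← pow_mul, mul_comm,
          mul_comm n]
    _ ≤ _ := Finset.prod_le_prod (fun _ _ => mul_nonneg (by positivity) (by linarith))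
        fun i _ => hfac i

lemma card_injInto_le {Bd : Submodule K X → Prop} {β : ℝ} (hβ : 0 ≤ β)
    (h : (Nat.card {Q : Submodule K X // finrank K Q = finrank K E ∧ Bd Q} : ℝ) ≤
      β * Nat.card {Q : Submodule K X // finrank K Q = finrank K E}) :
    (Nat.card {M : E →ₗ[K] X // InjInto Bd M} : ℝ) ≤
      β * (Fintype.card K : ℝ) ^ (finrank K E * finrank K X) := by
  obtain ⟨κ, hκ⟩ := exists_card_ker_eq_bot_eq K E X
  have h1 := hκ Bd
  have h2 := hκ fun _ => True
  simp only [and_true] at h2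
  have h3 : Nat.card {M : E →ₗ[K] X // LinearMap.ker M = ⊥} ≤
      Fintype.card K ^ (finrank K E * finrank K X) := by
    rw [← card_linearMap, ← Nat.card_eq_fintype_card]
    exact Nat.card_le_card_of_injective _ Subtype.val_injective
  rw [h2] at h3
  have h3' : (κ : ℝ) * Nat.card {Q : Submodule K X // finrank K Q = finrank K E} ≤
      (Fintype.card K : ℝ) ^ (finrank K E * finrank K X) := by exact_mod_cast h3
  unfold InjInto
  rw [h1]
  push_cast
  refine (mul_le_mul_of_nonneg_left h (Nat.cast_nonneg κ)).trans ?_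
  rw [mul_left_comm]
  exact mul_le_mul_of_nonneg_left h3' hβ

lemma card_injInto_comp_le {D : Type} [AddCommGroup D] [Module K D] [Finite D]
    {A : D →ₗ[K] E} (hA : Function.Injective A) {p : (D →ₗ[K] X) → Prop} {β : ℝ}
    (h : (Nat.card {B : D →ₗ[K] X // p B} : ℝ) ≤
      β * (Fintype.card K : ℝ) ^ (finrank K D * finrank K X)) :
    (Nat.card {M : E →ₗ[K] X // p (M ∘ₗ A)} : ℝ) ≤
      β * (Fintype.card K : ℝ) ^ (finrank K E * finrank K X) := by
  obtain ⟨s, hs⟩ := LinearMap.exists_leftInverse_of_injective A (LinearMap.ker_eq_bot.2 hA)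
  let Φ : (E →ₗ[K] X) →+ (D →ₗ[K] X) :=
    { toFun := fun M => M ∘ₗ A
      map_zero' := LinearMap.zero_comp A
      map_add' := fun M M' => LinearMap.add_comp A M' M }
  have hΦ : Function.Surjective Φ := fun B => ⟨B ∘ₗ s, by
    change (B ∘ₗ s) ∘ₗ A = B
    rw [LinearMap.comp_assoc, hs, LinearMap.comp_id]⟩
  have h1 := card_mul_card_of_surjective Φ hΦ p
  rw [Nat.card_eq_fintype_card (α := D →ₗ[K] X), Nat.card_eq_fintype_card (α := E →ₗ[K] X),
    card_linearMap, card_linearMap] at h1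
  have h1' : (Nat.card {M : E →ₗ[K] X // p (M ∘ₗ A)} : ℝ) *
      (Fintype.card K : ℝ) ^ (finrank K D * finrank K X) = (Nat.card {B : D →ₗ[K] X // p B} : ℝ) *
        (Fintype.card K : ℝ) ^ (finrank K E * finrank K X) := by exact_mod_cast h1
  have hq := one_le_card K
  refine le_of_mul_le_mul_right ?_
    (show 0 < (Fintype.card K : ℝ) ^ (finrank K D * finrank K X) by positivity)
  rw [h1', mul_right_comm]
  gcongr

lemma card_range_contains_le {Bd : Submodule K X → Prop} {β : ℝ} (hβ : 0 ≤ β) (r : ℕ)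
    (h : (Nat.card {Q : Submodule K X // finrank K Q = r ∧ Bd Q} : ℝ) ≤
      β * Nat.card {Q : Submodule K X // finrank K Q = r}) :
    (Nat.card {M : E →ₗ[K] X // LinearMap.ker M = ⊥ ∧ ∃ Q ≤ LinearMap.range M,
      finrank K Q = r ∧ Bd Q} : ℝ) ≤ (Fintype.card K : ℝ) ^ (finrank K E * r) *
        (β * (Fintype.card K : ℝ) ^ (finrank K E * finrank K X)) := by
  have hr : finrank K (Fin r → K) = r := finrank_fin_fun K
  have h1 := card_injInto_le (E := Fin r → K) hβ (by rwa [hr])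
  rw [Nat.card_eq_fintype_card, Fintype.card_subtype]
  let 𝒜 : Finset ((Fin r → K) →ₗ[K] E) := Finset.univ.filter fun A => LinearMap.ker A = ⊥
  have hsub : (Finset.univ.filter fun M : E →ₗ[K] X => LinearMap.ker M = ⊥ ∧
      ∃ Q ≤ LinearMap.range M, finrank K Q = r ∧ Bd Q) ⊆
      𝒜.biUnion fun A =>
        Finset.univ.filter fun M : E →ₗ[K] X => InjInto Bd (M ∘ₗ A) := by
    intro M hM
    obtain ⟨hk, Q, hQ, hQr, hQB⟩ := (Finset.mem_filter.1 hM).2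
    have hM' := LinearMap.ker_eq_bot.1 hk
    let e := LinearEquiv.ofInjective M hM'
    have e' : (Fin r → K) ≃ₗ[K] Q := LinearEquiv.ofFinrankEq _ _ (by rw [hr, hQr])
    let A : (Fin r → K) →ₗ[K] E :=
      e.symm.toLinearMap ∘ₗ Submodule.inclusion hQ ∘ₗ e'.toLinearMap
    have hA : Function.Injective A :=
      e.symm.injective.comp ((Submodule.inclusion_injective hQ).comp e'.injective)
    have hMA : M ∘ₗ A = Q.subtype ∘ₗ e'.toLinearMap := by
      ext x
      exact congrArg Subtype.val (e.apply_symm_apply (Submodule.inclusion hQ (e' _)))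
    simp only [𝒜, Finset.mem_biUnion, Finset.mem_filter, Finset.mem_univ, true_and]
    refine ⟨A, LinearMap.ker_eq_bot.2 hA, ?_, ?_⟩
    · rw [LinearMap.ker_eq_bot]
      exact hM'.comp hA
    · rwa [hMA, LinearMap.range_comp_of_range_eq_top _ (LinearEquiv.range _),
        Submodule.range_subtype]
  have hq := one_le_card K
  calc _ ≤ ((𝒜.biUnion
        fun A => Finset.univ.filter fun M : E →ₗ[K] X => InjInto Bd (M ∘ₗ A)).card : ℝ) := by
        exact_mod_cast Finset.card_le_card hsub
    _ ≤ ∑ A ∈ 𝒜,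
        ((Finset.univ.filter fun M : E →ₗ[K] X => InjInto Bd (M ∘ₗ A)).card : ℝ) := by
        exact_mod_cast Finset.card_biUnion_le
    _ ≤ ∑ A ∈ 𝒜,
        β * (Fintype.card K : ℝ) ^ (finrank K E * finrank K X) := by
        refine Finset.sum_le_sum fun A hA => ?_
        have := card_injInto_comp_le (E := E) (LinearMap.ker_eq_bot.1 (Finset.mem_filter.1 hA).2) h1
        rwa [Nat.card_eq_fintype_card, Fintype.card_subtype] at this
    _ ≤ _ := by
        rw [Finset.sum_const, nsmul_eq_mul]
        gcongr
        have h2 := Finset.card_le_univ 𝒜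
        rw [card_linearMap, hr, mul_comm] at h2
        exact_mod_cast h2

variable {E₁ E₂ : Type} [AddCommGroup E₁] [Module K E₁] [Finite E₁]
  [AddCommGroup E₂] [Module K E₂] [Finite E₂]

lemma card_consistent_ge (T₁ T₂ : (L : Submodule K X) → (L →ₗ[K] K)) {ε : ℝ}
    (hε : ε ≤ (Nat.card {p : Submodule K X × Submodule K X //
      finrank K p.1 = finrank K E₁ + finrank K E₂ ∧ finrank K p.2 = finrank K E₁ ∧ p.2 ≤ p.1 ∧
        Consistent T₁ T₂ p} : ℝ) / Nat.card {p : Submodule K X × Submodule K X //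
      finrank K p.1 = finrank K E₁ + finrank K E₂ ∧ finrank K p.2 = finrank K E₁ ∧ p.2 ≤ p.1}) :
    ε * Nat.card {M : E₁ × E₂ →ₗ[K] X // LinearMap.ker M = ⊥} ≤
      Nat.card {M : E₁ × E₂ →ₗ[K] X // LinearMap.ker M = ⊥ ∧
        Consistent T₁ T₂ (LinearMap.range M, LinearMap.range (M ∘ₗ LinearMap.inl K E₁ E₂))} := by
  obtain ⟨κ, hκ⟩ := exists_card_flag_eq K E₁ E₂ X
  have h1 := hκ (Consistent T₁ T₂)
  have h2 := hκ fun _ => True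
  simp only [and_true] at h2
  rw [h1, h2]
  push_cast
  rw [mul_left_comm]
  refine mul_le_mul_of_nonneg_left ?_ (Nat.cast_nonneg κ)
  rcases (Nat.cast_nonneg _ : (0 : ℝ) ≤ Nat.card {p : Submodule K X × Submodule K X //
      finrank K p.1 = finrank K E₁ + finrank K E₂ ∧ finrank K p.2 = finrank K E₁ ∧
        p.2 ≤ p.1}).eq_or_lt with h | h
  · rw [← h, mul_zero]
    exact Nat.cast_nonneg _
  · rwa [le_div_iff₀ h] at hε

lemma card_good_ge (T₁ T₂ : (L : Submodule K X) → (L →ₗ[K] K)) {ε β : ℝ} {rr : ℕ}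
    {Bd : ℕ → Submodule K X → Prop} (hβ : 0 ≤ β) (hε0 : 0 ≤ ε)
    (hX : 2 * (finrank K E₁ + finrank K E₂) + 1 ≤ finrank K X)
    (hε : ε ≤ (Nat.card {p : Submodule K X × Submodule K X //
      finrank K p.1 = finrank K E₁ + finrank K E₂ ∧ finrank K p.2 = finrank K E₁ ∧ p.2 ≤ p.1 ∧
        Consistent T₁ T₂ p} : ℝ) / Nat.card {p : Submodule K X × Submodule K X //
      finrank K p.1 = finrank K E₁ + finrank K E₂ ∧ finrank K p.2 = finrank K E₁ ∧ p.2 ≤ p.1})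
    (hB : ∀ r, 0 < r → r < rr → (Nat.card {Q : Submodule K X // finrank K Q = r ∧ Bd r Q} : ℝ) ≤
      β * Nat.card {Q : Submodule K X // finrank K Q = r})
    (hsmall : rr * (Fintype.card K : ℝ) ^ ((finrank K E₁ + finrank K E₂) * rr) * β ≤ ε / 4) :
    ε / 4 * (Fintype.card K : ℝ) ^ ((finrank K E₁ + finrank K E₂) * finrank K X) ≤
      Nat.card {M : E₁ × E₂ →ₗ[K] X // LinearMap.ker M = ⊥ ∧
        ((∀ r, 0 < r → r < rr → ∀ Q ≤ LinearMap.range M, finrank K Q = r → ¬ Bd r Q) ∧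
        Consistent T₁ T₂ (LinearMap.range M, LinearMap.range (M ∘ₗ LinearMap.inl K E₁ E₂)))} := by
  have hN : finrank K (E₁ × E₂) = finrank K E₁ + finrank K E₂ := finrank_prod
  have h1 := card_consistent_ge T₁ T₂ hε
  have h2 := half_le_card_injective (X := X) (E := E₁ × E₂) (by rwa [hN])
  have h3 : ∀ r ∈ Finset.range rr, (Nat.card {M : E₁ × E₂ →ₗ[K] X // LinearMap.ker M = ⊥ ∧
      ∃ Q ≤ LinearMap.range M, finrank K Q = r ∧ (0 < r ∧ Bd r Q)} : ℝ) ≤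
      (Fintype.card K : ℝ) ^ ((finrank K E₁ + finrank K E₂) * rr) *
        (β * (Fintype.card K : ℝ) ^ ((finrank K E₁ + finrank K E₂) * finrank K X)) := by
    intro r hr
    have hr' := Finset.mem_range.1 hr
    have hq := one_le_card K
    rw [← hN]
    refine (card_range_contains_le (E := E₁ × E₂) (Bd := fun Q => 0 < r ∧ Bd r Q) hβ r ?_).trans ?_
    · rcases Nat.eq_zero_or_pos r with rfl | h0
      · simp only [lt_irrefl, false_and, and_false, Nat.card_of_isEmpty, Nat.cast_zero]
        positivity
      · simpa only [h0, true_and] using hB r h0 hr'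
    · gcongr
  have hsub : (Finset.univ.filter fun M : E₁ × E₂ →ₗ[K] X => LinearMap.ker M = ⊥ ∧
        Consistent T₁ T₂ (LinearMap.range M, LinearMap.range (M ∘ₗ LinearMap.inl K E₁ E₂))) ⊆
      (Finset.univ.filter fun M : E₁ × E₂ →ₗ[K] X => LinearMap.ker M = ⊥ ∧
        ((∀ r, 0 < r → r < rr → ∀ Q ≤ LinearMap.range M, finrank K Q = r → ¬ Bd r Q) ∧
        Consistent T₁ T₂ (LinearMap.range M, LinearMap.range (M ∘ₗ LinearMap.inl K E₁ E₂)))) ∪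
      (Finset.range rr).biUnion fun r => Finset.univ.filter fun M : E₁ × E₂ →ₗ[K] X =>
        LinearMap.ker M = ⊥ ∧ ∃ Q ≤ LinearMap.range M, finrank K Q = r ∧ (0 < r ∧ Bd r Q) := by
    intro M hM
    obtain ⟨hk, hc⟩ := (Finset.mem_filter.1 hM).2
    simp only [Finset.mem_union, Finset.mem_biUnion, Finset.mem_filter, Finset.mem_univ, true_and,
      Finset.mem_range]
    by_cases h : ∀ r, 0 < r → r < rr → ∀ Q ≤ LinearMap.range M, finrank K Q = r → ¬ Bd r Q
    · exact Or.inl ⟨hk, h, hc⟩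
    · push Not at h
      obtain ⟨r, h0, hr, Q, hQ, hQr, hQB⟩ := h
      exact Or.inr ⟨r, hr, hk, Q, hQ, hQr, h0, hQB⟩
  have h4 := (Finset.card_le_card hsub).trans ((Finset.card_union_le _ _).trans
    (Nat.add_le_add_left Finset.card_biUnion_le _))
  simp only [← Fintype.card_subtype, ← Nat.card_eq_fintype_card] at h4
  have h4' := (Nat.cast_le (α := ℝ)).2 h4
  push_cast at h4'
  have h5 := Finset.sum_le_sum h3
  rw [Finset.sum_const, Finset.card_range, nsmul_eq_mul] at h5
  rw [hN] at h2
  set Z := (Fintype.card K : ℝ) ^ ((finrank K E₁ + finrank K E₂) * finrank K X)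
  have hZ : 0 ≤ Z := by positivity
  have h6 := mul_le_mul_of_nonneg_right hsmall hZ
  have h7 := mul_le_mul_of_nonneg_left h2 hε0
  linarith

end Abundance

section Parameters

lemma error_lt {q x C : ℝ} {k N t : ℕ} (hq : 2 ≤ q) (hC : 0 ≤ C) (hCk : 16 * C ≤ q ^ k)
    (hk : 1 ≤ k) (hN : 2 ≤ N) (ht : 1 ≤ t) (htk : t * k = 10 * N) (hx0 : 0 ≤ x)
    (hx : x * q ^ N ≤ q ^ k) {ε lam : ℝ} (hε : ε = 2 * q ^ (1000 * k) / q ^ N)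
    (hlam : lam = ε / (8 * q ^ k)) :
    lam * q ^ k + q ^ N * ((C * x ^ 2) ^ t / lam ^ (2 * t - 1) + 2 * (q ^ (2 * N))⁻¹) < ε / 4 := by
  have htA : (q ^ k) ^ t = (q ^ N) ^ 10 := by
    rw [← pow_mul, ← pow_mul, mul_comm k, htk, mul_comm N]
  have hA2 : 2 ≤ q ^ k := hq.trans (le_self_pow₀ (by linarith) (by omega))
  have hB4 : 4 ≤ q ^ N := by
    calc (4 : ℝ) = 2 ^ 2 := by norm_num
      _ ≤ q ^ 2 := by gcongr
      _ ≤ q ^ N := pow_le_pow_right₀ (by linarith) hN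
  rw [mul_comm 1000, pow_mul] at hε
  rw [mul_comm 2 N, pow_mul q N 2]
  set A := q ^ k
  set B := q ^ N
  have hA0 : 0 < A := by linarith
  have hB0 : 0 < B := by linarith
  have hε0 : 0 < ε := by rw [hε]; positivity
  have hlam0 : 0 < lam := by rw [hlam]; positivity
  have e1 : lam * A = ε / 8 := by rw [hlam]; field_simp
  have hlamε : lam ≤ ε / 8 := by
    rw [← e1]; exact le_mul_of_one_le_right hlam0.le (by linarith)
  have hlamB : A ^ 2 ≤ 4 * (lam * B) := by
    have : 4 * (lam * B) = A ^ 999 := by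
      rw [hlam, hε, pow_succ A 999]; field_simp; norm_num
    rw [this]
    exact pow_le_pow_right₀ (by linarith) (by norm_num)
  have e2 : C * x ^ 2 ≤ lam ^ 2 / A := by
    rw [le_div_iff₀ hA0]
    have h1 : (x * B) ^ 2 ≤ A ^ 2 := by gcongr
    have h2 : (A ^ 2) ^ 2 ≤ (4 * (lam * B)) ^ 2 := by gcongr
    have h3 : (16 * C) * (x * B) ^ 2 ≤ A * A ^ 2 := by gcongr
    have h4 : (C * x ^ 2 * A) * (16 * B ^ 2) ≤ lam ^ 2 * (16 * B ^ 2) := by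
      calc _ = A * ((16 * C) * (x * B) ^ 2) := by ring
        _ ≤ A * (A * A ^ 2) := by gcongr
        _ = (A ^ 2) ^ 2 := by ring
        _ ≤ _ := h2
        _ = _ := by ring
    exact le_of_mul_le_mul_right h4 (by positivity)
  have e3 : (C * x ^ 2) ^ t / lam ^ (2 * t - 1) ≤ lam / B ^ 10 := by
    rw [div_le_iff₀ (by positivity)]
    calc (C * x ^ 2) ^ t ≤ (lam ^ 2 / A) ^ t := by gcongr
      _ = lam ^ (1 + (2 * t - 1)) / B ^ 10 := by
        rw [div_pow, htA, ← pow_mul]; congr 2; omega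
      _ = _ := by rw [pow_add]; ring
  have e4 : B * (lam / B ^ 10) ≤ ε / 32 := by
    have : B * (lam / B ^ 10) = lam / B ^ 9 := by field_simp
    rw [this, div_le_iff₀ (by positivity)]
    have : (4 : ℝ) ≤ B ^ 9 := hB4.trans (le_self_pow₀ (by linarith) (by norm_num))
    nlinarith
  have e5 : B * (2 * (B ^ 2)⁻¹) ≤ ε / 16 := by
    have h1 : (16 : ℝ) ≤ A ^ 1000 := by
      calc (16 : ℝ) = 2 ^ 4 := by norm_num
        _ ≤ A ^ 4 := by gcongr
        _ ≤ _ := pow_le_pow_right₀ (by linarith) (by norm_num)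
    have h2 : B * (2 * (B ^ 2)⁻¹) = 2 / B := by field_simp
    rw [h2, hε, div_div, div_le_div_iff₀ hB0 (by positivity)]
    nlinarith
  rw [mul_add, e1]
  have e6 := mul_le_mul_of_nonneg_left e3 hB0.le
  linarith

end Parameters

end LinFourier

lemma consistFrac_le_one (F : Type) [Field F] [Fintype F] (n ℓ₂ m : ℕ)
    (T₁ T₂ : (L : Submodule F (Fin n → F)) → (↥L →ₗ[F] F)) : consistFrac F n ℓ₂ m T₁ T₂ ≤ 1 := by
  refine div_le_one_of_le₀ ?_ (Nat.cast_nonneg _)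
  rw [Nat.cast_le]
  exact Nat.card_le_card_of_injective
    (fun p => (⟨p.1, p.2.1, p.2.2.1, p.2.2.2.1⟩ : {p : Submodule F (Fin n → F) ×
      Submodule F (Fin n → F) // finrank F ↥p.1 = ℓ₂ ∧ finrank F ↥p.2 = m ∧ p.2 ≤ p.1}))
    fun p p' h => Subtype.ext (Subtype.mk.inj h)

open LinFourier in
lemma densityLE_of_not_agree {F X : Type} [Field F] [Fintype F] [AddCommGroup X] [Module F X]
    [Finite X] (T : (L : Submodule F X) → (↥L →ₗ[F] F)) {N rr p b : ℕ} {x : ℝ} (hx : 0 ≤ x)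
    (hp : 0 < p) (hb : 0 < b) (hpb : p + b = rr) {Bd : ℕ → Submodule F X → Prop}
    (hBd : ∀ r Q, (∃ W : Submodule F X, Q ≤ W ∧ finrank F X - finrank F ↥W = rr - r ∧
      ∃ g : ↥W →ₗ[F] F, x / 2 * (Nat.card {L : Submodule F X //
          finrank F ↥L = N ∧ Q ≤ L ∧ L ≤ W} : ℝ) ≤
        (Nat.card {L : Submodule F X // finrank F ↥L = N ∧ Q ≤ L ∧ L ≤ W ∧
          ∀ (y : X) (hxL : y ∈ L) (hxW : y ∈ W), g ⟨y, hxW⟩ = T L ⟨y, hxL⟩} : ℝ)) → Bd r Q)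
    (f : Dual F X) :
    DensityLE (Agree T (fun L => ∀ r, 0 < r → r < rr → ∀ Q ≤ L, finrank F Q = r → ¬ Bd r Q) f)
      N x p b := by
  intro Q W hQW hQ hW
  by_cases h : Bd p Q
  · have : IsEmpty {L : Submodule F X // finrank F L = N ∧ Q ≤ L ∧ L ≤ W ∧ Agree T (fun L =>
        ∀ r, 0 < r → r < rr → ∀ Q ≤ L, finrank F Q = r → ¬ Bd r Q) f L} :=
      ⟨fun L => L.2.2.2.2.1 p hp (by omega) Q L.2.2.1 hQ h⟩
    rw [Nat.card_of_isEmpty, Nat.cast_zero]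
    positivity
  · have hc := cod_add_finrank W
    have h2 := not_le.1 fun hle => h (hBd p Q ⟨W, hQW, by omega, f ∘ₗ W.subtype, hle⟩)
    have h3 : Nat.card {L : Submodule F X // finrank F L = N ∧ Q ≤ L ∧ L ≤ W ∧ Agree T (fun L =>
        ∀ r, 0 < r → r < rr → ∀ Q ≤ L, finrank F Q = r → ¬ Bd r Q) f L} ≤
        Nat.card {L : Submodule F X // finrank F ↥L = N ∧ Q ≤ L ∧ L ≤ W ∧
          ∀ (y : X) (hxL : y ∈ L) (hxW : y ∈ W),
            (f ∘ₗ W.subtype) ⟨y, hxW⟩ = T L ⟨y, hxL⟩} := by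
      refine Nat.card_le_card_of_injective (fun L => ⟨L.1, L.2.1, L.2.2.1, L.2.2.2.1, ?_⟩)
        fun L L' h => Subtype.ext (Subtype.mk.inj h)
      intro y hyL hyW
      exact LinearMap.congr_fun L.2.2.2.2.2 ⟨y, hyL⟩
    have h3' := (Nat.cast_le (α := ℝ)).2 h3
    have h4 : (0 : ℝ) ≤ x * Nat.card {L : Submodule F X // finrank F ↥L = N ∧ Q ≤ L ∧ L ≤ W} := by
      positivity
    linarith

lemma rpow_neg_mul_one_sub {q : ℝ} (hq : 0 < q) {ℓ k : ℕ} {δ : ℝ} (hk : (k : ℝ) = 2 * δ * ℓ) :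
    2 * q ^ (-(2 * (ℓ : ℝ) * (1 - 1000 * δ))) = 2 * q ^ (1000 * k) / q ^ (2 * ℓ) := by
  rw [mul_div_assoc, ← Real.rpow_natCast, ← Real.rpow_natCast, ← Real.rpow_sub hq]
  congr 2
  push_cast
  rw [hk]
  ring

lemma two_mul_pow_mul_le {q : ℝ} (hq : 2 ≤ q) {ℓ rr : ℕ} (h : rr + 1 ≤ ℓ) :
    rr * q ^ (2 * ℓ * rr) * q ^ (-(5 * (ℓ : ℝ) ^ 2)) ≤ (q ^ (2 * ℓ))⁻¹ / 2 := by
  have hq0 : 0 < q := by linarith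
  have h1 : q ^ (-(5 * (ℓ : ℝ) ^ 2)) = (q ^ (5 * ℓ ^ 2))⁻¹ := by
    rw [Real.rpow_neg hq0.le, ← Real.rpow_natCast q (5 * ℓ ^ 2)]
    push_cast
    rfl
  have h2 : (2 : ℝ) * rr ≤ q ^ (rr + 1) := by
    calc (2 : ℝ) * rr ≤ 2 * 2 ^ rr := by
          gcongr
          exact_mod_cast Nat.lt_two_pow_self.le
      _ = 2 ^ (rr + 1) := by ring
      _ ≤ _ := by gcongr
  have h3 : (2 : ℝ) * rr * q ^ (2 * ℓ * (rr + 1)) ≤ q ^ (5 * ℓ ^ 2) := by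
    calc _ ≤ q ^ (rr + 1) * q ^ (2 * ℓ * (rr + 1)) := by gcongr
      _ = q ^ ((2 * ℓ + 1) * (rr + 1)) := by rw [← pow_add]; congr 1; ring
      _ ≤ _ := by
        apply pow_le_pow_right₀ (by linarith)
        nlinarith
  rw [h1, ← div_eq_mul_inv, div_le_iff₀ (by positivity)]
  rw [mul_add, pow_add, mul_one] at h3
  have h4 : 0 < q ^ (2 * ℓ) := by positivity
  rw [inv_eq_one_div, div_div, div_mul_eq_mul_div, one_mul, le_div_iff₀ (by positivity)]
  linarith

open LinFourier in
lemma exists_zoom_of_le_consistFrac (F : Type) [Field F] [Fintype F] {rr j : ℕ} (hrr : 20 < rr)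
    {C : ℝ} (hC0 : 0 ≤ C) (hCj : 16 * C ≤ 2 ^ j)
    (hC : ∀ (E₁ E₂ X : Type) [AddCommGroup E₁] [Module F E₁] [Finite E₁] [AddCommGroup E₂]
      [Module F E₂] [Finite E₂] [AddCommGroup X] [Module F X] [Finite X]
      (T₁ T₂ : (L : Submodule F X) → (L →ₗ[F] F)) (S : Submodule F X → Prop) (ξ lam c : ℝ) (N : ℕ),
      N = finrank F E₁ + finrank F E₂ → N < finrank F X → rr - 1 + 1 ≤ N →
      (∀ f p b, 0 < p → 0 < b → p + b = rr - 1 + 1 → DensityLE (Agree T₁ S f) N ξ p b) →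
      0 < ξ → ξ ≤ 1 → ξ⁻¹ ≤ (Fintype.card F : ℝ) ^ N →
      2 * N ≤ finrank F E₂ * (rr - 1 - 2 * rr / 5) → 4 * N ≤ finrank F E₂ * (2 * rr / 5 + 1) →
      0 < lam →
      c * (Fintype.card F : ℝ) ^ (N * finrank F X) ≤ Nat.card {M : E₁ × E₂ →ₗ[F] X //
        LinearMap.ker M = ⊥ ∧ (S (LinearMap.range M) ∧
          Consistent T₁ T₂ (LinearMap.range M, LinearMap.range (M ∘ₗ LinearMap.inl F E₁ E₂)))} →
      c ≤ lam * (Fintype.card F : ℝ) ^ finrank F E₂ + (Fintype.card F : ℝ) ^ N *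
        ((C * ξ ^ 2) ^ rr / lam ^ (2 * rr - 1) + 2 * ((Fintype.card F : ℝ) ^ (2 * N))⁻¹))
    {n ℓ m k : ℕ} (hℓ : rr * (j + 2) ≤ ℓ) (hmk : m + k = 2 * ℓ) (hk : rr * k = 10 * (2 * ℓ))
    (hn : 4 * ℓ + 1 ≤ n) (T₁ T₂ : (L : Submodule F (Fin n → F)) → (↥L →ₗ[F] F)) {x ε : ℝ}
    (hx0 : 0 < x) (hx1 : x ≤ 1) (hxi : x⁻¹ ≤ (Fintype.card F : ℝ) ^ (2 * ℓ))
    (hx : x * (Fintype.card F : ℝ) ^ (2 * ℓ) ≤ (Fintype.card F : ℝ) ^ k)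
    (hε : ε = 2 * (Fintype.card F : ℝ) ^ (1000 * k) / (Fintype.card F : ℝ) ^ (2 * ℓ))
    (hcons : ε ≤ consistFrac F n (2 * ℓ) m T₁ T₂) :
    ∃ r, 0 < r ∧ r < rr ∧ (Fintype.card F : ℝ) ^ (-(5 * (ℓ : ℝ) ^ 2)) *
        (Nat.card {Q : Submodule F (Fin n → F) // finrank F ↥Q = r} : ℝ) ≤
      (Nat.card {Q : Submodule F (Fin n → F) // finrank F ↥Q = r ∧
        ∃ W : Submodule F (Fin n → F), Q ≤ W ∧ n - finrank F ↥W = rr - r ∧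
          ∃ g : ↥W →ₗ[F] F,
            x / 2 * (Nat.card {L : Submodule F (Fin n → F) //
                finrank F ↥L = 2 * ℓ ∧ Q ≤ L ∧ L ≤ W} : ℝ) ≤
              (Nat.card {L : Submodule F (Fin n → F) //
                finrank F ↥L = 2 * ℓ ∧ Q ≤ L ∧ L ≤ W ∧
                  ∀ (y : Fin n → F) (hxL : y ∈ L) (hxW : y ∈ W),
                    g ⟨y, hxW⟩ = T₁ L ⟨y, hxL⟩} : ℝ)} : ℝ) := by
  by_contra hcon
  push Not at hcon
  have hq : (2 : ℝ) ≤ Fintype.card F := by exact_mod_cast Fintype.one_lt_card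
  have hm : finrank F (Fin m → F) = m := finrank_fin_fun F
  have hk' : finrank F (Fin k → F) = k := finrank_fin_fun F
  have hn' : finrank F (Fin n → F) = n := finrank_fin_fun F
  have hjk : j + 2 ≤ k := by
    have : rr * (j + 2) ≤ rr * k := by omega
    exact le_of_mul_le_mul_left this (by omega)
  have hrr1 : rr + 1 ≤ ℓ := by nlinarith
  have hε0 : 0 < ε := by rw [hε]; positivity
  set Bd : ℕ → Submodule F (Fin n → F) → Prop := fun r Q =>
    ∃ W : Submodule F (Fin n → F), Q ≤ W ∧ n - finrank F ↥W = rr - r ∧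
      ∃ g : ↥W →ₗ[F] F, x / 2 * (Nat.card {L : Submodule F (Fin n → F) //
          finrank F ↥L = 2 * ℓ ∧ Q ≤ L ∧ L ≤ W} : ℝ) ≤
        (Nat.card {L : Submodule F (Fin n → F) // finrank F ↥L = 2 * ℓ ∧ Q ≤ L ∧ L ≤ W ∧
          ∀ (y : Fin n → F) (hxL : y ∈ L) (hxW : y ∈ W), g ⟨y, hxW⟩ = T₁ L ⟨y, hxL⟩} : ℝ)
    with hBd
  have hgood := card_good_ge (E₁ := Fin m → F) (E₂ := Fin k → F) T₁ T₂ (ε := ε) (rr := rr)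
    (Bd := Bd) (β := (Fintype.card F : ℝ) ^ (-(5 * (ℓ : ℝ) ^ 2))) (by positivity) hε0.le
    (by rw [hm, hk', hn']; omega) (by rw [hm, hk', hmk]; exact hcons)
    (fun r h0 h1 => (hcon r h0 h1).le)
    (by
      rw [hm, hk', hmk]
      refine (two_mul_pow_mul_le hq hrr1).trans ?_
      have h1 : (1 : ℝ) ≤ (Fintype.card F : ℝ) ^ (1000 * k) := one_le_pow₀ (by linarith)
      have h2 : (0 : ℝ) < ((Fintype.card F : ℝ) ^ (2 * ℓ))⁻¹ := by positivity
      rw [hε, div_eq_mul_inv (2 * _)]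
      nlinarith)
  rw [hm, hk', hmk] at hgood
  have hd1 : 5 * (2 * rr / 5 + 1) ≥ 2 * rr := by omega
  have hd2 : 5 * (rr - 1 - 2 * rr / 5) ≥ rr := by omega
  have hfin := hC (Fin m → F) (Fin k → F) (Fin n → F) T₁ T₂
    (fun L => ∀ r, 0 < r → r < rr → ∀ Q ≤ L, finrank F Q = r → ¬ Bd r Q) x
    (ε / (8 * (Fintype.card F : ℝ) ^ k)) (ε / 4) (2 * ℓ) (by rw [hm, hk', hmk])
    (by rw [hn']; omega) (by omega)
    (fun f p b hp hb hpb => densityLE_of_not_agree T₁ hx0.le hp hb (by omega)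
      (fun r Q h => by rw [hn'] at h; exact h) f)
    hx0 hx1 hxi (by rw [hk']; nlinarith) (by rw [hk']; nlinarith) (by positivity) hgood
  rw [hk'] at hfin
  refine absurd hfin (not_le.2 (error_lt hq hC0 (hCj.trans ?_) (by omega) (by omega) (by omega) hk
    hx0.le hx hε rfl))
  calc (2 : ℝ) ^ j ≤ (Fintype.card F : ℝ) ^ j := by gcongr
    _ ≤ _ := pow_le_pow_right₀ (by linarith) (by omega)

/-- Theorem 5.2, many successful zoom-ins.  Let `q` be a prime power and
`0 < δ < 1/2` with `r = 10/δ ∈ ℕ`.  For all sufficiently large `ℓ` and all sufficiently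
large `n`, if tables `T₁`, `T₂` are `ε`-consistent for some `ε ≥ 2 q^(-2ℓ(1-1000δ))`, then
there are positive `r₁, r₂` with `r₁ + r₂ = 10/δ` such that for at least a `q^(-5ℓ²)`
fraction of the `r₁`-dimensional `Q ⊆ F_q^n` there are a subspace `W ⊇ Q` of codimension
`r₂` and a linear `g : W → F_q` agreeing with `T₁[L]` for at least a `q^(-2ℓ(1-1000δ²))/2`
fraction of the `2ℓ`-dimensional `L` with `Q ⊆ L ⊆ W`. -/
theorem stmt5 (F : Type) [Field F] [Fintype F] (δ : ℝ) (hδ0 : 0 < δ) (hδ : δ < 1 / 2)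
    (rr : ℕ) (hrr : (rr : ℝ) = 10 / δ) :
    ∃ ℓ₀ : ℕ, ∀ ℓ : ℕ, ℓ₀ ≤ ℓ → ∀ m : ℕ, (m : ℝ) = 2 * (1 - δ) * ℓ →
      ∃ n₀ : ℕ, ∀ n : ℕ, n₀ ≤ n →
        ∀ (T₁ T₂ : (L : Submodule F (Fin n → F)) → (↥L →ₗ[F] F)) (ε : ℝ),
          2 * (Fintype.card F : ℝ) ^ (-(2 * (ℓ : ℝ) * (1 - 1000 * δ))) ≤ ε →
          ε ≤ consistFrac F n (2 * ℓ) m T₁ T₂ →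
          ∃ r₁ r₂ : ℕ, 0 < r₁ ∧ 0 < r₂ ∧ r₁ + r₂ = rr ∧
            (Fintype.card F : ℝ) ^ (-(5 * (ℓ : ℝ) ^ 2)) *
                (Nat.card {Q : Submodule F (Fin n → F) // finrank F ↥Q = r₁} : ℝ) ≤
              (Nat.card {Q : Submodule F (Fin n → F) // finrank F ↥Q = r₁ ∧
                ∃ W : Submodule F (Fin n → F), Q ≤ W ∧ n - finrank F ↥W = r₂ ∧
                  ∃ g : ↥W →ₗ[F] F,
                    (Fintype.card F : ℝ) ^ (-(2 * (ℓ : ℝ) * (1 - 1000 * δ ^ 2))) / 2 *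
                        (Nat.card {L : Submodule F (Fin n → F) //
                          finrank F ↥L = 2 * ℓ ∧ Q ≤ L ∧ L ≤ W} : ℝ) ≤
                      (Nat.card {L : Submodule F (Fin n → F) //
                        finrank F ↥L = 2 * ℓ ∧ Q ≤ L ∧ L ≤ W ∧
                          ∀ (x : Fin n → F) (hxL : x ∈ L) (hxW : x ∈ W),
                            g ⟨x, hxW⟩ = T₁ L ⟨x, hxL⟩} : ℝ)} : ℝ) := by
  have hδrr : δ * rr = 10 := by rw [hrr]; field_simp
  have hrr20 : 20 < rr := by
    have : (20 : ℝ) < rr := by nlinarith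
    exact_mod_cast this
  obtain ⟨C, hC0, hC⟩ := LinFourier.exists_le_of_densityLE F (r := rr - 1) (d := 2 * rr / 5)
    (by omega) (by omega) (t := rr) (by omega)
  obtain ⟨j, hj⟩ := pow_unbounded_of_one_lt (16 * C) (one_lt_two (α := ℝ))
  have hq : (2 : ℝ) ≤ Fintype.card F := by exact_mod_cast Fintype.one_lt_card
  have hq1 : (1 : ℝ) ≤ Fintype.card F := by linarith
  have hq0 : (0 : ℝ) < Fintype.card F := by linarith
  refine ⟨rr * (j + 2), fun ℓ hℓ m hm => ⟨4 * ℓ + 1, fun n hn T₁ T₂ ε hε hcons => ?_⟩⟩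
  rcases le_or_gt (1 / 1000) δ with hδ' | hδ'
  · exfalso
    have h1 := consistFrac_le_one F n (2 * ℓ) m T₁ T₂
    have h2 : (1 : ℝ) ≤ (Fintype.card F : ℝ) ^ (-(2 * (ℓ : ℝ) * (1 - 1000 * δ))) := by
      refine Real.one_le_rpow hq1 ?_
      have : (0 : ℝ) ≤ ℓ := Nat.cast_nonneg _
      nlinarith
    linarith
  have hℓ0 : (0 : ℝ) ≤ ℓ := Nat.cast_nonneg _
  have hmℓ : m ≤ 2 * ℓ := by
    have : (m : ℝ) ≤ 2 * ℓ := by rw [hm]; nlinarith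
    exact_mod_cast this
  obtain ⟨k, hmk⟩ := Nat.exists_eq_add_of_le hmℓ
  have hk : (k : ℝ) = 2 * δ * ℓ := by
    have : (2 : ℝ) * ℓ = m + k := by exact_mod_cast hmk
    linarith
  have hrk : rr * k = 10 * (2 * ℓ) := by
    have : (rr : ℝ) * k = 10 * (2 * ℓ) := by rw [hk, ← hδrr]; ring
    exact_mod_cast this
  obtain ⟨r, h0, h1, h2⟩ := exists_zoom_of_le_consistFrac F hrr20 hC0 hj.le hC hℓ hmk.symm hrk hn
    T₁ T₂ (x := (Fintype.card F : ℝ) ^ (-(2 * (ℓ : ℝ) * (1 - 1000 * δ ^ 2)))) (by positivity)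
    (by
      refine Real.rpow_le_one_of_one_le_of_nonpos hq1 ?_
      have : 0 ≤ 1 - 1000 * δ ^ 2 := by nlinarith
      have := mul_nonneg hℓ0 this
      linarith)
    (by
      rw [← Real.rpow_neg hq0.le, ← Real.rpow_natCast _ (2 * ℓ)]
      apply Real.rpow_le_rpow_of_exponent_le hq1
      push_cast
      have := mul_nonneg hℓ0 (sq_nonneg δ)
      linarith)
    (by
      rw [← Real.rpow_natCast _ (2 * ℓ), ← Real.rpow_natCast _ k, ← Real.rpow_add hq0]
      apply Real.rpow_le_rpow_of_exponent_le hq1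
      push_cast
      rw [hk]
      have : 0 ≤ δ * (1 - 1000 * δ) := by apply mul_nonneg <;> linarith
      have := mul_nonneg hℓ0 this
      linarith)
    rfl ((rpow_neg_mul_one_sub hq0 hk).symm.le.trans (hε.trans hcons))
  exact ⟨r, rr - r, h0, by omega, by omega, h2⟩
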